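/- (Existence and uniqueness.) Let T > 0, let φ : ℝ → ℝ be continuous and nondecreasing, let μ be a Lévy measure on ℝ^N \ {0}, and let u₀ ∈ L^∞(ℝ^N) ∩ L¹(ℝ^N). Then there exists a unique distributional solution u of ∂_t u − L^μ[φ(u)] = 0 in Q_T with initial datum u₀ satisfying u ∈ L^∞(Q_T) ∩ L¹(Q_T) ∩ C([0,T]; L¹_loc(ℝ^N)). -/

import Mathlib

open MeasureTheory Set Filter

noncomputable section

/-- Euclidean space `ℝ^N`. -/
abbrev Euc (N : ℕ) := EuclideanSpace ℝ (Fin N)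

variable {N : ℕ}

/-- `μ` is a (symmetric) Lévy measure on `ℝ^N ∖ {0}` : it is a nonnegative measure giving no
mass to `{0}`, symmetric (`μ(−B) = μ(B)`), and `∫ min(|z|²,1) dμ(z) < ∞`. -/
def IsLevyMeasure (μ : Measure (Euc N)) : Prop :=
  μ {0} = 0 ∧ μ.map (fun z => -z) = μ ∧
    ∫⁻ z, ENNReal.ofReal (min (‖z‖ ^ 2) 1) ∂μ ≠ ⊤

/-- The nonlocal operator
`L^μ[ψ](x) = ∫ (ψ(x+z) − ψ(x) − z·Dψ(x) 1_{|z|≤1}) dμ(z)`. -/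
def Lop (μ : Measure (Euc N)) (ψ : Euc N → ℝ) (x : Euc N) : ℝ :=
  ∫ z, (ψ (x + z) - ψ x - (if ‖z‖ ≤ 1 then fderiv ℝ ψ x z else 0)) ∂μ

/-- `ψ ∈ C_c^∞(ℝ^N)`. -/
def IsTestFn (ψ : Euc N → ℝ) : Prop :=
  ContDiff ℝ (⊤ : ℕ∞) ψ ∧ HasCompactSupport ψ

/-- `ψ ∈ C_c^∞(ℝ^N × [0,T))` : smooth, compactly supported, and the support stays away
from `t = T` (but may touch `t = 0`). -/
def IsSTTestFn (T : ℝ) (ψ : Euc N → ℝ → ℝ) : Prop :=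
  ContDiff ℝ (⊤ : ℕ∞) (Function.uncurry ψ) ∧ HasCompactSupport (Function.uncurry ψ) ∧
    tsupport (Function.uncurry ψ) ⊆ {p : Euc N × ℝ | p.2 < T}

/-- `ψ ∈ C_c^∞(Q_T)` : smooth, compactly supported inside the open cylinder
`ℝ^N × (0,T)`. -/
def IsIntTestFn (T : ℝ) (ψ : Euc N → ℝ → ℝ) : Prop :=
  ContDiff ℝ (⊤ : ℕ∞) (Function.uncurry ψ) ∧ HasCompactSupport (Function.uncurry ψ) ∧
    tsupport (Function.uncurry ψ) ⊆ {p : Euc N × ℝ | 0 < p.2 ∧ p.2 < T}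

/-- The natural measure on the cylinder `Q_T = ℝ^N × (0,T)`. -/
def QTvol (N : ℕ) (T : ℝ) : Measure (Euc N × ℝ) :=
  (volume : Measure (Euc N)).prod ((volume : Measure ℝ).restrict (Ioo 0 T))

/-- `u ∈ L^∞(Q_T)`. -/
def MemLinfQT (T : ℝ) (u : Euc N → ℝ → ℝ) : Prop :=
  AEStronglyMeasurable (fun p : Euc N × ℝ => u p.1 p.2) (QTvol N T) ∧
    ∃ C : ℝ, ∀ᵐ p ∂(QTvol N T), |u p.1 p.2| ≤ C

/-- `u ∈ L¹(Q_T)`. -/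
def MemL1QT (T : ℝ) (u : Euc N → ℝ → ℝ) : Prop :=
  Integrable (fun p : Euc N × ℝ => u p.1 p.2) (QTvol N T)

/-- `u ∈ C([0,T]; L¹_loc(ℝ^N))` : for every compact `K`, `t ↦ u(·,t)` is continuous
from `[0,T]` into `L¹(K)`. -/
def MemCL1loc (T : ℝ) (u : Euc N → ℝ → ℝ) : Prop :=
  ∀ K : Set (Euc N), IsCompact K →
    (∀ t ∈ Icc (0 : ℝ) T, IntegrableOn (fun x => u x t) K) ∧
    ∀ t ∈ Icc (0 : ℝ) T,
      Tendsto (fun s => ∫ x in K, |u x s - u x t|) (nhdsWithin t (Icc 0 T)) (nhds 0)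

/-- `u` is a distributional solution of `∂_t u − A[φ(u)] = 0` in `Q_T` with initial
datum `u0` : for all `ψ ∈ C_c^∞(ℝ^N × [0,T))`,
`∫₀^T ∫ (u ∂_t ψ + φ(u) A[ψ(·,t)]) dx dt + ∫ u0(x) ψ(x,0) dx = 0`. -/
def IsDistSolOp (T : ℝ) (A : (Euc N → ℝ) → Euc N → ℝ) (φ : ℝ → ℝ)
    (u0 : Euc N → ℝ) (u : Euc N → ℝ → ℝ) : Prop :=
  ∀ ψ : Euc N → ℝ → ℝ, IsSTTestFn T ψ →
    (∫ t in Ioo (0 : ℝ) T, ∫ x,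
        (u x t * deriv (ψ x) t + φ (u x t) * A (fun y => ψ y t) x))
      + ∫ x, u0 x * ψ x 0 = 0

/-- `u0 ∈ L^∞(ℝ^N)`. -/
def MemLinfRn (u0 : Euc N → ℝ) : Prop :=
  AEStronglyMeasurable u0 (volume : Measure (Euc N)) ∧
    ∃ C : ℝ, ∀ᵐ x : Euc N ∂volume, |u0 x| ≤ C

end

open scoped Topology ENNReal

/-- The nonlocal operator of a finite jump measure, without gradient correction. -/
noncomputable def jumpOp {N : ℕ} (ν : Measure (Euc N)) (f : Euc N → ℝ) (x : Euc N) : ℝ :=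
  ∫ z, (f (x + z) - f x) ∂ν

/-- Average of the translates of `f` with weight `ρ`. -/
noncomputable def mollify {N : ℕ} (ρ f : Euc N → ℝ) (x : Euc N) : ℝ :=
  ∫ y, f (x + y) * ρ y

/-- `ρ` is a smooth probability density supported in the ball of radius `δ`. -/
structure IsMollifier {N : ℕ} (δ : ℝ) (ρ : Euc N → ℝ) : Prop where
  isTestFn : IsTestFn ρ
  nonneg : ∀ y, 0 ≤ ρ y
  integral_eq_one : ∫ y, ρ y = 1
  eq_zero : ∀ y, δ ≤ ‖y‖ → ρ y = 0

lemma exists_isMollifier {N : ℕ} {δ : ℝ} (hδ : 0 < δ) : ∃ ρ : Euc N → ℝ, IsMollifier δ ρ := by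
  let b : ContDiffBump (0 : Euc N) := ⟨δ / 2, δ, by positivity, by linarith⟩
  refine ⟨b.normed volume, ⟨b.contDiff_normed, b.hasCompactSupport_normed⟩, b.nonneg_normed,
    b.integral_normed, fun y hy => ?_⟩
  have := b.support_normed_eq (μ := (volume : Measure (Euc N)))
  by_contra h
  have h' : y ∈ Function.support (b.normed volume) := h
  rw [this] at h'
  simp [b] at h'
  linarith

lemma IsTestFn.measurable {N : ℕ} {ψ : Euc N → ℝ} (h : IsTestFn ψ) : Measurable ψ :=
  h.1.continuous.measurable

lemma IsTestFn.integrable {N : ℕ} {ψ : Euc N → ℝ} (h : IsTestFn ψ) : Integrable ψ :=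
  h.1.continuous.integrable_of_hasCompactSupport h.2

lemma tendsto_integral_translate_sub {N : ℕ} {f : Euc N → ℝ} (hf : Integrable f) :
    Tendsto (fun y => ∫ x, |f (x + y) - f x|) (𝓝 0) (𝓝 0) := by
  let F : Lp ℝ 1 (volume : Measure (Euc N)) := hf.toL1 f
  have : Fact ((1 : ℝ≥0∞) ≠ ∞) := ⟨ENNReal.one_ne_top⟩
  have hc : Tendsto (fun y : Euc N => ‖((DomAddAct.mk y) +ᵥ F) - F‖) (𝓝 0) (𝓝 0) := by
    have h1 : Continuous (fun y : Euc N => ‖((DomAddAct.mk y) +ᵥ F) - F‖) :=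
      by
        have h0 : Continuous (fun y : Euc N => (DomAddAct.mk y) +ᵥ F) :=
          Continuous.comp (g := fun c : (Euc N)ᵈᵃᵃ => c +ᵥ F) (by fun_prop) DomAddAct.continuous_mk
        exact (h0.sub continuous_const).norm
    have := h1.tendsto 0
    simpa using this
  refine hc.congr fun y => ?_
  rw [L1.norm_eq_integral_norm]
  refine integral_congr_ae ?_
  have h1 : (F : Euc N → ℝ) =ᵐ[volume] f := hf.coeFn_toL1
  have h2 := DomAddAct.vadd_Lp_ae_eq (DomAddAct.mk y) F
  have hq : MeasurePreserving (fun x : Euc N => y +ᵥ x) volume volume :=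
    measurePreserving_vadd y volume
  have h3 := hq.quasiMeasurePreserving.ae_eq_comp h1
  filter_upwards [Lp.coeFn_sub ((DomAddAct.mk y) +ᵥ F) F, h1, h2, h3] with x a1 a2 a3 a4
  rw [a1, Pi.sub_apply, a2, a3]
  simp only [Function.comp_apply] at a4
  rw [Equiv.symm_apply_apply, a4]
  simp [add_comm]

section Sym
variable {N : ℕ} {ν : Measure (Euc N)}

lemma measurePreserving_jump [SFinite ν] (hs : ν.map (fun z => -z) = ν) :
    MeasurePreserving (fun p : Euc N × Euc N => (p.1 + p.2, -p.2))
      ((volume : Measure (Euc N)).prod ν) ((volume : Measure (Euc N)).prod ν) := by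
  have hm : Measurable (fun p : Euc N × Euc N => (p.1 + p.2, -p.2)) := by fun_prop
  refine ⟨hm, ?_⟩
  ext s hs'
  rw [Measure.map_apply hm hs', Measure.prod_apply_symm (hm hs'), Measure.prod_apply_symm hs']
  have hg : Measurable fun z => (volume : Measure (Euc N)) ((fun x => (x, z)) ⁻¹' s) :=
    measurable_measure_prodMk_right hs'
  conv_rhs => rw [← hs]
  rw [lintegral_map hg (by fun_prop)]
  refine lintegral_congr fun z => ?_
  have : (fun x : Euc N => (x, z)) ⁻¹' ((fun p : Euc N × Euc N => (p.1 + p.2, -p.2)) ⁻¹' s)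
      = (fun x => x + z) ⁻¹' ((fun x => (x, -z)) ⁻¹' s) := rfl
  rw [this, measure_preimage_add_right]

variable [IsFiniteMeasure ν]

lemma integrable_prod_fst_mul {f : Euc N → ℝ} (hf : Integrable f)
    {g : Euc N × Euc N → ℝ} (hg : Measurable g) {C : ℝ} (hC : ∀ p, |g p| ≤ C) :
    Integrable (fun p : Euc N × Euc N => f p.1 * g p) ((volume : Measure (Euc N)).prod ν) := by
  refine Integrable.mul_bdd (c := C) (hf.comp_fst ν) hg.aestronglyMeasurable (ae_of_all _ hC)

lemma integrable_prod_shift_mul (hs : ν.map (fun z => -z) = ν) {f : Euc N → ℝ} (hf : Integrable f)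
    {g : Euc N × Euc N → ℝ} (hg : Measurable g) {C : ℝ} (hC : ∀ p, |g p| ≤ C) :
    Integrable (fun p : Euc N × Euc N => f (p.1 + p.2) * g p)
      ((volume : Measure (Euc N)).prod ν) := by
  have h := (measurePreserving_jump hs).integrable_comp_of_integrable (hf.comp_fst ν)
  refine Integrable.mul_bdd (c := C) h hg.aestronglyMeasurable (ae_of_all _ hC)

lemma integral_prod_swap_jump (hs : ν.map (fun z => -z) = ν) (h : Euc N × Euc N → ℝ) :
    ∫ p, h (p.1 + p.2, -p.2) ∂((volume : Measure (Euc N)).prod ν)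
      = ∫ p, h p ∂((volume : Measure (Euc N)).prod ν) := by
  have hmp := measurePreserving_jump hs
  have hi : Function.Involutive (fun p : Euc N × Euc N => (p.1 + p.2, -p.2)) := by
    intro p; simp
  let e : (Euc N × Euc N) ≃ᵐ (Euc N × Euc N) :=
    { toFun := fun p => (p.1 + p.2, -p.2), invFun := fun p => (p.1 + p.2, -p.2),
      left_inv := hi, right_inv := hi
      measurable_toFun := hmp.measurable, measurable_invFun := hmp.measurable }
  exact hmp.integral_comp e.measurableEmbedding h

lemma measurable_jumpOp {g : Euc N → ℝ} (hg : Measurable g) : Measurable (jumpOp ν g) := by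
  have : StronglyMeasurable (Function.uncurry fun x z : Euc N => g (x + z) - g x) := by
    apply Measurable.stronglyMeasurable; unfold Function.uncurry; fun_prop
  exact this.integral_prod_right.measurable

lemma integrable_translate_bdd {g : Euc N → ℝ} (hg : Measurable g) {C : ℝ} (hC : ∀ x, |g x| ≤ C)
    (x : Euc N) : Integrable (fun z => g (x + z)) ν :=
  Integrable.of_bound (by apply Measurable.aestronglyMeasurable; fun_prop) C
    (ae_of_all _ fun z => hC _)

lemma abs_jumpOp_le {g : Euc N → ℝ} {C : ℝ} (hC : ∀ x, |g x| ≤ C)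
    (x : Euc N) : |jumpOp ν g x| ≤ 2 * C * ν.real univ := by
  have := norm_integral_le_of_norm_le_const (μ := ν) (f := fun z => g (x + z) - g x) (C := 2 * C)
    (ae_of_all _ fun z => by
      have h1 := hC (x + z); have h2 := hC x
      rw [Real.norm_eq_abs]
      rw [abs_le] at *; constructor <;> linarith)
  simpa [jumpOp] using this

lemma integrable_jumpOp (hs : ν.map (fun z => -z) = ν) {ρ : Euc N → ℝ}
    (hi : Integrable ρ) : Integrable (jumpOp ν ρ) := by
  have h1 := integrable_prod_fst_mul (ν := ν) hi (g := fun _ => 1) measurable_const (C := 1)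
    (by simp)
  have h2 := integrable_prod_shift_mul (ν := ν) hs hi (g := fun _ => 1) measurable_const (C := 1)
    (by simp)
  have := (h2.sub h1).integral_prod_left
  exact this.congr (ae_of_all _ fun x => by simp [jumpOp])

lemma integral_abs_jumpOp_le (hs : ν.map (fun z => -z) = ν) {ρ : Euc N → ℝ}
    (hi : Integrable ρ) : ∫ x, |jumpOp ν ρ x| ≤ 2 * ν.real univ * ∫ x, |ρ x| := by
  have h1 := integrable_prod_fst_mul (ν := ν) hi.abs (g := fun _ => 1) measurable_const (C := 1)
    (by simp)
  have h2 := integrable_prod_shift_mul (ν := ν) hs hi.abs (g := fun _ => 1) measurable_const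
    (C := 1) (by simp)
  have h3 := h2.add h1
  calc ∫ x, |jumpOp ν ρ x| ≤ ∫ x, ∫ z, (|ρ (x + z)| * 1 + |ρ x| * 1) ∂ν := by
        refine integral_mono_of_nonneg (ae_of_all _ fun x => abs_nonneg _) h3.integral_prod_left ?_
        filter_upwards [h3.prod_right_ae] with x hx
        refine (abs_integral_le_integral_abs).trans (integral_mono_of_nonneg
          (ae_of_all _ fun _ => abs_nonneg _) hx (ae_of_all _ fun z => ?_))
        simpa using abs_sub (ρ (x + z)) (ρ x)
    _ = ∫ p : Euc N × Euc N, (|ρ (p.1 + p.2)| * 1 + |ρ p.1| * 1)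
          ∂((volume : Measure (Euc N)).prod ν) := (integral_prod _ h3).symm
    _ = ∫ p : Euc N × Euc N, |ρ (p.1 + p.2)| * 1 ∂((volume : Measure (Euc N)).prod ν)
        + ∫ p : Euc N × Euc N, |ρ p.1| * 1 ∂((volume : Measure (Euc N)).prod ν) :=
          integral_add h2 h1
    _ = 2 * ν.real univ * ∫ x, |ρ x| := by
        have e1 := integral_prod_swap_jump (ν := ν) hs (fun p => |ρ p.1| * 1)
        simp only at e1
        rw [e1, integral_prod _ h1]
        simp only [mul_one, integral_const, smul_eq_mul, integral_const_mul]
        ring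

lemma integral_jumpOp_mul (hs : ν.map (fun z => -z) = ν) {g ρ : Euc N → ℝ} (hg : Measurable g)
    {C : ℝ} (hC : ∀ x, |g x| ≤ C) (hi : Integrable ρ) :
    ∫ x, jumpOp ν g x * ρ x = ∫ x, g x * jumpOp ν ρ x := by
  have i1 := integrable_prod_fst_mul (ν := ν) hi (g := fun p => g (p.1 + p.2)) (by fun_prop)
    (fun p => hC _)
  have i2 := integrable_prod_fst_mul (ν := ν) hi (g := fun p => g p.1) (by fun_prop)
    (fun p => hC _)
  have i3 := integrable_prod_shift_mul (ν := ν) hs hi (g := fun p => g p.1) (by fun_prop)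
    (fun p => hC _)
  have e1 : ∫ x, jumpOp ν g x * ρ x = ∫ p : Euc N × Euc N,
      (ρ p.1 * g (p.1 + p.2) - ρ p.1 * g p.1) ∂((volume : Measure (Euc N)).prod ν) := by
    rw [integral_prod _ (show Integrable (fun p : Euc N × Euc N =>
      ρ p.1 * g (p.1 + p.2) - ρ p.1 * g p.1) _ from i1.sub i2)]
    refine integral_congr_ae (ae_of_all _ fun x => ?_)
    simp only [jumpOp, ← integral_mul_const]
    exact integral_congr_ae (ae_of_all _ fun z => by ring)
  have e2 : ∫ x, g x * jumpOp ν ρ x = ∫ p : Euc N × Euc N,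
      (ρ (p.1 + p.2) * g p.1 - ρ p.1 * g p.1) ∂((volume : Measure (Euc N)).prod ν) := by
    rw [integral_prod _ (show Integrable (fun p : Euc N × Euc N =>
      ρ (p.1 + p.2) * g p.1 - ρ p.1 * g p.1) _ from i3.sub i2)]
    refine integral_congr_ae (ae_of_all _ fun x => ?_)
    simp only [jumpOp, ← integral_const_mul]
    exact integral_congr_ae (ae_of_all _ fun z => by ring)
  rw [e1, e2, integral_sub i1 i2, integral_sub i3 i2]
  congr 1
  have := integral_prod_swap_jump (ν := ν) hs (fun p => ρ p.1 * g (p.1 + p.2))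
  simpa using this.symm

lemma integral_mul_jumpOp (hs : ν.map (fun z => -z) = ν) {f g : Euc N → ℝ} (hg : Measurable g)
    {C : ℝ} (hC : ∀ x, |g x| ≤ C) (hi : Integrable f) :
    ∫ x, f x * jumpOp ν g x = -(1 / 2) * ∫ p : Euc N × Euc N,
      (f (p.1 + p.2) - f p.1) * (g (p.1 + p.2) - g p.1) ∂((volume : Measure (Euc N)).prod ν) := by
  have hb : ∀ p : Euc N × Euc N, |g (p.1 + p.2) - g p.1| ≤ 2 * C := fun p => by
    have h1 := hC (p.1 + p.2); have h2 := hC p.1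
    rw [abs_le] at *; constructor <;> linarith
  have i1 := integrable_prod_fst_mul (ν := ν) hi (g := fun p => g (p.1 + p.2) - g p.1)
    (by fun_prop) hb
  have i2 := integrable_prod_shift_mul (ν := ν) hs hi (g := fun p => g (p.1 + p.2) - g p.1)
    (by fun_prop) hb
  have e1 : ∫ x, f x * jumpOp ν g x = ∫ p : Euc N × Euc N,
      f p.1 * (g (p.1 + p.2) - g p.1) ∂((volume : Measure (Euc N)).prod ν) := by
    rw [integral_prod _ i1]
    refine integral_congr_ae (ae_of_all _ fun x => ?_)
    simp only [jumpOp, ← integral_const_mul]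
  have e2 := integral_prod_swap_jump (ν := ν) hs
    (fun p => f (p.1 + p.2) * (g (p.1 + p.2) - g p.1))
  simp only [add_neg_cancel_right] at e2
  have e3 : ∫ p : Euc N × Euc N, f p.1 * (g p.1 - g (p.1 + p.2))
      ∂((volume : Measure (Euc N)).prod ν) = - ∫ x, f x * jumpOp ν g x := by
    rw [e1, ← integral_neg]
    exact integral_congr_ae (ae_of_all _ fun z => by ring)
  simp only [sub_mul]
  rw [integral_sub i2 i1, ← e2, e3, e1]
  ring

end Sym

section Levy
variable {N : ℕ} {μ : Measure (Euc N)}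

/-- The part of a Lévy measure carried by jumps of size larger than `r`. -/
noncomputable def truncMeasure {N : ℕ} (μ : Measure (Euc N)) (r : ℝ) : Measure (Euc N) :=
  μ.restrict {z | r < ‖z‖}

lemma measurableSet_lt_norm (r : ℝ) : MeasurableSet {z : Euc N | r < ‖z‖} :=
  measurableSet_lt measurable_const measurable_norm

lemma measurableSet_norm_le (r : ℝ) : MeasurableSet {z : Euc N | ‖z‖ ≤ r} :=
  measurableSet_le measurable_norm measurable_const

lemma IsLevyMeasure.measure_lt_top (hμ : IsLevyMeasure μ) {r : ℝ} (hr : 0 < r) :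
    μ {z | r < ‖z‖} < ∞ := by
  set c : ℝ≥0∞ := ENNReal.ofReal (min (r ^ 2) 1) with hc
  have hc0 : c ≠ 0 := by
    rw [hc]; simp only [ne_eq, ENNReal.ofReal_eq_zero, not_le]; positivity
  have h := mul_meas_ge_le_lintegral₀ (μ := μ)
    (f := fun z => ENNReal.ofReal (min (‖z‖ ^ 2) 1)) (by fun_prop) c
  have hsub : {z : Euc N | r < ‖z‖} ⊆ {z | c ≤ ENNReal.ofReal (min (‖z‖ ^ 2) 1)} := by
    intro z hz
    simp only [mem_ofPred_eq] at hz ⊢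
    exact ENNReal.ofReal_le_ofReal (min_le_min_right _ (pow_le_pow_left₀ hr.le hz.le 2))
  refine (measure_mono hsub).trans_lt ?_
  have hlt : c * μ {z | c ≤ ENNReal.ofReal (min (‖z‖ ^ 2) 1)} < ∞ :=
    h.trans_lt (lt_top_iff_ne_top.2 hμ.2.2)
  exact (ENNReal.mul_lt_top_iff.1 hlt).elim (fun h => h.2) (fun h => h.elim
    (fun h => (hc0 h).elim) (fun h => h ▸ ENNReal.zero_lt_top))

lemma IsLevyMeasure.isFiniteMeasure_trunc (hμ : IsLevyMeasure μ) {r : ℝ} (hr : 0 < r) :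
    IsFiniteMeasure (truncMeasure μ r) :=
  ⟨by simpa [truncMeasure] using hμ.measure_lt_top hr⟩

lemma IsLevyMeasure.map_neg_trunc (hμ : IsLevyMeasure μ) (r : ℝ) :
    (truncMeasure μ r).map (fun z => -z) = truncMeasure μ r := by
  unfold truncMeasure
  conv_rhs => rw [← hμ.2.1]
  rw [Measure.restrict_map (by fun_prop) (measurableSet_lt_norm r)]
  simp

lemma IsLevyMeasure.sigmaFinite (hμ : IsLevyMeasure μ) : SigmaFinite μ := by
  refine ⟨⟨⟨fun n => {0} ∪ {z | 1 / ((n : ℝ) + 1) < ‖z‖}, fun _ => trivial, fun n => ?_, ?_⟩⟩⟩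
  · refine (measure_union_le _ _).trans_lt ?_
    rw [hμ.1, zero_add]
    exact hμ.measure_lt_top (by positivity)
  · refine eq_univ_of_forall fun z => mem_iUnion.2 ?_
    by_cases hz : z = 0
    · exact ⟨0, Or.inl hz⟩
    · obtain ⟨n, hn⟩ := exists_nat_one_div_lt (norm_pos_iff.2 hz)
      exact ⟨n, Or.inr hn⟩

lemma IsLevyMeasure.integrableOn_sq (hμ : IsLevyMeasure μ) :
    IntegrableOn (fun z : Euc N => ‖z‖ ^ 2) {z | ‖z‖ ≤ 1} μ := by
  refine ⟨by fun_prop, ?_⟩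
  rw [hasFiniteIntegral_iff_ofReal (ae_of_all _ fun z => by positivity)]
  refine lt_of_le_of_lt ?_ (lt_top_iff_ne_top.2 hμ.2.2)
  refine le_trans (setLIntegral_mono' (measurableSet_norm_le 1) fun z hz => ?_)
    (setLIntegral_le_lintegral _ _)
  simp only [mem_ofPred_eq] at hz
  refine ENNReal.ofReal_le_ofReal (le_min le_rfl ?_)
  exact pow_le_one₀ (norm_nonneg z) hz

/-- Second moment of the jumps of size at most `r`. -/
noncomputable def smallMoment {N : ℕ} (μ : Measure (Euc N)) (r : ℝ) : ℝ :=
  ∫ z in {z : Euc N | ‖z‖ ≤ r}, ‖z‖ ^ 2 ∂μ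

lemma smallMoment_nonneg (r : ℝ) : 0 ≤ smallMoment μ r :=
  integral_nonneg fun z => by positivity

lemma IsLevyMeasure.smallMoment_le (hμ : IsLevyMeasure μ) {r : ℝ} (hr : r ≤ 1) :
    smallMoment μ r ≤ smallMoment μ 1 :=
  setIntegral_mono_set hμ.integrableOn_sq (ae_of_all _ fun z => by positivity)
    (LE.le.eventuallyLE fun z (hz : ‖z‖ ≤ r) => hz.trans hr)

lemma IsLevyMeasure.tendsto_smallMoment (hμ : IsLevyMeasure μ) :
    Tendsto (fun n : ℕ => smallMoment μ (1 / ((n : ℝ) + 1))) atTop (𝓝 0) := by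
  have h := tendsto_setIntegral_of_antitone (μ := μ) (f := fun z : Euc N => ‖z‖ ^ 2)
    (s := fun n : ℕ => {z | ‖z‖ ≤ 1 / ((n : ℝ) + 1)})
    (fun n => measurableSet_norm_le _)
    (fun m n hmn z (hz : ‖z‖ ≤ _) => hz.trans (Nat.one_div_le_one_div hmn))
    ⟨0, by simpa using hμ.integrableOn_sq⟩
  have h0 : ⋂ n : ℕ, {z : Euc N | ‖z‖ ≤ 1 / ((n : ℝ) + 1)} = {0} := by
    ext z
    simp only [mem_iInter, mem_ofPred_eq, mem_singleton_iff]
    constructor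
    · intro hz
      by_contra h0
      obtain ⟨n, hn⟩ := exists_nat_one_div_lt (norm_pos_iff.2 h0)
      exact absurd (hz n) (not_le.2 hn)
    · rintro rfl n
      simp; positivity
  rw [h0] at h
  have h1 : ∫ z in ({0} : Set (Euc N)), ‖z‖ ^ 2 ∂μ = 0 :=
    setIntegral_measure_zero _ hμ.1
  rw [h1] at h
  exact h

/-- Quantitative smoothness and support bounds for a test function. -/
structure IsSlice {N : ℕ} (A R C : ℝ) (ψ : Euc N → ℝ) : Prop where
  contDiff : ContDiff ℝ (⊤ : ℕ∞) ψ
  nonneg : 0 ≤ A ∧ 0 ≤ R ∧ 0 ≤ C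
  taylor : ∀ x z, |ψ (x + z) - ψ x - fderiv ℝ ψ x z| ≤ A * ‖z‖ ^ 2
  supp : ∀ x, R < ‖x‖ → ψ x = 0
  bdd : ∀ x, |ψ x| ≤ C

lemma exists_taylor_bound {G : Type*} [NormedAddCommGroup G] [NormedSpace ℝ G] {F : G → ℝ}
    (hF : ContDiff ℝ (⊤ : ℕ∞) F) (hs : HasCompactSupport F) :
    ∃ A : ℝ, 0 ≤ A ∧ ∀ p q, |F (p + q) - F p - fderiv ℝ F p q| ≤ A * ‖q‖ ^ 2 := by
  have h1 : ContDiff ℝ (1 : ℕ∞) (fderiv ℝ F) := hF.fderiv_right (by norm_cast)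
  obtain ⟨K, hK⟩ := h1.lipschitzWith_of_hasCompactSupport (hs.fderiv ℝ) (by simp)
  refine ⟨K, K.2, fun p q => ?_⟩
  have hd : ∀ x ∈ Metric.closedBall p ‖q‖, DifferentiableAt ℝ F x := fun x _ =>
    (hF.differentiable (by simp)).differentiableAt
  have hb : ∀ x ∈ Metric.closedBall p ‖q‖, ‖fderiv ℝ F x - fderiv ℝ F p‖ ≤ K * ‖q‖ := by
    intro x hx
    refine (hK.norm_sub_le x p).trans ?_
    gcongr
    simpa [dist_eq_norm] using hx
  have := (convex_closedBall p ‖q‖).norm_image_sub_le_of_norm_fderiv_le' hd hb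
    (Metric.mem_closedBall_self (norm_nonneg q)) (y := p + q) (by simp)
  simp only [add_sub_cancel_left, Real.norm_eq_abs] at this
  rw [pow_two, ← mul_assoc]; exact this

lemma IsSTTestFn.exists_isSlice {T : ℝ} {ψ : Euc N → ℝ → ℝ} (hψ : IsSTTestFn T ψ) :
    ∃ A R C, ∀ t, IsSlice A R C (fun x => ψ x t) := by
  obtain ⟨A, hA, hT⟩ := exists_taylor_bound hψ.1 hψ.2.1
  obtain ⟨R, hR⟩ := hψ.2.1.isCompact.isBounded.exists_norm_le
  obtain ⟨C, hC⟩ := hψ.1.continuous.bounded_above_of_compact_support hψ.2.1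
  have hcd : ∀ t : ℝ, ContDiff ℝ (⊤ : ℕ∞) (fun x => ψ x t) := fun t =>
    hψ.1.comp (contDiff_id.prodMk contDiff_const)
  refine ⟨A, max R 0, max C 0, fun t => ⟨hcd t, ⟨hA, le_max_right _ _, le_max_right _ _⟩, ?_, ?_,
    fun x => (hC (x, t)).trans (le_max_left _ _)⟩⟩
  · intro x z
    have h := hT (x, t) (z, 0)
    have hf : fderiv ℝ (fun x => ψ x t) x z = fderiv ℝ (Function.uncurry ψ) (x, t) (z, 0) := by
      have h1 : HasFDerivAt (fun x : Euc N => (x, t)) (ContinuousLinearMap.inl ℝ (Euc N) ℝ) x :=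
        hasFDerivAt_prodMk_left x t
      have h2 := ((hψ.1.differentiable (by simp)).differentiableAt (x := (x, t))).hasFDerivAt
      have h3 := (HasFDerivAt.comp x h2 h1).fderiv
      have h4 : (Function.uncurry ψ ∘ fun x : Euc N => (x, t)) = fun x => ψ x t := rfl
      rw [h4] at h3
      rw [h3]; simp
    rw [hf]
    simpa using h
  · intro x hx
    have : (x, t) ∉ tsupport (Function.uncurry ψ) := fun hm => by
      have := hR _ hm
      have h2 : ‖x‖ ≤ ‖(x, t)‖ := norm_fst_le (x, t)
      linarith [le_max_left R 0]
    exact image_eq_zero_of_notMem_tsupport (f := Function.uncurry ψ) this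

lemma IsTestFn.exists_isSlice {ψ : Euc N → ℝ} (hψ : IsTestFn ψ) :
    ∃ A R C, IsSlice A R C ψ := by
  obtain ⟨A, hA, hT⟩ := exists_taylor_bound hψ.1 hψ.2
  obtain ⟨R, hR⟩ := hψ.2.isCompact.isBounded.exists_norm_le
  obtain ⟨C, hC⟩ := hψ.1.continuous.bounded_above_of_compact_support hψ.2
  refine ⟨A, max R 0, max C 0, ⟨hψ.1, ⟨hA, le_max_right _ _, le_max_right _ _⟩, hT, ?_,
    fun x => (hC x).trans (le_max_left _ _)⟩⟩
  intro x hx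
  have : x ∉ tsupport ψ := fun hm => by
    have := hR _ hm
    linarith [le_max_left R 0]
  exact image_eq_zero_of_notMem_tsupport this

lemma measurable_Lop_uncurry [SFinite μ] {ψ : Euc N → ℝ → ℝ}
    (hψ : ContDiff ℝ (⊤ : ℕ∞) (Function.uncurry ψ)) :
    Measurable (fun p : Euc N × ℝ => Lop μ (fun y => ψ y p.2) p.1) := by
  have hc : Continuous (Function.uncurry ψ) := hψ.continuous
  have hf : ∀ x t z, fderiv ℝ (fun x => ψ x t) x z
      = fderiv ℝ (Function.uncurry ψ) (x, t) (z, 0) := by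
    intro x t z
    have h1 : HasFDerivAt (fun x : Euc N => (x, t)) (ContinuousLinearMap.inl ℝ (Euc N) ℝ) x :=
      hasFDerivAt_prodMk_left x t
    have h2 := ((hψ.differentiable (by simp)).differentiableAt (x := (x, t))).hasFDerivAt
    have h3 := (HasFDerivAt.comp x h2 h1).fderiv
    have h4 : (Function.uncurry ψ ∘ fun x : Euc N => (x, t)) = fun x => ψ x t := rfl
    rw [h4] at h3
    rw [h3]; simp
  have hcf : Continuous (fderiv ℝ (Function.uncurry ψ)) :=
    hψ.continuous_fderiv (by simp)
  have h1 : Continuous (fun q : (Euc N × ℝ) × Euc N => Function.uncurry ψ (q.1.1 + q.2, q.1.2)) :=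
    hc.comp (by fun_prop)
  have h2 : Continuous (fun q : (Euc N × ℝ) × Euc N => Function.uncurry ψ q.1) :=
    hc.comp (by fun_prop)
  have h3 : Continuous (fun q : (Euc N × ℝ) × Euc N =>
      fderiv ℝ (Function.uncurry ψ) q.1 (q.2, 0)) :=
    (hcf.comp continuous_fst).clm_apply (by fun_prop)
  have hm : Measurable (fun q : (Euc N × ℝ) × Euc N =>
      ψ (q.1.1 + q.2) q.1.2 - ψ q.1.1 q.1.2 -
        (if ‖q.2‖ ≤ 1 then fderiv ℝ (fun x => ψ x q.1.2) q.1.1 q.2 else 0)) := by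
    simp only [hf]
    exact (h1.measurable.sub h2.measurable).sub (Measurable.ite
      (measurableSet_le (by fun_prop) measurable_const) h3.measurable measurable_const)
  exact (StronglyMeasurable.integral_prod_right (f := fun (p : Euc N × ℝ) (z : Euc N) =>
    ψ (p.1 + z) p.2 - ψ p.1 p.2 -
        (if ‖z‖ ≤ 1 then fderiv ℝ (fun x => ψ x p.2) p.1 z else 0))
        hm.stronglyMeasurable).measurable

lemma measurable_Lop [SFinite μ] {ψ : Euc N → ℝ} (hψ : ContDiff ℝ (⊤ : ℕ∞) ψ) :
    Measurable (Lop μ ψ) := by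
  have := measurable_Lop_uncurry (μ := μ) (ψ := fun x (_ : ℝ) => ψ x) (hψ.comp contDiff_fst)
  exact this.comp (measurable_id.prodMk (measurable_const (a := (0 : ℝ))))

variable {A R C : ℝ} {ψ : Euc N → ℝ}

lemma IsSlice.integrable (h : IsSlice A R C ψ) : Integrable ψ :=
  h.contDiff.continuous.integrable_of_hasCompactSupport
    (HasCompactSupport.of_support_subset_isCompact (isCompact_closedBall (0 : Euc N) R)
      fun x hx => by
        by_contra hn
        exact hx (h.supp x (by simpa using hn)))

lemma IsSlice.integral_abs_le (h : IsSlice A R C ψ) :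
    ∫ x, |ψ x| ≤ C * (volume : Measure (Euc N)).real (Metric.closedBall 0 R) := by
  rw [mul_comm, ← smul_eq_mul, ← integral_indicator_const C measurableSet_closedBall]
  refine integral_mono_of_nonneg (ae_of_all _ fun x => abs_nonneg _)
    ((integrable_indicator_iff measurableSet_closedBall).2
      (integrableOn_const (measure_closedBall_lt_top.ne))) (ae_of_all _ fun x => ?_)
  by_cases hx : x ∈ Metric.closedBall (0 : Euc N) R
  · simpa [indicator_of_mem hx] using h.bdd x
  · simp [indicator_of_notMem hx, h.supp x (by simpa using hx)]

lemma IsSlice.abs_Lop_sub_jumpOp_le (hμ : IsLevyMeasure μ) (h : IsSlice A R C ψ) {r : ℝ}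
    (hr : 0 < r) (hr1 : r ≤ 1) (x : Euc N) :
    |Lop μ ψ x - jumpOp (truncMeasure μ r) ψ x|
      ≤ (Metric.closedBall (0 : Euc N) (R + 1)).indicator (fun _ => A * smallMoment μ r) x := by
  have hfin := hμ.isFiniteMeasure_trunc hr
  have hψm : Measurable ψ := h.contDiff.continuous.measurable
  set D := fderiv ℝ ψ x with hD
  set q : Euc N → ℝ := fun z => ψ (x + z) - ψ x - (if ‖z‖ ≤ 1 then D z else 0) with hq
  have hqm : Measurable q := by
    refine Measurable.sub (by fun_prop) (Measurable.ite (measurableSet_norm_le 1)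
      D.continuous.measurable measurable_const)
  have hqs : ∀ z, ‖z‖ ≤ 1 → q z = ψ (x + z) - ψ x - D z := fun z hz => by simp [hq, hz]
  have i1 : IntegrableOn q {z | ‖z‖ ≤ r} μ := by
    refine Integrable.mono' ((hμ.integrableOn_sq.mono_set
      (fun z (hz : ‖z‖ ≤ r) => hz.trans hr1)).const_mul A) hqm.aestronglyMeasurable ?_
    filter_upwards [ae_restrict_mem (measurableSet_norm_le r)] with z hz
    rw [Real.norm_eq_abs, hqs z (le_trans hz hr1)]
    exact h.taylor x z
  have iD : Integrable (fun z => if ‖z‖ ≤ 1 then D z else 0) (truncMeasure μ r) := by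
    refine Integrable.of_bound ((Measurable.ite (measurableSet_norm_le 1)
      D.continuous.measurable measurable_const).aestronglyMeasurable) ‖D‖
      (ae_of_all _ fun z => ?_)
    split_ifs with hz
    · exact (D.le_opNorm z).trans (mul_le_of_le_one_right (norm_nonneg _) hz)
    · simp
  have iψ : Integrable (fun z => ψ (x + z) - ψ x) (truncMeasure μ r) :=
    (integrable_translate_bdd hψm h.bdd x).sub (integrable_const _)
  have i2 : IntegrableOn q {z | r < ‖z‖} μ := iψ.sub iD
  have hD0 : ∫ z, (if ‖z‖ ≤ 1 then D z else 0) ∂(truncMeasure μ r) = 0 := by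
    have e : ∫ z, (if ‖z‖ ≤ 1 then D z else 0) ∂(truncMeasure μ r)
        = ∫ z, (if ‖-z‖ ≤ 1 then D (-z) else 0) ∂(truncMeasure μ r) := by
      conv_lhs => rw [← hμ.map_neg_trunc r]
      exact integral_map_equiv (MeasurableEquiv.neg (Euc N)) _
    have e2 : ∫ z, (if ‖-z‖ ≤ 1 then D (-z) else 0) ∂(truncMeasure μ r)
        = - ∫ z, (if ‖z‖ ≤ 1 then D z else 0) ∂(truncMeasure μ r) := by
      rw [← integral_neg]
      refine integral_congr_ae (ae_of_all _ fun z => ?_)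
      simp only [norm_neg, map_neg]
      split_ifs <;> simp
    linarith
  have hcompl : {z : Euc N | ‖z‖ ≤ r}ᶜ = {z | r < ‖z‖} := by ext z; simp
  have hsplit : Lop μ ψ x = ∫ z in {z | ‖z‖ ≤ r}, q z ∂μ + jumpOp (truncMeasure μ r) ψ x := by
    have hqi : Integrable q μ := by
      have := i1.union i2
      rwa [← hcompl, union_compl_self, integrableOn_univ] at this
    have e := integral_add_compl (measurableSet_norm_le r) hqi
    rw [hcompl] at e
    have e2 : ∫ z in {z | r < ‖z‖}, q z ∂μ = jumpOp (truncMeasure μ r) ψ x := by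
      change ∫ z, q z ∂(truncMeasure μ r) = _
      rw [hq, integral_sub iψ iD, hD0, sub_zero]; rfl
    rw [← e2, e]; rfl
  rw [hsplit, add_sub_cancel_right]
  by_cases hx : x ∈ Metric.closedBall (0 : Euc N) (R + 1)
  · rw [indicator_of_mem hx, smallMoment, ← integral_const_mul]
    refine abs_integral_le_integral_abs.trans (setIntegral_mono_on i1.abs
      ((hμ.integrableOn_sq.mono_set (fun z (hz : ‖z‖ ≤ r) => hz.trans hr1)).const_mul A)
      (measurableSet_norm_le r) fun z hz => ?_)
    rw [hqs z (le_trans hz hr1)]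
    exact h.taylor x z
  · rw [indicator_of_notMem hx]
    have hx' : R + 1 < ‖x‖ := by simpa using hx
    have hD0 : D = 0 := by
      have : ψ =ᶠ[𝓝 x] fun _ => 0 := by
        filter_upwards [(isOpen_lt continuous_const continuous_norm).mem_nhds
          (show R < ‖x‖ by linarith)] with y hy using h.supp y hy
      rw [hD, this.fderiv_eq]; simp
    have : ∫ z in {z | ‖z‖ ≤ r}, q z ∂μ = 0 := by
      refine setIntegral_eq_zero_of_forall_eq_zero fun z hz => ?_
      have hz1 : ‖z‖ ≤ 1 := le_trans hz hr1
      have hxz : R < ‖x + z‖ := by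
        have := norm_sub_le (x + z) z
        simp only [add_sub_cancel_right] at this
        linarith
      rw [hqs z hz1, hD0, h.supp _ hxz, h.supp x (by linarith)]; simp
    rw [this]; simp

lemma IsSlice.integral_abs_Lop_sub_jumpOp_le (hμ : IsLevyMeasure μ) (h : IsSlice A R C ψ) {r : ℝ}
    (hr : 0 < r) (hr1 : r ≤ 1) :
    ∫ x, |Lop μ ψ x - jumpOp (truncMeasure μ r) ψ x|
      ≤ A * smallMoment μ r * (volume : Measure (Euc N)).real (Metric.closedBall 0 (R + 1)) := by
  rw [mul_comm (A * _), ← smul_eq_mul, ← integral_indicator_const _ measurableSet_closedBall]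
  refine integral_mono_of_nonneg (ae_of_all _ fun x => abs_nonneg _)
    ((integrable_indicator_iff measurableSet_closedBall).2
      (integrableOn_const (measure_closedBall_lt_top.ne)))
    (ae_of_all _ fun x => h.abs_Lop_sub_jumpOp_le hμ hr hr1 x)

lemma IsSlice.integrable_Lop_sub_jumpOp (hμ : IsLevyMeasure μ) (h : IsSlice A R C ψ) {r : ℝ}
    (hr : 0 < r) (hr1 : r ≤ 1) :
    Integrable (fun x => Lop μ ψ x - jumpOp (truncMeasure μ r) ψ x) := by
  have := hμ.sigmaFinite
  have := hμ.isFiniteMeasure_trunc hr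
  refine Integrable.mono' ((integrable_indicator_iff measurableSet_closedBall).2
      (integrableOn_const (measure_closedBall_lt_top.ne)))
    ((measurable_Lop h.contDiff).sub
      (measurable_jumpOp h.contDiff.continuous.measurable)).aestronglyMeasurable
    (ae_of_all _ fun x => h.abs_Lop_sub_jumpOp_le hμ hr hr1 x)

lemma IsSlice.integrable_jumpOp (hμ : IsLevyMeasure μ) (h : IsSlice A R C ψ) {r : ℝ}
    (hr : 0 < r) : Integrable (jumpOp (truncMeasure μ r) ψ) := by
  have := hμ.isFiniteMeasure_trunc hr
  exact _root_.integrable_jumpOp (hμ.map_neg_trunc r) h.integrable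

lemma IsSlice.integrable_Lop (hμ : IsLevyMeasure μ) (h : IsSlice A R C ψ) :
    Integrable (Lop μ ψ) := by
  have := (h.integrable_Lop_sub_jumpOp hμ one_pos le_rfl).add (h.integrable_jumpOp hμ one_pos)
  exact this.congr (ae_of_all _ fun x => by simp)

/-- A bound for the `L¹` norm of the operator on slices, uniform over truncations. -/
noncomputable def sliceConst {N : ℕ} (μ : Measure (Euc N)) (A R C : ℝ) : ℝ :=
  2 * (A * smallMoment μ 1 * (volume : Measure (Euc N)).real (Metric.closedBall 0 (R + 1)))
    + 2 * (truncMeasure μ 1).real univ *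
      (C * (volume : Measure (Euc N)).real (Metric.closedBall 0 R))

lemma IsSlice.integral_abs_Lop_le (hμ : IsLevyMeasure μ) (h : IsSlice A R C ψ) :
    ∫ x, |Lop μ ψ x| ≤ sliceConst μ A R C -
      A * smallMoment μ 1 * (volume : Measure (Euc N)).real (Metric.closedBall 0 (R + 1)) := by
  have := hμ.isFiniteMeasure_trunc one_pos
  have i1 := h.integrable_Lop_sub_jumpOp hμ one_pos le_rfl
  have i2 := h.integrable_jumpOp hμ one_pos
  have e1 := h.integral_abs_Lop_sub_jumpOp_le hμ one_pos le_rfl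
  have e2 := integral_abs_jumpOp_le (hμ.map_neg_trunc 1) h.integrable
  have e3 : ∫ x, |Lop μ ψ x| ≤ ∫ x, (|Lop μ ψ x - jumpOp (truncMeasure μ 1) ψ x|
      + |jumpOp (truncMeasure μ 1) ψ x|) :=
    integral_mono (h.integrable_Lop hμ).abs (i1.abs.add i2.abs) fun x => by
      simpa using abs_add_le (Lop μ ψ x - jumpOp (truncMeasure μ 1) ψ x)
        (jumpOp (truncMeasure μ 1) ψ x)
  rw [integral_add i1.abs i2.abs] at e3
  have e4 := mul_le_mul_of_nonneg_left h.integral_abs_le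
    (show 0 ≤ 2 * (truncMeasure μ 1).real univ by positivity)
  unfold sliceConst
  linarith

lemma IsSlice.integral_abs_jumpOp_le (hμ : IsLevyMeasure μ) (h : IsSlice A R C ψ) {r : ℝ}
    (hr : 0 < r) (hr1 : r ≤ 1) :
    ∫ x, |jumpOp (truncMeasure μ r) ψ x| ≤ sliceConst μ A R C := by
  have i1 := h.integrable_Lop_sub_jumpOp hμ hr hr1
  have i2 := h.integrable_Lop hμ
  have e1 := h.integral_abs_Lop_sub_jumpOp_le hμ hr hr1
  have e2 := h.integral_abs_Lop_le hμ
  have e3 : ∫ x, |jumpOp (truncMeasure μ r) ψ x| ≤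
      ∫ x, (|Lop μ ψ x - jumpOp (truncMeasure μ r) ψ x| + |Lop μ ψ x|) :=
    integral_mono (h.integrable_jumpOp hμ hr).abs (i1.abs.add i2.abs) fun x => by
      have := abs_sub (Lop μ ψ x) (Lop μ ψ x - jumpOp (truncMeasure μ r) ψ x)
      simp only [sub_sub_cancel] at this
      simp only
      linarith
  rw [integral_add i1.abs i2.abs] at e3
  have e5 : A * smallMoment μ r * (volume : Measure (Euc N)).real (Metric.closedBall 0 (R + 1)) ≤
      A * smallMoment μ 1 * (volume : Measure (Euc N)).real (Metric.closedBall 0 (R + 1)) := by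
    have := h.nonneg.1
    have := hμ.smallMoment_le hr1
    gcongr
  linarith

end Levy

lemma lintegral_le_of_tendsto_pointwise {α : Type*} [MeasurableSpace α] {m : Measure α}
    {f : ℕ → α → ℝ≥0∞} {g : α → ℝ≥0∞} (hf : ∀ n, Measurable (f n))
    (hlim : ∀ᵐ x ∂m, Tendsto (fun n => f n x) atTop (𝓝 (g x))) {b : ℕ → ℝ≥0∞} {B : ℝ≥0∞}
    (hb : ∀ n, ∫⁻ x, f n x ∂m ≤ b n) (hB : Tendsto b atTop (𝓝 B)) : ∫⁻ x, g x ∂m ≤ B := by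
  calc ∫⁻ x, g x ∂m = ∫⁻ x, liminf (fun n => f n x) atTop ∂m :=
        lintegral_congr_ae (hlim.mono fun x hx => hx.liminf_eq.symm)
    _ ≤ liminf (fun n => ∫⁻ x, f n x ∂m) atTop := lintegral_liminf_le hf
    _ ≤ liminf b atTop := liminf_le_liminf (Eventually.of_forall hb)
    _ = B := hB.liminf_eq

/-- Soft thresholding at level `δ`. -/
noncomputable def softThreshold (δ s : ℝ) : ℝ := s - max (-δ) (min δ s)

lemma measurable_softThreshold (δ : ℝ) : Measurable (softThreshold δ) := by
  unfold softThreshold; fun_prop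

lemma softThreshold_sub {δ a b : ℝ} (h : b ≤ a) :
    0 ≤ softThreshold δ a - softThreshold δ b ∧
      softThreshold δ a - softThreshold δ b ≤ a - b := by
  unfold softThreshold
  constructor
  · have : max (-δ) (min δ a) ≤ max (-δ) (min δ b) + (a - b) := by
      refine max_le ?_ ?_
      · linarith [le_max_left (-δ) (min δ b)]
      · have h1 : min δ a ≤ min δ b + (a - b) := by
          rcases min_cases δ b with h2 | h2 <;> rcases min_cases δ a with h3 | h3 <;> linarith
        linarith [le_max_right (-δ) (min δ b)]
    linarith
  · have : max (-δ) (min δ b) ≤ max (-δ) (min δ a) := by gcongr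
    linarith

lemma softThreshold_sq_le (δ a b : ℝ) : (softThreshold δ a - softThreshold δ b) ^ 2 ≤
    (softThreshold δ a - softThreshold δ b) * (a - b) := by
  rcases le_total b a with h | h
  · obtain ⟨h1, h2⟩ := softThreshold_sub (δ := δ) h
    nlinarith
  · obtain ⟨h1, h2⟩ := softThreshold_sub (δ := δ) h
    nlinarith

lemma abs_softThreshold_sub_le (δ a b : ℝ) :
    |softThreshold δ a - softThreshold δ b| ≤ |a - b| := by
  rcases le_total b a with h | h
  · obtain ⟨h1, h2⟩ := softThreshold_sub (δ := δ) h
    rw [abs_of_nonneg h1, abs_of_nonneg (by linarith)]; exact h2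
  · obtain ⟨h1, h2⟩ := softThreshold_sub (δ := δ) h
    rw [abs_sub_comm, abs_sub_comm a, abs_of_nonneg h1, abs_of_nonneg (by linarith)]; exact h2

lemma abs_softThreshold_sub_self_le {δ : ℝ} (hδ : 0 ≤ δ) (s : ℝ) : |softThreshold δ s - s| ≤ δ := by
  have : softThreshold δ s - s = -max (-δ) (min δ s) := by unfold softThreshold; ring
  rw [this, abs_neg, abs_le]
  exact ⟨le_max_left _ _, max_le (by linarith) (min_le_left _ _)⟩

lemma softThreshold_zero {δ : ℝ} (hδ : 0 ≤ δ) : softThreshold δ 0 = 0 := by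
  simp [softThreshold, hδ]

lemma abs_softThreshold_le {δ : ℝ} (hδ : 0 ≤ δ) (s : ℝ) : |softThreshold δ s| ≤ |s| := by
  simpa [softThreshold_zero hδ] using abs_softThreshold_sub_le δ s 0

lemma abs_softThreshold_le_of_abs_le {δ k s : ℝ} (h : |s| ≤ δ + k) (hk : 0 ≤ k) :
    |softThreshold δ s| ≤ k := by
  unfold softThreshold
  rw [abs_le] at *
  rcases max_cases (-δ) (min δ s) with h1 | h1 <;> rcases min_cases δ s with h2 | h2 <;>
    constructor <;> linarith

lemma tendsto_softThreshold {δ : ℕ → ℝ} (h0 : ∀ n, 0 ≤ δ n) (h : Tendsto δ atTop (𝓝 0)) (s : ℝ) :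
    Tendsto (fun n => softThreshold (δ n) s) atTop (𝓝 s) := by
  rw [tendsto_iff_norm_sub_tendsto_zero]
  exact squeeze_zero (fun _ => norm_nonneg _) (fun n => abs_softThreshold_sub_self_le (h0 n) s) h

section Energy
variable {N : ℕ} {μ : Measure (Euc N)}

/-- `f` is bounded, small at infinity, and its truncated operators converge boundedly to the
integrable function `F`. -/
structure IsEnergy {N : ℕ} (μ : Measure (Euc N)) (f F : Euc N → ℝ) : Prop where
  measurable : Measurable f
  bdd : ∃ C, ∀ x, |f x| ≤ C
  small : ∀ δ > 0, ∃ k : Euc N → ℝ, Integrable k ∧ ∀ᵐ x, |f x| ≤ δ + |k x|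
  integrable : Integrable F
  bdd_jumpOp : ∃ C, ∀ (n : ℕ) x, |jumpOp (truncMeasure μ (1 / ((n : ℝ) + 1))) f x| ≤ C
  tendsto : ∀ᵐ x, Tendsto (fun n : ℕ => jumpOp (truncMeasure μ (1 / ((n : ℝ) + 1))) f x)
    atTop (𝓝 (F x))

variable {f F g G : Euc N → ℝ}

lemma IsEnergy.integrable_softThreshold (h : IsEnergy μ f F) {δ : ℝ} (hδ : 0 < δ) :
    Integrable (fun x => softThreshold δ (f x)) := by
  obtain ⟨k, hk, hfk⟩ := h.small δ hδ
  refine Integrable.mono' hk.abs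
    ((measurable_softThreshold δ).comp h.measurable).aestronglyMeasurable ?_
  filter_upwards [hfk] with x hx
  exact abs_softThreshold_le_of_abs_le hx (abs_nonneg _)

lemma IsEnergy.tendsto_integral (hμ : IsLevyMeasure μ) (h : IsEnergy μ g G) (hf : Integrable f) :
    Tendsto (fun n : ℕ => ∫ x, f x * jumpOp (truncMeasure μ (1 / ((n : ℝ) + 1))) g x) atTop
      (𝓝 (∫ x, f x * G x)) := by
  obtain ⟨C, hC⟩ := h.bdd_jumpOp
  have hm : ∀ n : ℕ, AEStronglyMeasurable
      (fun x => f x * jumpOp (truncMeasure μ (1 / ((n : ℝ) + 1))) g x) volume := by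
    intro n
    refine hf.aestronglyMeasurable.mul ?_
    have hr : (0 : ℝ) < 1 / ((n : ℝ) + 1) := by positivity
    have := hμ.isFiniteMeasure_trunc hr
    exact (measurable_jumpOp h.measurable).aestronglyMeasurable
  refine tendsto_integral_of_dominated_convergence (fun x => C * |f x|) hm
    (hf.abs.const_mul C) (fun n => ae_of_all _ fun x => ?_) ?_
  · rw [Real.norm_eq_abs, abs_mul, mul_comm]
    exact mul_le_mul_of_nonneg_right (hC n x) (abs_nonneg _)
  · filter_upwards [h.tendsto] with x hx using hx.const_mul _

lemma truncMeasure_prod [SFinite μ] (r : ℝ) : (volume : Measure (Euc N)).prod (truncMeasure μ r)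
    = ((volume : Measure (Euc N)).prod μ).restrict (univ ×ˢ {z | r < ‖z‖}) := by
  rw [truncMeasure, ← Measure.prod_restrict, Measure.restrict_univ]

lemma tendsto_indicator_trunc (a : Euc N × Euc N → ℝ) (ha : ∀ x, a (x, 0) = 0)
    (p : Euc N × Euc N) :
    Tendsto (fun n : ℕ => (univ ×ˢ {z : Euc N | 1 / ((n : ℝ) + 1) < ‖z‖}).indicator a p) atTop
      (𝓝 (a p)) := by
  obtain ⟨x, z⟩ := p
  by_cases hz : z = 0
  · subst hz
    have : ∀ n : ℕ, (univ ×ˢ {z : Euc N | 1 / ((n : ℝ) + 1) < ‖z‖}).indicator a (x, 0) = 0 := by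
      intro n
      by_cases h : (x, (0 : Euc N)) ∈ univ ×ˢ {z : Euc N | 1 / ((n : ℝ) + 1) < ‖z‖}
      · rw [indicator_of_mem h, ha]
      · rw [indicator_of_notMem h]
    simp only [this, ha]
    exact tendsto_const_nhds
  · refine tendsto_const_nhds.congr' ?_
    have := tendsto_one_div_add_atTop_nhds_zero_nat (𝕜 := ℝ)
    filter_upwards [this.eventually_lt_const (norm_pos_iff.2 hz)] with n hn
    rw [indicator_of_mem]
    exact ⟨mem_univ _, hn⟩

lemma IsEnergy.lintegral_lt_top (hμ : IsLevyMeasure μ) (h : IsEnergy μ f F) :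
    ∫⁻ p : Euc N × Euc N, ENNReal.ofReal ((f (p.1 + p.2) - f p.1) ^ 2)
      ∂((volume : Measure (Euc N)).prod μ) < ∞ := by
  have := hμ.sigmaFinite
  obtain ⟨C, hC⟩ := h.bdd
  have hfm := h.measurable
  set B : ℝ := C * ∫ x, |F x| with hB
  have step : ∀ δ > 0, ∫⁻ p : Euc N × Euc N,
      ENNReal.ofReal ((softThreshold δ (f (p.1 + p.2)) - softThreshold δ (f p.1)) ^ 2)
      ∂((volume : Measure (Euc N)).prod μ) ≤ ENNReal.ofReal (2 * B) := by
    intro δ hδ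
    have hsm := measurable_softThreshold δ
    have hfi := h.integrable_softThreshold hδ
    have hle : -2 * ∫ x, softThreshold δ (f x) * F x ≤ 2 * B := by
      have : |∫ x, softThreshold δ (f x) * F x| ≤ B := by
        rw [hB, ← integral_const_mul]
        refine abs_integral_le_integral_abs.trans (integral_mono_of_nonneg
          (ae_of_all _ fun x => abs_nonneg _) (h.integrable.abs.const_mul C)
          (ae_of_all _ fun x => ?_))
        simp only [abs_mul]
        exact mul_le_mul_of_nonneg_right ((abs_softThreshold_le hδ.le _).trans (hC x))
          (abs_nonneg _)
      have := (abs_le.1 this).1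
      linarith
    refine le_trans ?_ (ENNReal.ofReal_le_ofReal hle)
    refine lintegral_le_of_tendsto_pointwise
      (f := fun (n : ℕ) => (univ ×ˢ {z : Euc N | 1 / ((n : ℝ) + 1) < ‖z‖}).indicator
        fun p : Euc N × Euc N =>
        ENNReal.ofReal ((softThreshold δ (f (p.1 + p.2)) - softThreshold δ (f p.1)) ^ 2))
      (b := fun n : ℕ => ENNReal.ofReal (-2 * ∫ x, softThreshold δ (f x) *
        jumpOp (truncMeasure μ (1 / ((n : ℝ) + 1))) f x)) (fun n => ?_) (ae_of_all _ fun p => ?_)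
      (fun n => ?_) ?_
    · exact (by fun_prop : Measurable fun p : Euc N × Euc N =>
        ENNReal.ofReal ((softThreshold δ (f (p.1 + p.2)) - softThreshold δ (f p.1)) ^ 2)).indicator
        (MeasurableSet.univ.prod (measurableSet_lt_norm _))
    · have := (ENNReal.continuous_ofReal.tendsto _).comp (tendsto_indicator_trunc (fun p =>
        (softThreshold δ (f (p.1 + p.2)) - softThreshold δ (f p.1)) ^ 2) (by simp) p)
      refine this.congr fun n => ?_
      by_cases hp : p ∈ univ ×ˢ {z : Euc N | 1 / ((n : ℝ) + 1) < ‖z‖}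
      · simp only [Function.comp_apply, indicator_of_mem hp]
      · simp only [Function.comp_apply, indicator_of_notMem hp, ENNReal.ofReal_zero]
    · have hr : (0 : ℝ) < 1 / ((n : ℝ) + 1) := by positivity
      have hfin := hμ.isFiniteMeasure_trunc hr
      have hsymm := hμ.map_neg_trunc (1 / ((n : ℝ) + 1))
      rw [lintegral_indicator (MeasurableSet.univ.prod (measurableSet_lt_norm _)),
        ← truncMeasure_prod, integral_mul_jumpOp hsymm hfm hC hfi]
      have hb : ∀ p : Euc N × Euc N, |f (p.1 + p.2) - f p.1| ≤ 2 * C := fun p => by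
        have h1 := hC (p.1 + p.2); have h2 := hC p.1
        rw [abs_le] at *; constructor <;> linarith
      have i1 := integrable_prod_fst_mul (ν := truncMeasure μ (1 / ((n : ℝ) + 1))) hfi
        (g := fun p => f (p.1 + p.2) - f p.1) (by fun_prop) hb
      have i2 := integrable_prod_shift_mul (ν := truncMeasure μ (1 / ((n : ℝ) + 1))) hsymm hfi
        (g := fun p => f (p.1 + p.2) - f p.1) (by fun_prop) hb
      have i3 := i2.sub i1
      rw [show ∀ y : ℝ, -2 * (-(1 / 2) * y) = y from fun y => by ring,
        ofReal_integral_eq_lintegral_ofReal]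
      · refine lintegral_mono fun p => ENNReal.ofReal_le_ofReal ?_
        exact softThreshold_sq_le δ _ _
      · exact i3.congr (ae_of_all _ fun p => by simp [sub_mul])
      · exact ae_of_all _ fun p => le_trans (sq_nonneg _) (softThreshold_sq_le δ _ _)
    · exact (ENNReal.continuous_ofReal.tendsto _).comp ((h.tendsto_integral hμ hfi).const_mul (-2))
  refine lt_of_le_of_lt (b := ENNReal.ofReal (2 * B)) ?_ ENNReal.ofReal_lt_top
  have hlim := tendsto_one_div_add_atTop_nhds_zero_nat (𝕜 := ℝ)
  refine lintegral_le_of_tendsto_pointwise (f := fun (n : ℕ) (p : Euc N × Euc N) =>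
      ENNReal.ofReal ((softThreshold (1 / ((n : ℝ) + 1)) (f (p.1 + p.2))
        - softThreshold (1 / ((n : ℝ) + 1)) (f p.1)) ^ 2))
    (fun n => ?_) (ae_of_all _ fun p => ?_)
    (fun n => step (1 / ((n : ℝ) + 1)) (by positivity)) tendsto_const_nhds
  · have := measurable_softThreshold (1 / ((n : ℝ) + 1))
    fun_prop
  · refine (ENNReal.continuous_ofReal.tendsto _).comp (Tendsto.pow (Tendsto.sub ?_ ?_) 2)
    · exact tendsto_softThreshold (fun n => by positivity) hlim _
    · exact tendsto_softThreshold (fun n => by positivity) hlim _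

lemma IsEnergy.integrable_sq (hμ : IsLevyMeasure μ) (h : IsEnergy μ f F) :
    Integrable (fun p : Euc N × Euc N => (f (p.1 + p.2) - f p.1) ^ 2)
      ((volume : Measure (Euc N)).prod μ) := by
  have := h.measurable
  refine ⟨by apply Measurable.aestronglyMeasurable; fun_prop, ?_⟩
  rw [hasFiniteIntegral_iff_ofReal (ae_of_all _ fun p => sq_nonneg _)]
  exact h.lintegral_lt_top hμ

lemma IsEnergy.integrable_abs_mul (hμ : IsLevyMeasure μ) (hf : IsEnergy μ f F)
    (hg : IsEnergy μ g G) :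
    Integrable (fun p : Euc N × Euc N => |f (p.1 + p.2) - f p.1| * |g (p.1 + p.2) - g p.1|)
      ((volume : Measure (Euc N)).prod μ) := by
  have h1 := hf.measurable
  have h2 := hg.measurable
  refine Integrable.mono' ((hf.integrable_sq hμ).add (hg.integrable_sq hμ))
    (by apply Measurable.aestronglyMeasurable; fun_prop) (ae_of_all _ fun p => ?_)
  rw [Real.norm_eq_abs, abs_mul, abs_abs, abs_abs]
  simp only [Pi.add_apply]
  rw [← sq_abs (f (p.1 + p.2) - f p.1), ← sq_abs (g (p.1 + p.2) - g p.1)]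
  nlinarith [sq_nonneg (|f (p.1 + p.2) - f p.1| - |g (p.1 + p.2) - g p.1|),
    sq_nonneg (|f (p.1 + p.2) - f p.1|), sq_nonneg (|g (p.1 + p.2) - g p.1|)]

lemma IsEnergy.integral_mul_eq (hμ : IsLevyMeasure μ) (hf : IsEnergy μ f F)
    (hg : IsEnergy μ g G) :
    ∫ x, f x * G x = -(1 / 2) * ∫ p : Euc N × Euc N, (f (p.1 + p.2) - f p.1)
      * (g (p.1 + p.2) - g p.1) ∂((volume : Measure (Euc N)).prod μ) := by
  have := hμ.sigmaFinite
  have hfm := hf.measurable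
  have hgm := hg.measurable
  obtain ⟨Cf, hCf⟩ := hf.bdd
  obtain ⟨Cg, hCg⟩ := hg.bdd
  have hdom := hf.integrable_abs_mul hμ hg
  have step : ∀ δ > 0, ∫ x, softThreshold δ (f x) * G x = -(1 / 2) * ∫ p : Euc N × Euc N,
      (softThreshold δ (f (p.1 + p.2)) - softThreshold δ (f p.1))
      * (g (p.1 + p.2) - g p.1) ∂((volume : Measure (Euc N)).prod μ) := by
    intro δ hδ
    have hsm := measurable_softThreshold δ
    have hfi := hf.integrable_softThreshold hδ
    refine tendsto_nhds_unique (hg.tendsto_integral hμ hfi) ?_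
    set a : Euc N × Euc N → ℝ := fun p =>
      (softThreshold δ (f (p.1 + p.2)) - softThreshold δ (f p.1)) * (g (p.1 + p.2) - g p.1) with ha
    have ham : Measurable a := by fun_prop
    have e : ∀ n : ℕ, ∫ x, softThreshold δ (f x) * jumpOp (truncMeasure μ (1 / ((n : ℝ) + 1))) g x
        = -(1 / 2) * ∫ p, (univ ×ˢ {z : Euc N | 1 / ((n : ℝ) + 1) < ‖z‖}).indicator a p
          ∂((volume : Measure (Euc N)).prod μ) := by
      intro n
      have hr : (0 : ℝ) < 1 / ((n : ℝ) + 1) := by positivity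
      have hfin := hμ.isFiniteMeasure_trunc hr
      rw [integral_mul_jumpOp (hμ.map_neg_trunc _) hgm hCg hfi, truncMeasure_prod,
        integral_indicator (MeasurableSet.univ.prod (measurableSet_lt_norm _))]
    simp only [e]
    refine Tendsto.const_mul _ (tendsto_integral_of_dominated_convergence _ (fun n =>
      (ham.indicator (MeasurableSet.univ.prod (measurableSet_lt_norm _))).aestronglyMeasurable)
      hdom (fun n => ae_of_all _ fun p => ?_)
      (ae_of_all _ fun p => tendsto_indicator_trunc a (by simp [ha]) p))
    refine (norm_indicator_le_norm_self _ _).trans ?_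
    rw [ha, Real.norm_eq_abs, abs_mul]
    exact mul_le_mul_of_nonneg_right (abs_softThreshold_sub_le _ _ _) (abs_nonneg _)
  have hlim := tendsto_one_div_add_atTop_nhds_zero_nat (𝕜 := ℝ)
  have hpos : ∀ n : ℕ, (0 : ℝ) < 1 / ((n : ℝ) + 1) := fun n => by positivity
  have l1 : Tendsto (fun n : ℕ => ∫ x, softThreshold (1 / ((n : ℝ) + 1)) (f x) * G x) atTop
      (𝓝 (∫ x, f x * G x)) := by
    refine tendsto_integral_of_dominated_convergence (fun x => Cf * |G x|) (fun n =>
      ((measurable_softThreshold _).comp hfm).aestronglyMeasurable.mul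
        hg.integrable.aestronglyMeasurable) (hg.integrable.abs.const_mul Cf)
      (fun n => ae_of_all _ fun x => ?_) (ae_of_all _ fun x =>
        (tendsto_softThreshold (fun n => (hpos n).le) hlim _).mul_const _)
    rw [Real.norm_eq_abs, abs_mul]
    exact mul_le_mul_of_nonneg_right ((abs_softThreshold_le (hpos n).le _).trans (hCf x))
      (abs_nonneg _)
  refine tendsto_nhds_unique l1 ?_
  simp only [step _ (hpos _)]
  refine Tendsto.const_mul _ (tendsto_integral_of_dominated_convergence _ (fun n => ?_)
      hdom (fun n => ae_of_all _ fun p => ?_) (ae_of_all _ fun p => ?_))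
  · have := measurable_softThreshold (1 / ((n : ℝ) + 1))
    apply Measurable.aestronglyMeasurable; fun_prop
  · rw [Real.norm_eq_abs, abs_mul]
    exact mul_le_mul_of_nonneg_right (abs_softThreshold_sub_le _ _ _) (abs_nonneg _)
  · exact (Tendsto.sub (tendsto_softThreshold (fun n => (hpos n).le) hlim _)
      (tendsto_softThreshold (fun n => (hpos n).le) hlim _)).mul_const _

lemma IsEnergy.integral_mul_self_nonpos (hμ : IsLevyMeasure μ) (hf : IsEnergy μ f F) :
    ∫ x, f x * F x ≤ 0 := by
  rw [hf.integral_mul_eq hμ hf]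
  have : 0 ≤ ∫ p : Euc N × Euc N, (f (p.1 + p.2) - f p.1) * (f (p.1 + p.2) - f p.1)
      ∂((volume : Measure (Euc N)).prod μ) := integral_nonneg fun p => mul_self_nonneg _
  linarith

lemma IsEnergy.integral_sub_le (hμ : IsLevyMeasure μ) (hf : IsEnergy μ f F)
    (hg : IsEnergy μ g G) :
    (∫ x, g x * G x) - ∫ x, f x * G x ≤
      (1 / 2) * (∫ x, g x * G x) - (1 / 2) * ∫ x, f x * F x := by
  rw [hf.integral_mul_eq hμ hf, hf.integral_mul_eq hμ hg, hg.integral_mul_eq hμ hg]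
  have hfm := hf.measurable
  have hgm := hg.measurable
  have i1 := hf.integrable_sq hμ
  have i2 := hg.integrable_sq hμ
  have i3 : Integrable (fun p : Euc N × Euc N => (f (p.1 + p.2) - f p.1) *
      (g (p.1 + p.2) - g p.1)) ((volume : Measure (Euc N)).prod μ) :=
    Integrable.mono' (hf.integrable_abs_mul hμ hg)
      (by apply Measurable.aestronglyMeasurable; fun_prop)
      (ae_of_all _ fun p => by rw [Real.norm_eq_abs, abs_mul])
  have h0 : 0 ≤ ∫ p : Euc N × Euc N, (((f (p.1 + p.2) - f p.1) ^ 2 +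
      (g (p.1 + p.2) - g p.1) ^ 2) - 2 * ((f (p.1 + p.2) - f p.1) * (g (p.1 + p.2) - g p.1)))
      ∂((volume : Measure (Euc N)).prod μ) := by
    refine integral_nonneg fun p => ?_
    simp only [Pi.zero_apply]
    nlinarith [sq_nonneg ((f (p.1 + p.2) - f p.1) - (g (p.1 + p.2) - g p.1))]
  rw [integral_sub (by exact i1.add i2) (i3.const_mul 2), integral_add i1 i2,
    integral_const_mul] at h0
  simp only [← pow_two]
  linarith

end Energy

section Mollify
variable {N : ℕ} {ρ f g : Euc N → ℝ}

lemma measurable_mollify_uncurry {α : Type*} [MeasurableSpace α] {f : Euc N → α → ℝ}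
    (hf : Measurable (Function.uncurry f)) (hρ : Measurable ρ) :
    Measurable (fun p : Euc N × α => mollify ρ (fun x => f x p.2) p.1) := by
  have : StronglyMeasurable (Function.uncurry fun (p : Euc N × α) (y : Euc N) =>
      f (p.1 + y) p.2 * ρ y) := by
    apply Measurable.stronglyMeasurable
    have h : Measurable (fun q : (Euc N × α) × Euc N => (q.1.1 + q.2, q.1.2)) := by fun_prop
    exact (hf.comp h).mul (hρ.comp measurable_snd)
  exact this.integral_prod_right.measurable

lemma measurable_mollify (hf : Measurable f) (hρ : Measurable ρ) : Measurable (mollify ρ f) :=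
  (measurable_mollify_uncurry (f := fun x (_ : Unit) => f x) (hf.comp measurable_fst) hρ).comp
    (measurable_id.prodMk (measurable_const (a := ())))

lemma integrable_mollify_integrand (hf : Measurable f) (hρ : Integrable ρ) {C : ℝ}
    (hC : ∀ x, |f x| ≤ C) (x : Euc N) : Integrable (fun y => f (x + y) * ρ y) :=
  hρ.bdd_mul (c := C) (by apply Measurable.aestronglyMeasurable; fun_prop)
    (ae_of_all _ fun y => hC _)

lemma abs_mollify_le (hρ : Integrable ρ) {C : ℝ} (hC : ∀ x, |f x| ≤ C) (x : Euc N) :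
    |mollify ρ f x| ≤ C * ∫ y, |ρ y| := by
  rw [← integral_const_mul]
  refine abs_integral_le_integral_abs.trans (integral_mono_of_nonneg
    (ae_of_all _ fun y => abs_nonneg _) (hρ.abs.const_mul C) (ae_of_all _ fun y => ?_))
  simp only [abs_mul]
  exact mul_le_mul_of_nonneg_right (hC _) (abs_nonneg _)

lemma integrable_prod_add_mul (hf : Integrable f) (hρ : Integrable ρ) :
    Integrable (fun p : Euc N × Euc N => f (p.1 + p.2) * ρ p.2)
      ((volume : Measure (Euc N)).prod volume) := by
  have h := (hρ.comp_neg).convolution_integrand (ContinuousLinearMap.mul ℝ ℝ) hf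
  have hmp : MeasurePreserving (fun p : Euc N × Euc N => (p.1, -p.2))
      ((volume : Measure (Euc N)).prod volume) ((volume : Measure (Euc N)).prod volume) :=
    (MeasurePreserving.id _).prod (Measure.measurePreserving_neg _)
  refine (hmp.integrable_comp_of_integrable h).congr (ae_of_all _ fun p => ?_)
  simp [mul_comm]

lemma integrable_mollify (hf : Integrable f) (hρ : Integrable ρ) : Integrable (mollify ρ f) :=
  (integrable_prod_add_mul hf hρ).integral_prod_left

lemma integral_abs_mollify_le (hf : Integrable f) (hρ : Integrable ρ) :
    ∫ x, |mollify ρ f x| ≤ (∫ x, |f x|) * ∫ y, |ρ y| := by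
  have h := integrable_prod_add_mul hf.abs hρ.abs
  calc ∫ x, |mollify ρ f x| ≤ ∫ x, ∫ y, |f (x + y)| * |ρ y| := by
        refine integral_mono_of_nonneg (ae_of_all _ fun x => abs_nonneg _) h.integral_prod_left
          (ae_of_all _ fun x => ?_)
        simp only [← abs_mul]
        exact abs_integral_le_integral_abs
    _ = ∫ y, ∫ x, |f (x + y)| * |ρ y| := integral_integral_swap h
    _ = (∫ x, |f x|) * ∫ y, |ρ y| := by
        simp_rw [integral_mul_const, integral_add_right_eq_self (fun x => |f x|)]
        rw [integral_const_mul]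

lemma integral_mul_mollify (hf : Integrable f) (hρ : Integrable ρ) (hg : Measurable g) {C : ℝ}
    (hC : ∀ x, |g x| ≤ C) :
    ∫ x, f x * mollify ρ g x = ∫ x, mollify (fun y => ρ (-y)) f x * g x := by
  have i1 : Integrable (fun p : Euc N × Euc N => f p.1 * (g (p.1 + p.2) * ρ p.2))
      ((volume : Measure (Euc N)).prod volume) := by
    refine ((hf.mul_prod hρ).bdd_mul (c := C) (f := fun p : Euc N × Euc N => g (p.1 + p.2))
      (by apply Measurable.aestronglyMeasurable; fun_prop) (ae_of_all _ fun y => hC _)).congr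
      (ae_of_all _ fun p => by ring)
  have i2 : Integrable (fun p : Euc N × Euc N => f (p.1 + p.2) * ρ (-p.2) * g p.1)
      ((volume : Measure (Euc N)).prod volume) := by
    refine (integrable_prod_add_mul hf hρ.comp_neg).mul_bdd (c := C)
      (by apply Measurable.aestronglyMeasurable; fun_prop) (ae_of_all _ fun y => hC _)
  unfold mollify
  simp_rw [← integral_const_mul, ← integral_mul_const]
  rw [integral_integral_swap i1,
    integral_integral_swap (f := fun x y => f (x + y) * ρ (-y) * g x) i2]
  rw [← integral_neg_eq_self]
  refine integral_congr_ae (ae_of_all _ fun y => ?_)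
  simp only
  rw [← integral_add_right_eq_self _ y]
  simp only [add_neg_cancel_right]
  exact integral_congr_ae (ae_of_all _ fun x => by ring)

lemma IsMollifier.integral_abs {δ : ℝ} (h : IsMollifier δ ρ) : ∫ y, |ρ y| = 1 := by
  rw [← h.integral_eq_one]
  exact integral_congr_ae (ae_of_all _ fun y => abs_of_nonneg (h.nonneg y))

lemma IsMollifier.abs_mollify_le {δ : ℝ} (h : IsMollifier δ ρ) {C : ℝ} (hC : ∀ x, |f x| ≤ C)
    (x : Euc N) : |mollify ρ f x| ≤ C := by
  simpa [h.integral_abs] using _root_.abs_mollify_le h.isTestFn.integrable hC x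

lemma IsMollifier.comp_neg {δ : ℝ} (h : IsMollifier δ ρ) : IsMollifier δ (fun y => ρ (-y)) where
  isTestFn := ⟨h.isTestFn.1.comp contDiff_neg, h.isTestFn.2.comp_homeomorph (Homeomorph.neg _)⟩
  nonneg y := h.nonneg _
  integral_eq_one := by rw [integral_neg_eq_self]; exact h.integral_eq_one
  eq_zero y hy := h.eq_zero _ (by simpa using hy)

lemma IsMollifier.integral_abs_mollify_sub_le {δ ω : ℝ} (h : IsMollifier δ ρ) (hf : Integrable f)
    (hω : ∀ y : Euc N, ‖y‖ < δ → ∫ x, |f (x + y) - f x| ≤ ω) :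
    ∫ x, |mollify ρ f x - f x| ≤ ω := by
  have hρ := h.isTestFn.integrable
  have i1 := integrable_prod_add_mul hf hρ
  have i2 := hf.mul_prod hρ
  have i3 : Integrable (fun p : Euc N × Euc N => |f (p.1 + p.2) - f p.1| * ρ p.2)
      ((volume : Measure (Euc N)).prod volume) := by
    refine (i1.sub i2).abs.congr (ae_of_all _ fun p => ?_)
    simp only [Pi.sub_apply]
    rw [← sub_mul, abs_mul, abs_of_nonneg (h.nonneg _)]
  calc ∫ x, |mollify ρ f x - f x| ≤ ∫ x, ∫ y, |f (x + y) - f x| * ρ y := by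
        refine integral_mono_of_nonneg (ae_of_all _ fun x => abs_nonneg _) i3.integral_prod_left ?_
        filter_upwards [i1.prod_right_ae] with x hx
        have : mollify ρ f x - f x = ∫ y, (f (x + y) - f x) * ρ y := by
          simp_rw [sub_mul]
          rw [integral_sub hx (hρ.const_mul _), integral_const_mul, h.integral_eq_one, mul_one]
          rfl
        simp only [this]
        refine abs_integral_le_integral_abs.trans (le_of_eq (integral_congr_ae
          (ae_of_all _ fun y => ?_)))
        simp only [abs_mul, abs_of_nonneg (h.nonneg _)]
    _ = ∫ y, ∫ x, |f (x + y) - f x| * ρ y := integral_integral_swap i3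
    _ ≤ ∫ y, ω * ρ y := by
        refine integral_mono_of_nonneg (ae_of_all _ fun y => integral_nonneg fun x =>
          mul_nonneg (abs_nonneg _) (h.nonneg _)) (hρ.const_mul ω) (ae_of_all _ fun y => ?_)
        simp only [integral_mul_const]
        by_cases hy : ‖y‖ < δ
        · exact mul_le_mul_of_nonneg_right (hω y hy) (h.nonneg y)
        · simp [h.eq_zero y (not_lt.1 hy)]
    _ = ω := by rw [integral_const_mul, h.integral_eq_one, mul_one]

lemma tendsto_integral_abs_mollify_sub (hf : Integrable f) {ρ : ℕ → Euc N → ℝ}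
    (hρ : ∀ n : ℕ, IsMollifier (1 / ((n : ℝ) + 1)) (ρ n)) :
    Tendsto (fun n => ∫ x, |mollify (ρ n) f x - f x|) atTop (𝓝 0) := by
  rw [Metric.tendsto_atTop]
  intro ε hε
  obtain ⟨δ, hδ, h⟩ := Metric.eventually_nhds_iff.1
    ((tendsto_integral_translate_sub hf).eventually_le_const (half_pos hε))
  obtain ⟨n, hn⟩ := exists_nat_one_div_lt hδ
  refine ⟨n, fun m hm => ?_⟩
  have : ∫ x, |mollify (ρ m) f x - f x| ≤ ε / 2 :=
    (hρ m).integral_abs_mollify_sub_le hf fun y hy => h (by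
      rw [dist_zero_right]
      exact (hy.trans_le (Nat.one_div_le_one_div hm)).trans hn)
  rw [Real.dist_eq, sub_zero, abs_of_nonneg (integral_nonneg fun _ => abs_nonneg _)]
  linarith

lemma tendsto_integral_mollify_mul_mollify (hf : Integrable f) (hg : Measurable g) {C : ℝ}
    (hC : ∀ x, |g x| ≤ C) {ρ : ℕ → Euc N → ℝ}
    (hρ : ∀ n : ℕ, IsMollifier (1 / ((n : ℝ) + 1)) (ρ n)) :
    Tendsto (fun n => ∫ x, mollify (ρ n) f x * mollify (ρ n) g x) atTop
      (𝓝 (∫ x, f x * g x)) := by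
  have hρi := fun n => (hρ n).isTestFn.integrable
  have hb : ∀ (a b : Euc N → ℝ), Integrable a → (∀ x, |b x| ≤ C) → 
      |∫ x, a x * b x| ≤ C * ∫ x, |a x| := by
    intro a b ha hb
    rw [← integral_const_mul]
    refine abs_integral_le_integral_abs.trans (integral_mono_of_nonneg
      (ae_of_all _ fun y => abs_nonneg _) (ha.abs.const_mul C) (ae_of_all _ fun y => ?_))
    simp only [abs_mul]
    rw [mul_comm]
    exact mul_le_mul_of_nonneg_right (hb _) (abs_nonneg _)
  have t1 := tendsto_integral_abs_mollify_sub hf hρ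
  have t2 := tendsto_integral_abs_mollify_sub hf (fun n => (hρ n).comp_neg)
  rw [tendsto_iff_norm_sub_tendsto_zero]
  refine squeeze_zero (fun n => norm_nonneg _) (fun n => ?_)
    (by simpa using (t1.const_mul C).add (t2.const_mul C))
  have hgm := measurable_mollify hg (hρ n).isTestFn.measurable
  have hgb := fun x => (hρ n).abs_mollify_le hC x
  have j1 := (integrable_mollify hf (hρi n))
  have j2 := (integrable_mollify hf (hρi n).comp_neg)
  have k1 : Integrable (fun x => mollify (ρ n) f x * mollify (ρ n) g x) :=
    j1.mul_bdd (c := C) hgm.aestronglyMeasurable (ae_of_all _ hgb)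
  have k2 : Integrable (fun x => f x * mollify (ρ n) g x) :=
    hf.mul_bdd (c := C) hgm.aestronglyMeasurable (ae_of_all _ hgb)
  have k3 : Integrable (fun x => f x * g x) :=
    hf.mul_bdd (c := C) hg.aestronglyMeasurable (ae_of_all _ hC)
  have k4 : Integrable (fun x => mollify (fun y => ρ n (-y)) f x * g x) :=
    j2.mul_bdd (c := C) hg.aestronglyMeasurable (ae_of_all _ hC)
  have e1 : (∫ x, mollify (ρ n) f x * mollify (ρ n) g x) - ∫ x, f x * g x =
      (∫ x, (mollify (ρ n) f x - f x) * mollify (ρ n) g x) +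
      ∫ x, (mollify (fun y => ρ n (-y)) f x - f x) * g x := by
    simp_rw [sub_mul]
    rw [integral_sub k1 k2, integral_sub k4 k3, ← integral_mul_mollify hf (hρi n) hg hC]
    ring
  rw [e1]
  exact (norm_add_le _ _).trans (add_le_add (hb _ _ (j1.sub hf) hgb) (hb _ _ (j2.sub hf) hC))

lemma jumpOp_mollify {ν : Measure (Euc N)} [IsFiniteMeasure ν] (hs : ν.map (fun z => -z) = ν)
    (hf : Measurable f) {C : ℝ} (hC : ∀ x, |f x| ≤ C) (hρ : Integrable ρ) (x : Euc N) :
    jumpOp ν (mollify ρ f) x = mollify (jumpOp ν ρ) f x := by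
  have h := integral_jumpOp_mul hs (g := fun y => f (x + y)) (by fun_prop) (fun y => hC _) hρ
  have i1 := integrable_prod_fst_mul (ν := ν) hρ (g := fun p => f (x + (p.1 + p.2)) - f (x + p.1))
    (by fun_prop) (C := 2 * C) (fun p => by
      have h1 := hC (x + (p.1 + p.2)); have h2 := hC (x + p.1)
      rw [abs_le] at *; constructor <;> linarith)
  change _ = ∫ y, f (x + y) * jumpOp ν ρ y
  rw [← h]
  unfold jumpOp
  simp_rw [← integral_mul_const]
  have i2 := i1.congr (g := fun p => (f (x + (p.1 + p.2)) - f (x + p.1)) * ρ p.1)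
    (ae_of_all _ fun p => mul_comm _ _)
  rw [integral_integral_swap i2]
  refine integral_congr_ae (ae_of_all _ fun z => ?_)
  simp only [mollify]
  rw [← integral_sub (integrable_mollify_integrand hf hρ hC _)
    (integrable_mollify_integrand hf hρ hC _)]
  refine integral_congr_ae (ae_of_all _ fun y => ?_)
  simp only
  rw [add_assoc, add_comm z y]
  ring

end Mollify

lemma setIntegral_Iic_eq {b : ℝ → ℝ} (hb : Integrable b) (t : ℝ) :
    ∫ s in Iic t, b s = (∫ s in Iic 0, b s) + ∫ s in (0 : ℝ)..t, b s := by
  rw [← intervalIntegral.integral_Iic_sub_Iic hb.integrableOn hb.integrableOn]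
  ring

lemma continuous_setIntegral_Iic {b : ℝ → ℝ} (hb : Integrable b) :
    Continuous (fun t => ∫ s in Iic t, b s) := by
  rw [funext (setIntegral_Iic_eq hb)]
  exact continuous_const.add
    (intervalIntegral.continuous_primitive (fun _ _ => hb.intervalIntegrable) 0)

lemma ae_hasDerivAt_setIntegral_Iic {b : ℝ → ℝ} (hb : Integrable b) :
    ∀ᵐ t, HasDerivAt (fun t => ∫ s in Iic t, b s) (b t) t := by
  filter_upwards [LocallyIntegrable.ae_hasDerivAt_integral hb.locallyIntegrable] with t ht
  rw [funext (setIntegral_Iic_eq hb)]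
  exact (ht 0).const_add _

lemma ae_eq_primitive {T : ℝ} {a b : ℝ → ℝ} (ha : Integrable a) (hb : Integrable b)
    (hb0 : ∀ t, t ∉ Ioo 0 T → b t = 0)
    (h : ∀ θ : ℝ → ℝ, ContDiff ℝ (⊤ : ℕ∞) θ → HasCompactSupport θ → tsupport θ ⊆ Iio T →
      ∫ t in Ioo 0 T, (deriv θ t * a t + θ t * b t) = 0) :
    ∀ᵐ t, t ∈ Ioo 0 T → a t = ∫ s in Iic t, b s := by
  have hβc := continuous_setIntegral_Iic hb
  have key := isOpen_Ioo.ae_eq_zero_of_integral_contDiff_smul_eq_zero (μ := volume) (U := Ioo 0 T)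
    (f := fun t => a t - ∫ s in Iic t, b s)
    ((ha.locallyIntegrable.sub hβc.locallyIntegrable).locallyIntegrableOn _) ?_
  · filter_upwards [key] with t ht hm
    exact sub_eq_zero.1 (ht hm)
  intro χ hχ hχc hχs
  have hχ0 : ∀ t, t ∉ Ioo 0 T → χ t = 0 := fun t ht => by
    by_contra hne
    exact ht (hχs (subset_tsupport _ hne))
  have hχi : Integrable χ := hχ.continuous.integrable_of_hasCompactSupport hχc
  rcases le_or_gt T 0 with hT | hT
  · have : ∀ t, χ t = 0 := fun t => hχ0 t (by simp [Ioo_eq_empty_of_le hT])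
    simp [this]
  obtain ⟨c, hcT, hc⟩ : ∃ c < T, ∀ t, c ≤ t → χ t = 0 := by
    rcases (tsupport χ).eq_empty_or_nonempty with he | hne
    · refine ⟨T - 1, by linarith, fun t _ => ?_⟩
      rw [tsupport_eq_empty_iff.1 he]; rfl
    · have hK : IsCompact (tsupport χ) := hχc
      obtain ⟨m, hm, hmax⟩ := hK.exists_isMaxOn hne continuous_id.continuousOn
      have := (hχs hm).2
      refine ⟨(m + T) / 2, by linarith, fun t ht => ?_⟩
      by_contra h0
      have := hmax (subset_tsupport _ h0)
      simp at this
      linarith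
  set P : ℝ → ℝ := fun t => ∫ s in T..t, χ s with hP
  have hPd : ∀ t, HasDerivAt P (χ t) t := fun t =>
    intervalIntegral.integral_hasDerivAt_right hχi.intervalIntegrable
      hχ.continuous.stronglyMeasurable.stronglyMeasurableAtFilter hχ.continuous.continuousAt
  have hPs : ContDiff ℝ (⊤ : ℕ∞) P := by
    rw [contDiff_infty_iff_deriv]
    refine ⟨fun t => (hPd t).differentiableAt, ?_⟩
    rw [funext fun t => (hPd t).deriv]
    exact hχ
  have hP0 : ∀ t, c ≤ t → P t = 0 := by
    intro t ht
    rw [hP]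
    refine (intervalIntegral.integral_congr (g := fun _ => (0 : ℝ)) fun s hs => ?_).trans (by simp)
    refine hc s ?_
    have := hs.1
    rcases min_cases T t with h | h <;> linarith
  let η : ContDiffBump (0 : ℝ) := ⟨T + 1, T + 2, by linarith, by linarith⟩
  have hη : ∀ t ∈ Ioo 0 T, (fun s => η s) =ᶠ[𝓝 t] fun _ => 1 := by
    intro t ht
    filter_upwards [isOpen_Ioo.mem_nhds ht] with s hs
    refine η.one_of_mem_closedBall ?_
    simp only [Metric.mem_closedBall, dist_zero_right, Real.norm_eq_abs]
    rw [abs_of_pos hs.1]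
    exact (by linarith [hs.2] : s ≤ T + 1)
  have h1 := h (fun t => η t * P t) (η.contDiff.mul hPs) η.hasCompactSupport.mul_right ?_
  swap
  · have hsub : Function.support (fun t => η t * P t) ⊆ Iic c := by
      intro t ht
      by_contra hn
      exact ht (by simp [hP0 t (le_of_lt (by simpa using hn))])
    have hcl : tsupport (fun t => η t * P t) ⊆ Iic c := closure_minimal hsub isClosed_Iic
    exact fun t ht => lt_of_le_of_lt (hcl ht) hcT
  have h2 : ∫ t in Ioo 0 T, (χ t * a t + P t * b t) = 0 := by
    refine Eq.trans ?_ h1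
    refine setIntegral_congr_fun measurableSet_Ioo fun t ht => ?_
    have e : (fun s => η s * P s) =ᶠ[𝓝 t] P := by
      filter_upwards [hη t ht] with s hs
      rw [hs, one_mul]
    rw [e.deriv_eq, e.eq_of_nhds, (hPd t).deriv]
  have hχm : ∃ M, ∀ t, |χ t| ≤ M := by
    obtain ⟨M, hM⟩ := hχc.exists_bound_of_continuous hχ.continuous
    exact ⟨M, hM⟩
  obtain ⟨M, hM⟩ := hχm
  have i1 : Integrable (fun t => χ t * a t) :=
    ha.bdd_mul (c := M) hχ.continuous.aestronglyMeasurable (ae_of_all _ hM)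
  have i2 : Integrable (fun p : ℝ × ℝ => (Ici p.1).indicator (fun s => b p.1 * χ s) p.2)
      ((volume : Measure ℝ).prod volume) := by
    have hs : MeasurableSet {p : ℝ × ℝ | p.1 ≤ p.2} :=
      measurableSet_le measurable_fst measurable_snd
    refine ((hb.mul_prod hχi).indicator hs).congr (ae_of_all _ fun p => ?_)
    simp only
    by_cases hp : p.1 ≤ p.2
    · rw [indicator_of_mem (show p ∈ {p : ℝ × ℝ | p.1 ≤ p.2} from hp),
        indicator_of_mem (show p.2 ∈ Ici p.1 from hp)]
    · rw [indicator_of_notMem (show p ∉ {p : ℝ × ℝ | p.1 ≤ p.2} from hp),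
        indicator_of_notMem (show p.2 ∉ Ici p.1 from hp)]
  have hPb : ∀ t, P t * b t = - ∫ s, (Ici t).indicator (fun s => b t * χ s) s := by
    intro t
    rw [integral_indicator measurableSet_Ici, integral_const_mul]
    by_cases ht : t ∈ Ioo 0 T
    · have : P t = -∫ s in Ici t, χ s := by
        rw [hP]
        simp only
        rw [intervalIntegral.integral_symm, intervalIntegral.integral_of_le ht.2.le,
          integral_Ici_eq_integral_Ioi, ← Ioc_union_Ioi_eq_Ioi ht.2.le,
          setIntegral_union (Ioc_disjoint_Ioi le_rfl) measurableSet_Ioi hχi.integrableOn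
          hχi.integrableOn, setIntegral_eq_zero_of_forall_eq_zero (t := Ioi T)
          fun s hs => hχ0 s fun hs' => absurd hs'.2 (not_lt.2 (le_of_lt hs)), add_zero]
      rw [this]; ring
    · rw [hb0 t ht]; simp
  have i3 : Integrable (fun t => P t * b t) := by
    simp only [hPb]
    exact i2.integral_prod_left.neg
  have h3 : ∫ t, (χ t * a t + P t * b t) = 0 := by
    refine Eq.trans ?_ h2
    rw [setIntegral_eq_integral_of_forall_compl_eq_zero]
    intro t ht
    simp [hχ0 t ht, hb0 t ht]
  rw [integral_add i1 i3] at h3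
  have h4 : ∫ t, P t * b t = - ∫ s, χ s * ∫ t in Iic s, b t := by
    simp_rw [hPb]
    rw [integral_neg, integral_integral_swap (f := fun t s => (Ici t).indicator
      (fun s => b t * χ s) s) i2]
    congr 1
    refine integral_congr_ae (ae_of_all _ fun s => ?_)
    simp only
    rw [← integral_indicator measurableSet_Iic, ← integral_const_mul]
    refine integral_congr_ae (ae_of_all _ fun t => ?_)
    by_cases hp : t ≤ s
    · simp only [indicator_of_mem (show t ∈ Iic s from hp), indicator_of_mem
        (show s ∈ Ici t from hp)]; ring
    · simp only [indicator_of_notMem (show t ∉ Iic s from hp), indicator_of_notMem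
        (show s ∉ Ici t from hp), mul_zero]
  simp_rw [smul_eq_mul, mul_sub]
  rw [integral_sub i1, ← h3, h4]
  · ring
  · exact (hβc.mul hχ.continuous |>.integrable_of_hasCompactSupport hχc.mul_left).congr
      (ae_of_all _ fun t => mul_comm _ _)

section Pair
variable {N : ℕ} {μ : Measure (Euc N)} {T C : ℝ} {U W : Euc N → ℝ → ℝ}

/-- The differences `U = u - v` and `W = φ(u) - φ(v)` of two solutions with the same initial datum,
extended by zero outside of `(0, T)`. -/
structure IsPair (μ : Measure (Euc N)) (T C : ℝ) (U W : Euc N → ℝ → ℝ) : Prop where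
  measurable_left : Measurable (Function.uncurry U)
  measurable_right : Measurable (Function.uncurry W)
  left_eq_zero : ∀ x t, t ∉ Ioo 0 T → U x t = 0
  bound : ∀ x t, |W x t| ≤ C
  integrable : Integrable (Function.uncurry U) ((volume : Measure (Euc N)).prod volume)
  small : ∀ δ > 0, ∃ K, ∀ x t, |W x t| ≤ (Ioo 0 T).indicator (fun _ => δ) t + K * |U x t|
  mul_nonneg : ∀ x t, 0 ≤ U x t * W x t
  weak : ∀ ψ : Euc N → ℝ → ℝ, IsSTTestFn T ψ → ∫ t in Ioo 0 T, ∫ x,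
    (U x t * deriv (ψ x) t + W x t * Lop μ (fun y => ψ y t) x) = 0

/-- The primitive in time of `W`. -/
noncomputable def timePrimitive (W : Euc N → ℝ → ℝ) (x : Euc N) (t : ℝ) : ℝ := ∫ s in Iic t, W x s

lemma IsPair.right_eq_zero (h : IsPair μ T C U W) (x : Euc N) (t : ℝ) (ht : t ∉ Ioo 0 T) :
    W x t = 0 := by
  obtain ⟨K, hK⟩ := h.small 1 one_pos
  have := hK x t
  rw [h.left_eq_zero x t ht, indicator_of_notMem ht] at this
  simpa using this

lemma IsPair.right_eq_zero_of_left_eq_zero (h : IsPair μ T C U W) {x : Euc N} {t : ℝ}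
    (ht : U x t = 0) : W x t = 0 := by
  have : |W x t| ≤ 0 := by
    refine le_of_forall_pos_le_add fun δ hδ => ?_
    obtain ⟨K, hK⟩ := h.small δ hδ
    have := hK x t
    rw [ht] at this
    have h2 : (Ioo 0 T).indicator (fun _ => δ) t ≤ δ :=
      indicator_le_self' (fun _ _ => hδ.le) t
    simp at this
    linarith
  simpa using this

lemma IsPair.bound_nonneg (h : IsPair μ T C U W) : 0 ≤ C :=
  (abs_nonneg _).trans (h.bound 0 0)

lemma IsPair.measurable_slice (h : IsPair μ T C U W) (t : ℝ) : Measurable (fun x => W x t) :=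
  h.measurable_right.comp (measurable_id.prodMk measurable_const)

lemma IsPair.abs_right_le (h : IsPair μ T C U W) (x : Euc N) (t : ℝ) :
    |W x t| ≤ (Ioo 0 T).indicator (fun _ => C) t := by
  by_cases ht : t ∈ Ioo 0 T
  · rw [indicator_of_mem ht]; exact h.bound x t
  · rw [indicator_of_notMem ht, h.right_eq_zero x t ht, abs_zero]

lemma integrable_indicator_Ioo (T c : ℝ) : Integrable ((Ioo 0 T).indicator fun _ => c) :=
  (integrable_indicator_iff measurableSet_Ioo).2 (integrableOn_const measure_Ioo_lt_top.ne)

lemma IsPair.integrable_right (h : IsPair μ T C U W) (x : Euc N) : Integrable (W x) :=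
  (integrable_indicator_Ioo T C).mono'
    (h.measurable_right.comp (measurable_const.prodMk measurable_id)).aestronglyMeasurable
    (ae_of_all _ fun t => h.abs_right_le x t)

lemma measurable_timePrimitive (hW : Measurable (Function.uncurry W)) :
    Measurable (Function.uncurry (timePrimitive W)) := by
  have hs : MeasurableSet {q : (Euc N × ℝ) × ℝ | q.2 ≤ q.1.2} :=
    measurableSet_le (by fun_prop) (by fun_prop)
  have hm : Measurable (fun q : (Euc N × ℝ) × ℝ => W q.1.1 q.2) :=
    hW.comp (by fun_prop : Measurable (fun q : (Euc N × ℝ) × ℝ => (q.1.1, q.2)))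
  have : StronglyMeasurable (Function.uncurry fun (p : Euc N × ℝ) (s : ℝ) =>
      {q : (Euc N × ℝ) × ℝ | q.2 ≤ q.1.2}.indicator (fun q => W q.1.1 q.2) (p, s)) :=
    (hm.indicator hs).stronglyMeasurable
  convert (this.integral_prod_right (ν := (volume : Measure ℝ))).measurable using 2 with p
  obtain ⟨x, t⟩ := p
  simp only [Function.uncurry, timePrimitive]
  rw [← integral_indicator measurableSet_Iic]
  rfl

lemma IsPair.abs_timePrimitive_sub_le (h : IsPair μ T C U W) (x : Euc N) {s t : ℝ} (hst : s ≤ t) :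
    |timePrimitive W x t - timePrimitive W x s| ≤ C * (t - s) := by
  unfold timePrimitive
  rw [intervalIntegral.integral_Iic_sub_Iic (h.integrable_right x).integrableOn
    (h.integrable_right x).integrableOn]
  have := intervalIntegral.norm_integral_le_of_norm_le_const (a := s) (b := t) (f := W x) (C := C)
    (fun r _ => h.bound x r)
  rwa [abs_of_nonneg (sub_nonneg.2 hst)] at this

lemma IsPair.timePrimitive_eq_zero (h : IsPair μ T C U W) (x : Euc N) {t : ℝ} (ht : t ≤ 0) :
    timePrimitive W x t = 0 :=
  setIntegral_eq_zero_of_forall_eq_zero fun s hs =>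
    h.right_eq_zero x s fun h' => absurd h'.1 (not_lt.2 (le_trans hs ht))

lemma IsPair.abs_timePrimitive_le (h : IsPair μ T C U W) (hT : 0 ≤ T) (x : Euc N) (t : ℝ) :
    |timePrimitive W x t| ≤ C * T := by
  have : ∀ c, ∫ s, (Ioo 0 T).indicator (fun _ => c) s = c * T := by
    intro c
    rw [integral_indicator_const _ measurableSet_Ioo]
    simp [hT, mul_comm]
  rw [← this]
  have i := integrable_indicator_Ioo T C
  calc |timePrimitive W x t| ≤ ∫ s in Iic t, |W x s| := abs_integral_le_integral_abs
    _ ≤ ∫ s in Iic t, (Ioo 0 T).indicator (fun _ => C) s :=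
      integral_mono_of_nonneg (ae_of_all _ fun s => abs_nonneg _) i.integrableOn
        (ae_of_all _ fun s => h.abs_right_le x s)
    _ ≤ ∫ s, (Ioo 0 T).indicator (fun _ => C) s :=
      setIntegral_le_integral i (ae_of_all _ fun s => indicator_nonneg
        (fun _ _ => h.bound_nonneg) _)

lemma IsPair.small_timePrimitive (h : IsPair μ T C U W) (hT : 0 ≤ T) {δ : ℝ} (hδ : 0 < δ) :
    ∃ k : Euc N → ℝ, Integrable k ∧ (∀ x, 0 ≤ k x) ∧ 
      ∀ᵐ x, ∀ t, |timePrimitive W x t| ≤ δ * T + k x := by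
  obtain ⟨K, hK⟩ := h.small δ hδ
  have hU := h.integrable.abs
  refine ⟨fun x => |K| * ∫ s, |U x s|, hU.integral_prod_left.const_mul _, fun x => by positivity,
    ?_⟩
  filter_upwards [hU.prod_right_ae] with x hx t
  have hx' : Integrable (fun s => |U x s|) := hx
  have i := integrable_indicator_Ioo T δ
  have i2 := i.add (hx'.const_mul |K|)
  have e : ∀ s, |W x s| ≤ (Ioo 0 T).indicator (fun _ => δ) s + |K| * |U x s| := fun s =>
    (hK x s).trans (by gcongr; exact le_abs_self K)
  calc |timePrimitive W x t| ≤ ∫ s in Iic t, |W x s| := abs_integral_le_integral_abs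
    _ ≤ ∫ s in Iic t, ((Ioo 0 T).indicator (fun _ => δ) s + |K| * |U x s|) :=
      integral_mono_of_nonneg (ae_of_all _ fun s => abs_nonneg _) i2.integrableOn
        (ae_of_all _ e)
    _ ≤ ∫ s, ((Ioo 0 T).indicator (fun _ => δ) s + |K| * |U x s|) :=
      setIntegral_le_integral i2 (ae_of_all _ fun s => (abs_nonneg _).trans (e s))
    _ = δ * T + |K| * ∫ s, |U x s| := by
      rw [integral_add i (hx'.const_mul _), integral_const_mul,
        integral_indicator_const _ measurableSet_Ioo]
      simp [hT, mul_comm]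

lemma Lop_mul_const {ρ : Euc N → ℝ} (hρ : Differentiable ℝ ρ) (c : ℝ) (x : Euc N) :
    Lop μ (fun y => ρ y * c) x = Lop μ ρ x * c := by
  unfold Lop
  rw [← integral_mul_const]
  refine integral_congr_ae (ae_of_all _ fun z => ?_)
  simp only
  rw [fderiv_mul_const (hρ x)]
  split_ifs
  · simp; ring
  · ring

lemma Lop_comp_sub (ρ : Euc N → ℝ) (x y : Euc N) :
    Lop μ (fun y => ρ (y - x)) y = Lop μ ρ (y - x) := by
  unfold Lop
  refine integral_congr_ae (ae_of_all _ fun z => ?_)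
  simp only
  rw [fderiv_comp_sub, add_sub_right_comm]

lemma IsTestFn.integrable_Lop (hμ : IsLevyMeasure μ) {ρ : Euc N → ℝ} (hρ : IsTestFn ρ) :
    Integrable (Lop μ ρ) := by
  obtain ⟨A, R, C, h⟩ := hρ.exists_isSlice
  exact h.integrable_Lop hμ

lemma IsPair.weak_slice (hμ : IsLevyMeasure μ) (h : IsPair μ T C U W) {ρ : Euc N → ℝ}
    (hρ : IsTestFn ρ) :
    ∀ᵐ t, t ∈ Ioo 0 T → ∫ x, U x t * ρ x = ∫ x, timePrimitive W x t * Lop μ ρ x := by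
  have hL := hρ.integrable_Lop hμ
  obtain ⟨M, hM⟩ := hρ.2.exists_bound_of_continuous hρ.1.continuous
  have i1 : Integrable (fun p : Euc N × ℝ => U p.1 p.2 * ρ p.1)
      ((volume : Measure (Euc N)).prod volume) :=
    h.integrable.mul_bdd (c := M) (hρ.measurable.comp measurable_fst).aestronglyMeasurable
      (ae_of_all _ fun p => hM _)
  have i2 : Integrable (fun p : Euc N × ℝ => W p.1 p.2 * Lop μ ρ p.1)
      ((volume : Measure (Euc N)).prod volume) := by
    refine (hL.abs.mul_prod (integrable_indicator_Ioo T C)).mono'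
      (h.measurable_right.aestronglyMeasurable.mul hL.aestronglyMeasurable.comp_fst)
      (ae_of_all _ fun p => ?_)
    rw [Real.norm_eq_abs, abs_mul, mul_comm]
    exact mul_le_mul_of_nonneg_left (h.abs_right_le _ _) (abs_nonneg _)
  have key := ae_eq_primitive (T := T) (a := fun t => ∫ x, U x t * ρ x)
    (b := fun t => ∫ x, W x t * Lop μ ρ x) i1.integral_prod_right i2.integral_prod_right
    (fun t ht => by simp [h.right_eq_zero _ t ht]) ?_
  · filter_upwards [key] with t ht hm
    rw [ht hm]
    have i3 : Integrable (fun p : Euc N × ℝ => W p.1 p.2 * Lop μ ρ p.1)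
      ((volume : Measure (Euc N)).prod (volume.restrict (Iic t))) := by
      have := i2.restrict (s := univ ×ˢ Iic t)
      rwa [← Measure.prod_restrict, Measure.restrict_univ] at this
    rw [← integral_integral_swap (f := fun x s => W x s * Lop μ ρ x) i3]
    simp_rw [integral_mul_const]
    rfl
  · intro θ hθ hθc hθs
    have hψ : IsSTTestFn T (fun x t => ρ x * θ t) := by
      have hK : HasCompactSupport (Function.uncurry fun (x : Euc N) (t : ℝ) => ρ x * θ t) := by
        refine HasCompactSupport.intro (hρ.2.isCompact.prod hθc.isCompact) fun p hp => ?_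
        rw [mem_prod, not_and_or] at hp
        rcases hp with hp | hp
        · simp [Function.uncurry, image_eq_zero_of_notMem_tsupport hp]
        · simp [Function.uncurry, image_eq_zero_of_notMem_tsupport hp]
      refine ⟨(hρ.1.comp contDiff_fst).mul (hθ.comp contDiff_snd), hK, ?_⟩
      have : tsupport (Function.uncurry fun (x : Euc N) (t : ℝ) => ρ x * θ t)
          ⊆ Prod.snd ⁻¹' tsupport θ := by
        refine closure_minimal (fun p hp => subset_tsupport _ ?_)
          ((isClosed_tsupport θ).preimage continuous_snd)
        exact right_ne_zero_of_mul hp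
      exact fun p hp => hθs (this hp)
    refine Eq.trans ?_ (h.weak _ hψ)
    refine setIntegral_congr_ae measurableSet_Ioo ?_
    filter_upwards [i1.prod_left_ae, i2.prod_left_ae] with t h1 h2 _
    have hρd : Differentiable ℝ ρ := hρ.1.differentiable (by simp)
    have e : ∀ x, U x t * deriv (fun t => ρ x * θ t) t + W x t * Lop μ (fun y => ρ y * θ t) x
        = deriv θ t * (U x t * ρ x) + θ t * (W x t * Lop μ ρ x) := by
      intro x
      rw [Lop_mul_const hρd, deriv_const_mul _ (hθ.differentiable (by simp) t)]
      ring
    simp only [e]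
    rw [integral_add (h1.const_mul _) (h2.const_mul _), integral_const_mul, integral_const_mul]

lemma IsPair.mollify_eq (hμ : IsLevyMeasure μ) (h : IsPair μ T C U W) {ρ : Euc N → ℝ}
    (hρ : IsTestFn ρ) :
    ∀ᵐ t, t < T → ∀ᵐ x, mollify ρ (fun x => U x t) x =
      mollify (Lop μ ρ) (fun x => timePrimitive W x t) x := by
  have := hμ.sigmaFinite
  have hLm : Measurable (Lop μ ρ) := measurable_Lop hρ.1
  have hs : MeasurableSet {p : Euc N × ℝ | p.2 < T → mollify ρ (fun x => U x p.2) p.1 =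
      mollify (Lop μ ρ) (fun x => timePrimitive W x p.2) p.1} := by
    refine MeasurableSet.imp (measurableSet_lt measurable_snd measurable_const)
      (measurableSet_eq_fun ?_ ?_)
    · exact measurable_mollify_uncurry h.measurable_left hρ.measurable
    · exact measurable_mollify_uncurry (measurable_timePrimitive h.measurable_right) hLm
  have h1 : ∀ᵐ p : Euc N × ℝ ∂((volume : Measure (Euc N)).prod volume),
      p.2 < T → mollify ρ (fun x => U x p.2) p.1 =
      mollify (Lop μ ρ) (fun x => timePrimitive W x p.2) p.1 := by
    rw [Measure.ae_prod_iff_ae_ae hs]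
    refine ae_of_all _ fun x => ?_
    have hρx : IsTestFn (fun y => ρ (y - x)) :=
      ⟨hρ.1.comp (contDiff_id.sub contDiff_const), hρ.2.comp_homeomorph (Homeomorph.subRight x)⟩
    filter_upwards [h.weak_slice hμ hρx] with t ht htT
    rcases le_or_gt t 0 with h0 | h0
    · have h1 : ∀ y, U y t = 0 := fun y => h.left_eq_zero y t fun h' => absurd h'.1 (not_lt.2 h0)
      simp [mollify, h1, h.timePrimitive_eq_zero _ h0]
    · have := ht ⟨h0, htT⟩
      simp_rw [Lop_comp_sub] at this
      rw [← integral_add_left_eq_self _ x,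
        ← integral_add_left_eq_self (fun y => timePrimitive W y t * Lop μ ρ (y - x)) x] at this
      simpa [mollify] using this
  have h2 := (Measure.measurePreserving_swap (μ := (volume : Measure ℝ))
    (ν := (volume : Measure (Euc N)))).quasiMeasurePreserving.ae h1
  filter_upwards [Measure.ae_ae_of_ae_prod h2] with t ht htT
  filter_upwards [ht] with x hx using hx htT

end Pair

section Pair
variable {N : ℕ} {μ : Measure (Euc N)} {T C δ : ℝ} {U W : Euc N → ℝ → ℝ} {ρ : Euc N → ℝ}

lemma Measurable.slice {α : Type*} [MeasurableSpace α] {g : Euc N → α → ℝ}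
    (hg : Measurable (Function.uncurry g)) (t : α) : Measurable (fun x => g x t) :=
  hg.comp (measurable_id.prodMk measurable_const)

lemma IsPair.ae_integrable (h : IsPair μ T C U W) : ∀ᵐ t, Integrable (fun x => U x t) :=
  h.integrable.prod_left_ae

lemma IsPair.isEnergy (hμ : IsLevyMeasure μ) (hT : 0 < T) (h : IsPair μ T C U W)
    (hρ : IsMollifier δ ρ) :
    ∀ᵐ t, t < T → IsEnergy μ (mollify ρ (fun x => timePrimitive W x t))
      (mollify ρ (fun x => U x t)) := by
  have hρi := hρ.isTestFn.integrable
  obtain ⟨A, R, B, hsl⟩ := hρ.isTestFn.exists_isSlice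
  filter_upwards [h.mollify_eq hμ hρ.isTestFn, h.ae_integrable] with t ht hU htT
  have hVm : Measurable (fun x => timePrimitive W x t) :=
    (measurable_timePrimitive h.measurable_right).slice t
  have hVb : ∀ x, |timePrimitive W x t| ≤ C * T := fun x => h.abs_timePrimitive_le hT.le x t
  have hCT : 0 ≤ C * T := _root_.mul_nonneg h.bound_nonneg hT.le
  have hr : ∀ n : ℕ, (0 : ℝ) < 1 / ((n : ℝ) + 1) := fun n => by positivity
  have hr1 : ∀ n : ℕ, 1 / ((n : ℝ) + 1) ≤ 1 := fun n => by
    rw [div_le_one (by positivity)]; linarith [(Nat.cast_nonneg n : (0 : ℝ) ≤ n)]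
  have hj : ∀ (n : ℕ) x, jumpOp (truncMeasure μ (1 / ((n : ℝ) + 1)))
      (mollify ρ (fun x => timePrimitive W x t)) x
      = mollify (jumpOp (truncMeasure μ (1 / ((n : ℝ) + 1))) ρ)
          (fun x => timePrimitive W x t) x := by
    intro n x
    have := hμ.isFiniteMeasure_trunc (hr n)
    exact jumpOp_mollify (hμ.map_neg_trunc _) hVm hVb hρi x
  refine ⟨measurable_mollify hVm hρ.isTestFn.measurable, ⟨C * T, hρ.abs_mollify_le hVb⟩, ?_,
    integrable_mollify hU hρi, ⟨C * T * sliceConst μ A R B, fun n x => ?_⟩, ?_⟩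
  · intro ε hε
    obtain ⟨k, hk, hk0, hVk⟩ := h.small_timePrimitive hT.le (div_pos hε hT)
    refine ⟨mollify ρ k, integrable_mollify hk hρi, ?_⟩
    filter_upwards [(integrable_prod_add_mul hk hρi).prod_right_ae] with x hx
    have hx' : Integrable (fun y => k (x + y) * ρ y) := hx
    rw [div_mul_cancel₀ _ hT.ne'] at hVk
    have hVk' : ∀ᵐ y, |timePrimitive W (x + y) t| ≤ ε + k (x + y) := by
      filter_upwards [(measurePreserving_add_left volume x).quasiMeasurePreserving.ae hVk]
        with y hy using hy t
    calc |mollify ρ (fun x => timePrimitive W x t) x|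
        ≤ ∫ y, |timePrimitive W (x + y) t * ρ y| := abs_integral_le_integral_abs
      _ ≤ ∫ y, (ε * ρ y + k (x + y) * ρ y) := by
        refine integral_mono_of_nonneg (ae_of_all _ fun y => abs_nonneg _)
          ((hρi.const_mul ε).add hx') ?_
        filter_upwards [hVk'] with y hy
        rw [abs_mul, abs_of_nonneg (hρ.nonneg y), ← add_mul]
        exact mul_le_mul_of_nonneg_right hy (hρ.nonneg y)
      _ = ε + mollify ρ k x := by
        rw [integral_add (hρi.const_mul ε) hx', integral_const_mul, hρ.integral_eq_one, mul_one]
        rfl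
      _ ≤ ε + |mollify ρ k x| := by gcongr; exact le_abs_self _
  · rw [hj]
    exact (abs_mollify_le (hsl.integrable_jumpOp hμ (hr n)) hVb x).trans
      (mul_le_mul_of_nonneg_left (hsl.integral_abs_jumpOp_le hμ (hr n) (hr1 n)) hCT)
  · filter_upwards [ht htT] with x hx
    rw [hx]
    simp only [hj]
    rw [tendsto_iff_norm_sub_tendsto_zero]
    have hlim := (hμ.tendsto_smallMoment.const_mul A).mul_const
      ((volume : Measure (Euc N)).real (Metric.closedBall 0 (R + 1)))
    have hlim2 := hlim.const_mul (C * T)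
    refine squeeze_zero (fun _ => norm_nonneg _) (fun n => ?_) (by simpa using hlim2)
    have e : mollify (jumpOp (truncMeasure μ (1 / ((n : ℝ) + 1))) ρ)
        (fun x => timePrimitive W x t) x - mollify (Lop μ ρ) (fun x => timePrimitive W x t) x
        = -mollify (fun y => Lop μ ρ y - jumpOp (truncMeasure μ (1 / ((n : ℝ) + 1))) ρ y)
          (fun x => timePrimitive W x t) x := by
      unfold mollify
      simp_rw [mul_sub]
      rw [integral_sub (integrable_mollify_integrand hVm (hsl.integrable_Lop hμ) hVb x)
        (integrable_mollify_integrand hVm (hsl.integrable_jumpOp hμ (hr n)) hVb x)]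
      ring
    rw [e, norm_neg]
    refine (abs_mollify_le (hsl.integrable_Lop_sub_jumpOp hμ (hr n) (hr1 n)) hVb x).trans ?_
    have := mul_le_mul_of_nonneg_left
      (hsl.integral_abs_Lop_sub_jumpOp_le hμ (hr n) (hr1 n)) hCT
    simpa using this

lemma IsPair.abs_integral_mul_mollify_le (h : IsPair μ T C U W) (hρ : IsMollifier δ ρ)
    {g : Euc N → ℝ → ℝ} {M : ℝ} (hM : ∀ x t, |g x t| ≤ M) :
    ∀ᵐ t, |∫ x, g x t * mollify ρ (fun x => U x t) x| ≤ M * ∫ x, |U x t| := by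
  filter_upwards [h.ae_integrable] with t ht
  have hi := integrable_mollify ht hρ.isTestFn.integrable
  have hle := integral_abs_mollify_le ht hρ.isTestFn.integrable
  rw [hρ.integral_abs, mul_one] at hle
  refine le_trans ?_ (mul_le_mul_of_nonneg_left hle ((abs_nonneg _).trans (hM 0 0)))
  rw [← integral_const_mul]
  refine abs_integral_le_integral_abs.trans (integral_mono_of_nonneg
    (ae_of_all _ fun y => abs_nonneg _) (hi.abs.const_mul M) (ae_of_all _ fun y => ?_))
  simp only [abs_mul]
  exact mul_le_mul_of_nonneg_right (hM _ _) (abs_nonneg _)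

lemma IsPair.integrable_integral_mul_mollify (h : IsPair μ T C U W) (hρ : IsMollifier δ ρ)
    {g : Euc N → ℝ → ℝ} (hg : Measurable (Function.uncurry g)) {M : ℝ} (hM : ∀ x t, |g x t| ≤ M) :
    Integrable (fun t => ∫ x, g x t * mollify ρ (fun x => U x t) x) := by
  have hm : StronglyMeasurable (Function.uncurry fun x t => g x t * mollify ρ (fun x => U x t) x) :=
    (hg.mul (measurable_mollify_uncurry h.measurable_left
      hρ.isTestFn.measurable)).stronglyMeasurable
  exact (h.integrable.abs.integral_prod_right.const_mul M).mono'
    hm.integral_prod_left.aestronglyMeasurable (h.abs_integral_mul_mollify_le hρ hM)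

lemma IsPair.integral_sub_mul_nonpos (hμ : IsLevyMeasure μ) (hT : 0 < T) (h : IsPair μ T C U W)
    (hρ : IsMollifier δ ρ) {k : ℝ} (hk : 0 ≤ k) :
    ∫ t in Iio T, ∫ x, (mollify ρ (fun x => timePrimitive W x t) x
      - mollify ρ (fun x => timePrimitive W x (t - k)) x) * mollify ρ (fun x => U x t) x ≤ 0 := by
  set V := timePrimitive W with hV
  have hVm : Measurable (Function.uncurry V) := measurable_timePrimitive h.measurable_right
  set J : ℝ → ℝ := fun t => ∫ x, mollify ρ (fun x => V x t) x * mollify ρ (fun x => U x t) x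
  have hVb : ∀ t x, |mollify ρ (fun x => V x t) x| ≤ C * T := fun t =>
    hρ.abs_mollify_le fun x => h.abs_timePrimitive_le hT.le x t
  have hVρm : Measurable (Function.uncurry fun x t => mollify ρ (fun x => V x t) x) :=
    measurable_mollify_uncurry hVm hρ.isTestFn.measurable
  have hVρm' : Measurable (Function.uncurry fun x t => mollify ρ (fun x => V x (t - k)) x) :=
    hVρm.comp (by fun_prop : Measurable fun p : Euc N × ℝ => (p.1, p.2 - k))
  have hJ : Integrable J := h.integrable_integral_mul_mollify hρ hVρm (fun x t => hVb t x)
  have hI : Integrable (fun t => ∫ x, mollify ρ (fun x => V x (t - k)) x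
      * mollify ρ (fun x => U x t) x) :=
    h.integrable_integral_mul_mollify hρ hVρm' (fun x t => hVb (t - k) x)
  have hE := h.isEnergy hμ hT hρ
  have hE' : ∀ᵐ t, t - k < T → IsEnergy μ (mollify ρ (fun x => V x (t - k)))
      (mollify ρ (fun x => U x (t - k))) :=
    (measurePreserving_sub_right volume k).quasiMeasurePreserving.ae hE
  have hJ' : Integrable (fun t => J (t - k)) := hJ.comp_sub_right k
  have hJ0 : ∀ᵐ t, t < T → J t ≤ 0 := by
    filter_upwards [hE] with t ht htT using (ht htT).integral_mul_self_nonpos hμ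
  calc _ ≤ ∫ t in Iio T, ((1 / 2) * J t - (1 / 2) * J (t - k)) := by
        refine setIntegral_mono_on_ae ?_ ((hJ.const_mul _).sub (hJ'.const_mul _)).integrableOn
          measurableSet_Iio ?_
        · refine ((hJ.sub hI).congr ?_).integrableOn
          filter_upwards [h.ae_integrable] with t ht
          have hi := integrable_mollify ht hρ.isTestFn.integrable
          simp only [Pi.sub_apply, sub_mul]
          rw [integral_sub]
          · exact hi.bdd_mul (c := C * T) (hVρm.slice t).aestronglyMeasurable
              (ae_of_all _ (hVb t))
          · exact hi.bdd_mul (c := C * T) (hVρm'.slice t).aestronglyMeasurable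
              (ae_of_all _ (hVb (t - k)))
        · filter_upwards [hE, hE', h.ae_integrable] with t h1 h2 ht htT
          have htT : t < T := htT
          have hi := integrable_mollify ht hρ.isTestFn.integrable
          refine le_trans (le_of_eq ?_) ((h2 (by linarith)).integral_sub_le hμ (h1 htT))
          simp only [sub_mul]
          rw [integral_sub]
          · exact hi.bdd_mul (c := C * T) (hVρm.slice t).aestronglyMeasurable
              (ae_of_all _ (hVb t))
          · exact hi.bdd_mul (c := C * T) (hVρm'.slice t).aestronglyMeasurable
              (ae_of_all _ (hVb (t - k)))
    _ = (1 / 2) * (∫ t in Iio T, J t) - (1 / 2) * ∫ t in Iio (T - k), J t := by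
        rw [integral_sub (hJ.const_mul _).integrableOn (hJ'.const_mul _).integrableOn,
          integral_const_mul, integral_const_mul]
        congr 2
        rw [← integral_indicator measurableSet_Iio, ← integral_indicator measurableSet_Iio,
          ← integral_sub_right_eq_self (fun t => (Iio (T - k)).indicator (fun t => J t) t) k]
        refine integral_congr_ae (ae_of_all _ fun t => ?_)
        simp [indicator]
    _ ≤ 0 := by
        have : ∫ t in Iio (T - k), -J t ≤ ∫ t in Iio T, -J t := by
          refine setIntegral_mono_set hJ.neg.integrableOn ?_
            (Eventually.of_forall (Iio_subset_Iio (by linarith)))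
          filter_upwards [ae_restrict_of_ae hJ0, ae_restrict_mem measurableSet_Iio] with t h1 h2
          simpa using h1 h2
        rw [integral_neg, integral_neg] at this
        linarith

lemma IsPair.ae_tendsto_quotient (h : IsPair μ T C U W) :
    ∀ᵐ t, ∀ᵐ x, Tendsto (fun n : ℕ => ((n : ℝ) + 1) *
      (timePrimitive W x t - timePrimitive W x (t - 1 / ((n : ℝ) + 1)))) atTop (𝓝 (W x t)) := by
  have hVm : Measurable (Function.uncurry (timePrimitive W)) :=
    measurable_timePrimitive h.measurable_right
  have hs : MeasurableSet {p : Euc N × ℝ | Tendsto (fun n : ℕ => ((n : ℝ) + 1) *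
      (timePrimitive W p.1 p.2 - timePrimitive W p.1 (p.2 - 1 / ((n : ℝ) + 1)))) atTop
      (𝓝 (W p.1 p.2))} := by
    refine measurableSet_tendsto_fun (fun n => ?_) h.measurable_right
    refine (hVm.sub (hVm.comp (?_ :
      Measurable fun p : Euc N × ℝ => (p.1, p.2 - 1 / ((n : ℝ) + 1))))).const_mul _
    fun_prop
  have h1 : ∀ᵐ p : Euc N × ℝ ∂((volume : Measure (Euc N)).prod volume),
      Tendsto (fun n : ℕ => ((n : ℝ) + 1) *
      (timePrimitive W p.1 p.2 - timePrimitive W p.1 (p.2 - 1 / ((n : ℝ) + 1)))) atTop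
      (𝓝 (W p.1 p.2)) := by
    rw [Measure.ae_prod_iff_ae_ae hs]
    refine ae_of_all _ fun x => ?_
    filter_upwards [ae_hasDerivAt_setIntegral_Iic (h.integrable_right x)] with t ht
    have hlim : Tendsto (fun n : ℕ => t - 1 / ((n : ℝ) + 1)) atTop (𝓝[≠] t) := by
      refine tendsto_nhdsWithin_iff.2 ⟨?_, Eventually.of_forall fun n => ?_⟩
      · simpa using (tendsto_one_div_add_atTop_nhds_zero_nat (𝕜 := ℝ)).const_sub t
      · have : (0 : ℝ) < 1 / ((n : ℝ) + 1) := by positivity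
        simp only [mem_compl_iff, mem_singleton_iff]
        intro h'
        linarith
    refine (ht.tendsto_slope.comp hlim).congr fun n => ?_
    simp only [Function.comp_apply, slope_def_field, timePrimitive]
    have : (n : ℝ) + 1 ≠ 0 := by positivity
    field_simp
    ring
  have h2 := (Measure.measurePreserving_swap (μ := (volume : Measure ℝ))
    (ν := (volume : Measure (Euc N)))).quasiMeasurePreserving.ae h1
  exact Measure.ae_ae_of_ae_prod h2

lemma IsPair.integral_mollify_mul_nonpos (hμ : IsLevyMeasure μ) (hT : 0 < T)
    (h : IsPair μ T C U W) (hρ : IsMollifier δ ρ) :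
    ∫ t in Iio T, ∫ x, mollify ρ (fun x => W x t) x * mollify ρ (fun x => U x t) x ≤ 0 := by
  set V := timePrimitive W with hV
  have hVm : Measurable (Function.uncurry V) := measurable_timePrimitive h.measurable_right
  have hVb : ∀ x t, |V x t| ≤ C * T := fun x t => h.abs_timePrimitive_le hT.le x t
  have hρi := hρ.isTestFn.integrable
  have hpos : ∀ n : ℕ, (0 : ℝ) < (n : ℝ) + 1 := fun n => by positivity
  set q : ℕ → Euc N → ℝ → ℝ := fun n x t => ((n : ℝ) + 1) * (V x t - V x (t - 1 / ((n : ℝ) + 1)))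
    with hq
  have hqm : ∀ n, Measurable (Function.uncurry (q n)) := fun n => by
    refine (hVm.sub (hVm.comp (?_ :
      Measurable fun p : Euc N × ℝ => (p.1, p.2 - 1 / ((n : ℝ) + 1))))).const_mul _
    fun_prop
  have hqb : ∀ n x t, |q n x t| ≤ C := by
    intro n x t
    have := h.abs_timePrimitive_sub_le x (s := t - 1 / ((n : ℝ) + 1)) (t := t)
      (by linarith [one_div_pos.2 (hpos n)])
    simp only [hq]
    rw [abs_mul, abs_of_pos (hpos n)]
    refine (mul_le_mul_of_nonneg_left this (hpos n).le).trans (le_of_eq ?_)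
    have := (hpos n).ne'
    field_simp
    ring
  have hqρm : ∀ n, Measurable (Function.uncurry fun x t => mollify ρ (fun x => q n x t) x) :=
    fun n => measurable_mollify_uncurry (hqm n) hρ.isTestFn.measurable
  have hqρb : ∀ n x t, |mollify ρ (fun x => q n x t) x| ≤ C := fun n x t =>
    hρ.abs_mollify_le (fun x => hqb n x t) x
  have hle : ∀ n, ∫ t in Iio T, ∫ x, mollify ρ (fun x => q n x t) x
      * mollify ρ (fun x => U x t) x ≤ 0 := by
    intro n
    have h1 := h.integral_sub_mul_nonpos hμ hT hρ (k := 1 / ((n : ℝ) + 1)) (by positivity)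
    have h2 := mul_nonpos_of_nonneg_of_nonpos (hpos n).le h1
    refine le_trans (le_of_eq ?_) h2
    rw [← integral_const_mul]
    refine integral_congr_ae (ae_of_all _ fun t => ?_)
    simp only
    rw [← integral_const_mul]
    refine integral_congr_ae (ae_of_all _ fun x => ?_)
    simp only
    rw [← mul_assoc]
    congr 1
    unfold mollify
    rw [← integral_sub (integrable_mollify_integrand (hVm.slice t) hρi (fun x => hVb x t) x)
      (integrable_mollify_integrand (hVm.slice _) hρi (fun x => hVb x _) x), ← integral_const_mul]
    refine integral_congr_ae (ae_of_all _ fun y => ?_)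
    simp only [hq]
    ring
  refine le_of_tendsto' (x := atTop) ?_ hle
  refine tendsto_integral_of_dominated_convergence (fun t => C * ∫ x, |U x t|) (fun n => ?_)
    (h.integrable.abs.integral_prod_right.const_mul C).integrableOn (fun n => ?_) ?_
  · exact (h.integrable_integral_mul_mollify hρ (hqρm n) (hqρb n)).aestronglyMeasurable.restrict
  · exact ae_restrict_of_ae (h.abs_integral_mul_mollify_le hρ (hqρb n))
  · refine ae_restrict_of_ae ?_
    filter_upwards [h.ae_tendsto_quotient, h.ae_integrable] with t ht hU
    have hi := integrable_mollify hU hρi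
    refine tendsto_integral_of_dominated_convergence (fun x => C * |mollify ρ (fun x => U x t) x|)
      (fun n => ((hqρm n).slice t).aestronglyMeasurable.mul hi.aestronglyMeasurable)
      (hi.abs.const_mul C) (fun n => ae_of_all _ fun x => ?_) (ae_of_all _ fun x => ?_)
    · rw [Real.norm_eq_abs, abs_mul]
      exact mul_le_mul_of_nonneg_right (hqρb n x t) (abs_nonneg _)
    · refine Tendsto.mul_const _ ?_
      refine tendsto_integral_of_dominated_convergence (fun y => C * |ρ y|) (fun n => ?_)
        (hρi.abs.const_mul C) (fun n => ae_of_all _ fun y => ?_) ?_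
      · exact (integrable_mollify_integrand ((hqm n).slice t) hρi
          (fun x => hqb n x t) x).aestronglyMeasurable
      · rw [Real.norm_eq_abs, abs_mul]
        exact mul_le_mul_of_nonneg_right (hqb n _ t) (abs_nonneg _)
      · filter_upwards [(measurePreserving_add_left volume x).quasiMeasurePreserving.ae ht]
          with y hy using hy.mul_const _

lemma IsPair.ae_right_eq_zero (hμ : IsLevyMeasure μ) (hT : 0 < T) (h : IsPair μ T C U W) :
    ∀ᵐ p : Euc N × ℝ ∂((volume : Measure (Euc N)).prod volume), W p.1 p.2 = 0 := by
  choose ρ hρ using fun n : ℕ => exists_isMollifier (N := N) (δ := 1 / ((n : ℝ) + 1))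
    (by positivity)
  have hi : Integrable (fun p : Euc N × ℝ => U p.1 p.2 * W p.1 p.2)
      ((volume : Measure (Euc N)).prod volume) :=
    h.integrable.mul_bdd (c := C) h.measurable_right.aestronglyMeasurable
      (ae_of_all _ fun p => h.bound _ _)
  have hWm : ∀ n, Measurable (Function.uncurry fun x t => mollify (ρ n) (fun x => W x t) x) :=
    fun n => measurable_mollify_uncurry h.measurable_right (hρ n).isTestFn.measurable
  have hWb : ∀ n x t, |mollify (ρ n) (fun x => W x t) x| ≤ C := fun n x t =>
    (hρ n).abs_mollify_le (fun x => h.bound x t) x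
  have hle : ∫ t in Iio T, ∫ x, U x t * W x t ≤ 0 := by
    refine le_of_tendsto' (x := atTop) ?_ (fun n => h.integral_mollify_mul_nonpos hμ hT (hρ n))
    refine tendsto_integral_of_dominated_convergence (fun t => C * ∫ x, |U x t|) (fun n => ?_)
      (h.integrable.abs.integral_prod_right.const_mul C).integrableOn (fun n => ?_) ?_
    · exact (h.integrable_integral_mul_mollify (hρ n) (hWm n)
        (hWb n)).aestronglyMeasurable.restrict
    · exact ae_restrict_of_ae (h.abs_integral_mul_mollify_le (hρ n) (hWb n))
    · refine ae_restrict_of_ae ?_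
      filter_upwards [h.ae_integrable] with t ht
      refine (tendsto_integral_mollify_mul_mollify ht (h.measurable_slice t)
        (fun x => h.bound x t) hρ).congr fun n => ?_
      exact integral_congr_ae (ae_of_all _ fun x => mul_comm _ _)
  rw [setIntegral_eq_integral_of_forall_compl_eq_zero (fun t ht => by
    have : t ∉ Ioo 0 T := fun h' => ht h'.2
    simp [h.left_eq_zero _ t this])] at hle
  have hle2 : ∫ p : Euc N × ℝ, U p.1 p.2 * W p.1 p.2 ∂((volume : Measure (Euc N)).prod volume)
      ≤ 0 := by
    rw [integral_prod_symm _ hi]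
    exact hle
  have h0 := (integral_eq_zero_iff_of_nonneg (fun p => h.mul_nonneg _ _) hi).1
    (le_antisymm hle2 (integral_nonneg fun p => h.mul_nonneg _ _))
  filter_upwards [h0] with p hp
  rcases mul_eq_zero.1 hp with h1 | h1
  · exact h.right_eq_zero_of_left_eq_zero h1
  · exact h1

lemma IsPair.ae_left_eq_zero (hμ : IsLevyMeasure μ) (hT : 0 < T) (h : IsPair μ T C U W) :
    ∀ᵐ p : Euc N × ℝ ∂((volume : Measure (Euc N)).prod volume), U p.1 p.2 = 0 := by
  choose ρ hρ using fun n : ℕ => exists_isMollifier (N := N) (δ := 1 / ((n : ℝ) + 1))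
    (by positivity)
  have hV : ∀ᵐ x : Euc N, ∀ t, timePrimitive W x t = 0 := by
    filter_upwards [Measure.ae_ae_of_ae_prod (h.ae_right_eq_zero hμ hT)] with x hx t
    exact integral_eq_zero_of_ae (ae_restrict_of_ae hx)
  have key : ∀ᵐ t, ∀ᵐ x, U x t = 0 := by
    filter_upwards [h.ae_integrable, ae_all_iff.2 fun n => h.mollify_eq hμ (hρ n).isTestFn]
      with t hU ht
    rcases lt_or_ge t T with htT | htT
    swap
    · exact ae_of_all _ fun x => h.left_eq_zero x t fun h' => absurd h'.2 (not_lt.2 htT)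
    have hz : ∀ n, ∫ x, |mollify (ρ n) (fun x => U x t) x - U x t| = ∫ x, |U x t| := by
      intro n
      refine integral_congr_ae ?_
      filter_upwards [ht n htT] with x hx
      have : mollify (Lop μ (ρ n)) (fun x => timePrimitive W x t) x = 0 := by
        refine integral_eq_zero_of_ae ?_
        filter_upwards [(measurePreserving_add_left volume x).quasiMeasurePreserving.ae hV]
          with y hy
        simp [hy t]
      rw [hx, this, zero_sub, abs_neg]
    have hlim := tendsto_integral_abs_mollify_sub hU hρ
    simp only [hz] at hlim
    have h0 := tendsto_nhds_unique hlim tendsto_const_nhds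
    have := (integral_eq_zero_iff_of_nonneg (fun x => abs_nonneg _) hU.abs).1 h0.symm
    filter_upwards [this] with x hx
    simpa using hx
  have hs : MeasurableSet {p : ℝ × Euc N | U p.2 p.1 = 0} :=
    measurableSet_eq_fun (h.measurable_left.comp measurable_swap) measurable_const
  have h1 := (Measure.ae_prod_iff_ae_ae (μ := (volume : Measure ℝ))
    (ν := (volume : Measure (Euc N))) (p := fun p => U p.2 p.1 = 0) hs).2 key
  exact (Measure.measurePreserving_swap (μ := (volume : Measure (Euc N)))
    (ν := (volume : Measure ℝ))).quasiMeasurePreserving.ae h1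

end Pair

section Weak
variable {N : ℕ} {μ : Measure (Euc N)} {T M Φ : ℝ} {ψ u f : Euc N → ℝ → ℝ}

lemma IsSTTestFn.deriv_eq (hψ : IsSTTestFn T ψ) (x : Euc N) (t : ℝ) :
    deriv (ψ x) t = fderiv ℝ (Function.uncurry ψ) (x, t) (0, 1) := by
  have h1 : HasFDerivAt (Function.uncurry ψ) (fderiv ℝ (Function.uncurry ψ) (x, t)) (x, t) :=
    (hψ.1.differentiable (by simp)).differentiableAt.hasFDerivAt
  have h2 : HasDerivAt (fun s : ℝ => (x, s)) ((0 : Euc N), (1 : ℝ)) t :=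
    (hasDerivAt_const t x).prodMk (hasDerivAt_id t)
  exact (h1.comp_hasDerivAt t h2).deriv

lemma IsSTTestFn.deriv_time (hψ : IsSTTestFn T ψ) :
    IsSTTestFn T (fun x t => deriv (ψ x) t) := by
  have e : Function.uncurry (fun x t => deriv (ψ x) t)
      = fun p => fderiv ℝ (Function.uncurry ψ) p (0, 1) := by
    ext ⟨x, t⟩
    exact hψ.deriv_eq x t
  refine ⟨?_, ?_, ?_⟩ <;> rw [e]
  · exact (hψ.1.fderiv_right (m := (⊤ : ℕ∞)) (by simp)).clm_apply contDiff_const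
  · exact hψ.2.1.fderiv_apply ℝ _
  · exact (tsupport_fderiv_apply_subset ℝ _).trans hψ.2.2

lemma integrable_mul_deriv (hψ : IsSTTestFn T ψ) (hu : Measurable (Function.uncurry u))
    (hM : ∀ x t, |u x t| ≤ M) (t : ℝ) : Integrable (fun x => u x t * deriv (ψ x) t) := by
  obtain ⟨A, R, C, h⟩ := hψ.deriv_time.exists_isSlice
  exact (h t).integrable.bdd_mul (c := M) (hu.slice t).aestronglyMeasurable
    (ae_of_all _ fun x => hM x t)

lemma integrable_mul_Lop (hμ : IsLevyMeasure μ) (hψ : IsSTTestFn T ψ)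
    (hf : Measurable (Function.uncurry f))
    (hΦ : ∀ x t, |f x t| ≤ Φ) (t : ℝ) :
    Integrable (fun x => f x t * Lop μ (fun y => ψ y t) x) := by
  obtain ⟨A, R, C, h⟩ := hψ.exists_isSlice
  exact ((h t).integrable_Lop hμ).bdd_mul (c := Φ) (hf.slice t).aestronglyMeasurable
    (ae_of_all _ fun x => hΦ x t)

lemma abs_integral_mul_le {α : Type*} [MeasurableSpace α] {ν : Measure α} {a b : α → ℝ} {C : ℝ}
    (ha : ∀ x, |a x| ≤ C) (hb : Integrable b ν) : |∫ x, a x * b x ∂ν| ≤ C * ∫ x, |b x| ∂ν := by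
  rw [← integral_const_mul, ← Real.norm_eq_abs]
  refine norm_integral_le_of_norm_le (hb.abs.const_mul C) (ae_of_all _ fun x => ?_)
  rw [Real.norm_eq_abs, abs_mul]
  exact mul_le_mul_of_nonneg_right (ha x) (abs_nonneg _)

lemma exists_bound_weak_integrand (hμ : IsLevyMeasure μ) (hψ : IsSTTestFn T ψ) (M Φ : ℝ) :
    ∃ B : ℝ, ∀ u f : Euc N → ℝ → ℝ, Measurable (Function.uncurry u) →
      Measurable (Function.uncurry f) → (∀ x t, |u x t| ≤ M) → (∀ x t, |f x t| ≤ Φ) →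
      ∀ t, |∫ x, (u x t * deriv (ψ x) t + f x t * Lop μ (fun y => ψ y t) x)| ≤ B := by
  obtain ⟨A, R, C, h⟩ := hψ.exists_isSlice
  obtain ⟨A', R', C', h'⟩ := hψ.deriv_time.exists_isSlice
  refine ⟨M * (C' * (volume : Measure (Euc N)).real (Metric.closedBall 0 R')) +
    Φ * (sliceConst μ A R C -
      A * smallMoment μ 1 * (volume : Measure (Euc N)).real (Metric.closedBall 0 (R + 1))),
    fun u f hu hf hM hΦ t => ?_⟩
  have hM0 : 0 ≤ M := (abs_nonneg _).trans (hM 0 0)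
  have hΦ0 : 0 ≤ Φ := (abs_nonneg _).trans (hΦ 0 0)
  rw [integral_add (integrable_mul_deriv hψ hu hM t) (integrable_mul_Lop hμ hψ hf hΦ t)]
  refine (abs_add_le _ _).trans (add_le_add ?_ ?_)
  · exact (abs_integral_mul_le (fun x => hM x t) (h' t).integrable).trans
      (mul_le_mul_of_nonneg_left (h' t).integral_abs_le hM0)
  · exact (abs_integral_mul_le (fun x => hΦ x t) ((h t).integrable_Lop hμ)).trans
      (mul_le_mul_of_nonneg_left ((h t).integral_abs_Lop_le hμ) hΦ0)

lemma measurable_weak_integrand (hμ : IsLevyMeasure μ) (hψ : IsSTTestFn T ψ)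
    (hu : Measurable (Function.uncurry u)) (hf : Measurable (Function.uncurry f)) :
    Measurable (fun p : Euc N × ℝ => u p.1 p.2 * deriv (ψ p.1) p.2
      + f p.1 p.2 * Lop μ (fun y => ψ y p.2) p.1) := by
  have := hμ.sigmaFinite
  exact (hu.mul hψ.deriv_time.1.continuous.measurable).add (hf.mul (measurable_Lop_uncurry hψ.1))

lemma aestronglyMeasurable_weak_integral (hμ : IsLevyMeasure μ) (hψ : IsSTTestFn T ψ)
    (hu : Measurable (Function.uncurry u)) (hf : Measurable (Function.uncurry f)) (ν : Measure ℝ) :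
    AEStronglyMeasurable
      (fun t => ∫ x, (u x t * deriv (ψ x) t + f x t * Lop μ (fun y => ψ y t) x)) ν :=
  (StronglyMeasurable.integral_prod_left'
    (measurable_weak_integrand hμ hψ hu hf).stronglyMeasurable).aestronglyMeasurable

lemma integrable_weak_integral (hμ : IsLevyMeasure μ) (hψ : IsSTTestFn T ψ)
    (hu : Measurable (Function.uncurry u)) (hf : Measurable (Function.uncurry f))
    (hM : ∀ x t, |u x t| ≤ M) (hΦ : ∀ x t, |f x t| ≤ Φ) :
    IntegrableOn (fun t => ∫ x, (u x t * deriv (ψ x) t + f x t * Lop μ (fun y => ψ y t) x))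
      (Ioo 0 T) := by
  obtain ⟨B, hB⟩ := exists_bound_weak_integrand hμ hψ M Φ
  exact Integrable.mono' (integrable_const B)
    (aestronglyMeasurable_weak_integral hμ hψ hu hf _) (ae_of_all _ (hB u f hu hf hM hΦ))

/-- Truncation of a real number to `[-M, M]`. -/
noncomputable def clamp (M r : ℝ) : ℝ := max (-M) (min r M)

lemma continuous_clamp (M : ℝ) : Continuous (clamp M) := by unfold clamp; fun_prop

lemma abs_clamp_le (hM : 0 ≤ M) (r : ℝ) : |clamp M r| ≤ M := by
  unfold clamp
  rw [abs_le]
  exact ⟨le_max_left _ _, max_le (by linarith) (min_le_right _ _)⟩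

lemma clamp_of_abs_le {r : ℝ} (h : |r| ≤ M) : clamp M r = r := by
  rw [abs_le] at h
  unfold clamp
  rw [min_eq_left h.2, max_eq_right h.1]

lemma ae_ae_of_ae_QTvol {p : Euc N → ℝ → Prop} (h : ∀ᵐ q ∂(QTvol N T), p q.1 q.2) :
    ∀ᵐ t ∂((volume : Measure ℝ).restrict (Ioo 0 T)), ∀ᵐ x : Euc N, p x t := by
  have h2 := (Measure.measurePreserving_swap (μ := (volume : Measure ℝ).restrict (Ioo 0 T))
    (ν := (volume : Measure (Euc N)))).quasiMeasurePreserving.ae h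
  exact Measure.ae_ae_of_ae_prod h2

lemma IsDistSolOp.congr_ae {A : (Euc N → ℝ) → Euc N → ℝ} {φ : ℝ → ℝ} {u0 : Euc N → ℝ}
    {v : Euc N → ℝ → ℝ} (h : IsDistSolOp T A φ u0 u)
    (huv : ∀ᵐ p ∂(QTvol N T), u p.1 p.2 = v p.1 p.2) : IsDistSolOp T A φ u0 v := by
  intro ψ hψ
  refine Eq.trans ?_ (h ψ hψ)
  congr 1
  refine integral_congr_ae ?_
  filter_upwards [ae_ae_of_ae_QTvol (p := fun x t => u x t = v x t) huv] with t ht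
  refine integral_congr_ae ?_
  filter_upwards [ht] with x hx
  rw [hx]

lemma MemLinfQT.exists_clamp (h : MemLinfQT T u) :
    ∃ M₀, ∀ M, M₀ ≤ M → 0 ≤ M → ∃ v : Euc N → ℝ → ℝ, Measurable (Function.uncurry v) ∧
      (∀ x t, |v x t| ≤ M) ∧ ∀ᵐ p ∂(QTvol N T), u p.1 p.2 = v p.1 p.2 := by
  obtain ⟨hm, C, hC⟩ := h
  refine ⟨C, fun M hM hM0 => ⟨fun x t => clamp M (hm.mk _ (x, t)), ?_, fun x t =>
    abs_clamp_le hM0 _, ?_⟩⟩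
  · exact (continuous_clamp M).measurable.comp (hm.stronglyMeasurable_mk.measurable.comp
      measurable_id)
  · filter_upwards [hm.ae_eq_mk, hC] with p h1 h2
    have : hm.mk _ (p.1, p.2) = u p.1 p.2 := h1.symm
    rw [this, clamp_of_abs_le (h2.trans hM)]

lemma Monotone.abs_le_of_abs_le {φ : ℝ → ℝ} (hφ : Monotone φ) {M r : ℝ} (h : |r| ≤ M) :
    |φ r| ≤ |φ M| + |φ (-M)| := by
  rw [abs_le] at h
  have h1 := hφ h.1
  have h2 := hφ h.2
  rw [abs_le]
  constructor
  · linarith [neg_abs_le (φ (-M)), abs_nonneg (φ M)]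
  · linarith [le_abs_self (φ M), abs_nonneg (φ (-M))]

/-- A continuous function on a compact interval is Lipschitz up to a small error. -/
lemma exists_abs_sub_le_add_mul {φ : ℝ → ℝ} (hφc : Continuous φ) (hφ : Monotone φ) (M : ℝ)
    {δ : ℝ} (hδ : 0 < δ) :
    ∃ K : ℝ, 0 ≤ K ∧ ∀ a b, |a| ≤ M → |b| ≤ M → |φ a - φ b| ≤ δ + K * |a - b| := by
  have huc := (isCompact_Icc (a := -M) (b := M)).uniformContinuousOn_of_continuous
    hφc.continuousOn
  obtain ⟨η, hη, H⟩ := Metric.uniformContinuousOn_iff.1 huc δ hδ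
  set B := 2 * (|φ M| + |φ (-M)|) with hB
  refine ⟨B / η, by positivity, fun a b ha hb => ?_⟩
  rcases lt_or_ge (|a - b|) η with h | h
  · have := H a (abs_le.1 ha) b (abs_le.1 hb) h
    rw [Real.dist_eq] at this
    have : 0 ≤ B / η * |a - b| := by positivity
    linarith
  · have h1 : |φ a - φ b| ≤ B := by
      linarith [abs_sub (φ a) (φ b), hφ.abs_le_of_abs_le ha, hφ.abs_le_of_abs_le hb]
    have h2 : B ≤ B / η * |a - b| := by
      rw [div_mul_eq_mul_div, le_div_iff₀ hη]
      exact mul_le_mul_of_nonneg_left h (by positivity)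
    linarith

lemma IsDistSolOp.unique {φ : ℝ → ℝ} (hφc : Continuous φ) (hφ : Monotone φ)
    (hμ : IsLevyMeasure μ) (hT : 0 < T) {u0 : Euc N → ℝ} {v : Euc N → ℝ → ℝ}
    (huL : MemLinfQT T u) (hu1 : MemL1QT T u) (hu : IsDistSolOp T (Lop μ) φ u0 u)
    (hvL : MemLinfQT T v) (hv1 : MemL1QT T v) (hv : IsDistSolOp T (Lop μ) φ u0 v) :
    ∀ᵐ p ∂(QTvol N T), v p.1 p.2 = u p.1 p.2 := by
  obtain ⟨M₁, h₁⟩ := huL.exists_clamp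
  obtain ⟨M₂, h₂⟩ := hvL.exists_clamp
  set M := max (max M₁ M₂) 0 with hMdef
  have hM0 : 0 ≤ M := le_max_right _ _
  obtain ⟨a, ham, hab, hua⟩ := h₁ M ((le_max_left _ _).trans (le_max_left _ _)) hM0
  obtain ⟨b, hbm, hbb, hvb⟩ := h₂ M ((le_max_right _ _).trans (le_max_left _ _)) hM0
  set Φ := |φ M| + |φ (-M)|
  have hφa : ∀ x t, |φ (a x t)| ≤ Φ := fun x t => hφ.abs_le_of_abs_le (hab x t)
  have hφb : ∀ x t, |φ (b x t)| ≤ Φ := fun x t => hφ.abs_le_of_abs_le (hbb x t)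
  have hφam : Measurable (Function.uncurry fun x t => φ (a x t)) := hφc.measurable.comp ham
  have hφbm : Measurable (Function.uncurry fun x t => φ (b x t)) := hφc.measurable.comp hbm
  have hS : MeasurableSet {p : Euc N × ℝ | p.2 ∈ Ioo 0 T} := measurable_snd measurableSet_Ioo
  have hQ : QTvol N T = ((volume : Measure (Euc N)).prod volume).restrict
      {p : Euc N × ℝ | p.2 ∈ Ioo 0 T} := by
    rw [QTvol, ← Measure.restrict_univ (μ := (volume : Measure (Euc N))), Measure.prod_restrict,
      Measure.restrict_univ]
    congr 1
    ext p
    simp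
  have hind : ∀ (c : ℝ → ℝ), ∀ t, t ∈ Ioo 0 T → (Ioo 0 T).indicator c t = c t := fun c t ht =>
    indicator_of_mem ht c
  have hpair : IsPair μ T (2 * Φ) (fun x t => (Ioo 0 T).indicator (fun t => a x t - b x t) t)
      (fun x t => (Ioo 0 T).indicator (fun t => φ (a x t) - φ (b x t)) t) := by
    refine ⟨?_, ?_, fun x t ht => indicator_of_notMem ht _, fun x t => ?_, ?_, fun δ hδ => ?_,
      fun x t => ?_, fun ψ hψ => ?_⟩
    · exact (ham.sub hbm).indicator hS
    · exact (hφam.sub hφbm).indicator hS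
    · by_cases ht : t ∈ Ioo 0 T
      · rw [indicator_of_mem ht]
        linarith [abs_sub (φ (a x t)) (φ (b x t)), hφa x t, hφb x t]
      · rw [indicator_of_notMem ht, abs_zero]
        have := (abs_nonneg _).trans (hφa x t)
        positivity
    · have : IntegrableOn (fun p : Euc N × ℝ => a p.1 p.2 - b p.1 p.2)
          {p : Euc N × ℝ | p.2 ∈ Ioo 0 T} ((volume : Measure (Euc N)).prod volume) := by
        rw [IntegrableOn, ← hQ]
        exact (Integrable.congr hu1 hua).sub (Integrable.congr hv1 hvb)
      exact this.integrable_indicator hS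
    · obtain ⟨K, hK, hle⟩ := exists_abs_sub_le_add_mul hφc hφ M hδ
      refine ⟨K, fun x t => ?_⟩
      by_cases ht : t ∈ Ioo 0 T
      · simp only [indicator_of_mem ht]
        exact hle _ _ (hab x t) (hbb x t)
      · simp [indicator_of_notMem ht]
    · by_cases ht : t ∈ Ioo 0 T
      · simp only [indicator_of_mem ht]
        rcases le_total (a x t) (b x t) with h | h
        · exact mul_nonneg_of_nonpos_of_nonpos (sub_nonpos.2 h) (sub_nonpos.2 (hφ h))
        · exact mul_nonneg (sub_nonneg.2 h) (sub_nonneg.2 (hφ h))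
      · simp [indicator_of_notMem ht]
    · have e1 := hu.congr_ae hua ψ hψ
      have e2 := hv.congr_ae hvb ψ hψ
      have i1 := integrable_weak_integral hμ hψ ham hφam hab hφa
      have i2 := integrable_weak_integral hμ hψ hbm hφbm hbb hφb
      have e3 := integral_sub i1 i2
      have e4 : ∀ p q r : ℝ, p + r = 0 → q + r = 0 → p - q = 0 := fun p q r h1 h2 => by linarith
      refine Eq.trans ?_ (e3.trans (e4 _ _ _ e1 e2))
      refine setIntegral_congr_fun measurableSet_Ioo fun t ht => ?_
      simp only [indicator_of_mem ht]
      rw [← integral_sub]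
      · refine integral_congr_ae (ae_of_all _ fun x => ?_)
        simp only
        ring
      · exact (integrable_mul_deriv hψ ham hab t).add (integrable_mul_Lop hμ hψ hφam hφa t)
      · exact (integrable_mul_deriv hψ hbm hbb t).add (integrable_mul_Lop hμ hψ hφbm hφb t)
  have h0 := hpair.ae_left_eq_zero hμ hT
  have h0' := ae_restrict_of_ae (s := {p : Euc N × ℝ | p.2 ∈ Ioo 0 T}) h0
  have hmem := ae_restrict_mem (μ := (volume : Measure (Euc N)).prod volume) hS
  rw [← hQ] at h0' hmem
  filter_upwards [h0', hmem, hua, hvb] with p h1 h2 h3 h4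
  have h2 : p.2 ∈ Ioo 0 T := h2
  rw [indicator_of_mem h2] at h1
  rw [h3, h4]
  linarith

end Weak

section Euler
variable {N : ℕ} {ν : Measure (Euc N)} {g : ℝ → ℝ} {h M : ℝ} {u v : Euc N → ℝ}

/-- One explicit Euler step for `∂_t u = jumpOp ν (g ∘ u)`. -/
noncomputable def eulerStep (ν : Measure (Euc N)) (g : ℝ → ℝ) (h : ℝ) (u : Euc N → ℝ)
    (x : Euc N) : ℝ := u x + h * jumpOp ν (fun y => g (u y)) x

/-- The stability (CFL) condition for the explicit Euler scheme on `[-M, M]`. -/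
structure IsStable (ν : Measure (Euc N)) (g : ℝ → ℝ) (h M : ℝ) : Prop where
  isFinite : IsFiniteMeasure ν
  symm : ν.map (fun z => -z) = ν
  mono : Monotone g
  step_nonneg : 0 ≤ h
  bound_nonneg : 0 ≤ M
  lip : ∀ a b, |a| ≤ M → |b| ≤ M → h * ν.real univ * |g a - g b| ≤ |a - b|

lemma IsStable.measurable_comp (H : IsStable ν g h M) (hu : Measurable u) :
    Measurable (fun x => g (u x)) := H.mono.measurable.comp hu

lemma IsStable.measurable_eulerStep (H : IsStable ν g h M) (hu : Measurable u) :
    Measurable (eulerStep ν g h u) := by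
  have := H.isFinite
  exact hu.add ((measurable_jumpOp (H.measurable_comp hu)).const_mul h)

lemma IsStable.abs_comp_le (H : IsStable ν g h M) (hM : ∀ x, |u x| ≤ M) (x : Euc N) :
    |g (u x)| ≤ |g M| + |g (-M)| := H.mono.abs_le_of_abs_le (hM x)

lemma IsStable.integrable_shift (H : IsStable ν g h M) (hu : Measurable u) (hM : ∀ x, |u x| ≤ M)
    (x : Euc N) : Integrable (fun z => g (u (x + z))) ν := by
  have := H.isFinite
  exact Integrable.of_bound
    ((H.measurable_comp hu).comp (measurable_const_add x)).aestronglyMeasurable _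
    (ae_of_all _ fun z => H.abs_comp_le hM (x + z))

lemma IsStable.eulerStep_eq (H : IsStable ν g h M) (hu : Measurable u) (hM : ∀ x, |u x| ≤ M)
    (x : Euc N) : eulerStep ν g h u x
      = (u x - h * ν.real univ * g (u x)) + h * ∫ z, g (u (x + z)) ∂ν := by
  have := H.isFinite
  unfold eulerStep jumpOp
  rw [integral_sub (H.integrable_shift hu hM x) (integrable_const _), integral_const, smul_eq_mul]
  ring

lemma IsStable.monotone_aux (H : IsStable ν g h M) {a b : ℝ} (ha : |a| ≤ M) (hb : |b| ≤ M)
    (hab : a ≤ b) : a - h * ν.real univ * g a ≤ b - h * ν.real univ * g b := by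
  have := H.lip b a hb ha
  rw [abs_of_nonneg (sub_nonneg.2 (H.mono hab)), abs_of_nonneg (sub_nonneg.2 hab)] at this
  linarith

lemma IsStable.abs_eulerStep_le (H : IsStable ν g h M) (hu : Measurable u)
    (hM : ∀ x, |u x| ≤ M) (x : Euc N) : |eulerStep ν g h u x| ≤ M := by
  have := H.isFinite
  have h0 := H.step_nonneg
  have hMM : |M| ≤ M := (abs_of_nonneg H.bound_nonneg).le
  have hMM' : |-M| ≤ M := by rwa [abs_neg]
  have hi := H.integrable_shift hu hM x
  rw [H.eulerStep_eq hu hM x, abs_le]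
  have e : ∀ c : ℝ, ∫ _z, c ∂ν = ν.real univ * c := fun c => by
    rw [integral_const, smul_eq_mul]
  have h1 : ∫ z, g (u (x + z)) ∂ν ≤ ν.real univ * g M := by
    rw [← e]
    exact integral_mono hi (integrable_const _) fun z => H.mono (abs_le.1 (hM _)).2
  have h2 : ν.real univ * g (-M) ≤ ∫ z, g (u (x + z)) ∂ν := by
    rw [← e]
    exact integral_mono (integrable_const _) hi fun z => H.mono (abs_le.1 (hM _)).1
  have h3 := H.monotone_aux (hM x) hMM (abs_le.1 (hM x)).2
  have h4 := H.monotone_aux hMM' (hM x) (abs_le.1 (hM x)).1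
  have h5 := mul_le_mul_of_nonneg_left h1 h0
  have h6 := mul_le_mul_of_nonneg_left h2 h0
  constructor <;> nlinarith

lemma IsStable.abs_sub_eq (H : IsStable ν g h M) {a b : ℝ} (ha : |a| ≤ M) (hb : |b| ≤ M) :
    |(a - h * ν.real univ * g a) - (b - h * ν.real univ * g b)|
      + h * ν.real univ * |g a - g b| = |a - b| := by
  wlog hab : b ≤ a generalizing a b
  · rw [abs_sub_comm, abs_sub_comm (g a), abs_sub_comm a]
    exact this hb ha (le_of_not_ge hab)
  rw [abs_of_nonneg (sub_nonneg.2 (H.monotone_aux hb ha hab)),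
    abs_of_nonneg (sub_nonneg.2 (H.mono hab)), abs_of_nonneg (sub_nonneg.2 hab)]
  ring

lemma IsStable.lintegral_eulerStep_sub_le (H : IsStable ν g h M) (hu : Measurable u)
    (hM : ∀ x, |u x| ≤ M) (hv : Measurable v) (hM' : ∀ x, |v x| ≤ M) :
    ∫⁻ x, ‖eulerStep ν g h u x - eulerStep ν g h v x‖ₑ ≤ ∫⁻ x, ‖u x - v x‖ₑ := by
  have := H.isFinite
  have hgu := H.measurable_comp hu
  have hgv := H.measurable_comp hv
  set G : ℝ → ℝ := fun r => r - h * ν.real univ * g r with hG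
  have hm : Measurable fun x => ‖g (u x) - g (v x)‖ₑ := (hgu.sub hgv).enorm
  have hm2 : Measurable fun p : Euc N × Euc N => ‖g (u (p.1 + p.2)) - g (v (p.1 + p.2))‖ₑ :=
    hm.comp (measurable_fst.add measurable_snd)
  have hpt : ∀ x, ‖eulerStep ν g h u x - eulerStep ν g h v x‖ₑ ≤ ‖G (u x) - G (v x)‖ₑ
      + ‖h‖ₑ * ∫⁻ z, ‖g (u (x + z)) - g (v (x + z))‖ₑ ∂ν := by
    intro x
    have e : eulerStep ν g h u x - eulerStep ν g h v x = (G (u x) - G (v x))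
        + h * ∫ z, (g (u (x + z)) - g (v (x + z))) ∂ν := by
      rw [H.eulerStep_eq hu hM, H.eulerStep_eq hv hM',
        integral_sub (H.integrable_shift hu hM x) (H.integrable_shift hv hM' x)]
      simp only [hG]
      ring
    rw [e]
    refine (enorm_add_le _ _).trans (add_le_add le_rfl ?_)
    rw [enorm_mul]
    exact mul_le_mul_right (enorm_integral_le_lintegral_enorm _) _
  have hGm : Measurable fun x => ‖G (u x) - G (v x)‖ₑ :=
    ((hu.sub (hgu.const_mul _)).sub (hv.sub (hgv.const_mul _))).enorm
  calc ∫⁻ x, ‖eulerStep ν g h u x - eulerStep ν g h v x‖ₑ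
      ≤ ∫⁻ x, (‖G (u x) - G (v x)‖ₑ
        + ‖h‖ₑ * ∫⁻ z, ‖g (u (x + z)) - g (v (x + z))‖ₑ ∂ν) := lintegral_mono hpt
    _ = (∫⁻ x, ‖G (u x) - G (v x)‖ₑ)
        + ‖h‖ₑ * ((∫⁻ x, ‖g (u x) - g (v x)‖ₑ) * ν univ) := by
        rw [lintegral_add_left hGm, lintegral_const_mul _ hm2.lintegral_prod_right',
          lintegral_lintegral_swap hm2.aemeasurable]
        congr 2
        rw [← lintegral_const]
        refine lintegral_congr fun z => ?_
        exact lintegral_add_right_eq_self (fun x => ‖g (u x) - g (v x)‖ₑ) z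
    _ = ∫⁻ x, (‖G (u x) - G (v x)‖ₑ + ‖h * ν.real univ‖ₑ * ‖g (u x) - g (v x)‖ₑ) := by
        rw [lintegral_add_left hGm, lintegral_const_mul _ hm, enorm_mul,
          Real.enorm_of_nonneg measureReal_nonneg, ofReal_measureReal]
        ring
    _ = ∫⁻ x, ‖u x - v x‖ₑ := by
        refine lintegral_congr fun x => ?_
        have h0 : 0 ≤ h * ν.real univ := mul_nonneg H.step_nonneg measureReal_nonneg
        rw [← enorm_mul, Real.enorm_eq_ofReal_abs, Real.enorm_eq_ofReal_abs,
          Real.enorm_eq_ofReal_abs, ← H.abs_sub_eq (hM x) (hM' x),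
          ← ENNReal.ofReal_add (abs_nonneg _) (abs_nonneg _), abs_mul, abs_of_nonneg h0]

lemma eulerStep_zero : eulerStep ν g h (fun _ => 0) = fun _ => 0 := by
  ext x
  simp [eulerStep, jumpOp]

lemma eulerStep_translate (y : Euc N) :
    eulerStep ν g h (fun x => u (x + y)) = fun x => eulerStep ν g h u (x + y) := by
  ext x
  simp only [eulerStep, jumpOp]
  simp_rw [add_right_comm]

lemma IsStable.integral_eulerStep_sub_mul (H : IsStable ν g h M) (hu : Measurable u)
    (hM : ∀ x, |u x| ≤ M) {ψ : Euc N → ℝ} (hψ : Integrable ψ) :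
    ∫ x, (eulerStep ν g h u x - u x) * ψ x = h * ∫ x, g (u x) * jumpOp ν ψ x := by
  have := H.isFinite
  rw [← integral_jumpOp_mul H.symm (H.measurable_comp hu) (H.abs_comp_le hM) hψ,
    ← integral_const_mul]
  refine integral_congr_ae (ae_of_all _ fun x => ?_)
  simp only [eulerStep]
  ring

/-- The iterates of the Euler scheme. -/
noncomputable def eulerIter (ν : Measure (Euc N)) (g : ℝ → ℝ) (h : ℝ) (u : Euc N → ℝ)
    (k : ℕ) : Euc N → ℝ := (eulerStep ν g h)^[k] u

lemma eulerIter_succ (k : ℕ) :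
    eulerIter ν g h u (k + 1) = eulerStep ν g h (eulerIter ν g h u k) :=
  Function.iterate_succ_apply' _ _ _

lemma IsStable.measurable_eulerIter (H : IsStable ν g h M) (hu : Measurable u) (k : ℕ) :
    Measurable (eulerIter ν g h u k) := by
  induction k with
  | zero => exact hu
  | succ k ih =>
    rw [eulerIter_succ]
    exact H.measurable_eulerStep ih

lemma IsStable.abs_eulerIter_le (H : IsStable ν g h M) (hu : Measurable u)
    (hM : ∀ x, |u x| ≤ M) (k : ℕ) (x : Euc N) : |eulerIter ν g h u k x| ≤ M := by
  induction k generalizing x with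
  | zero => exact hM x
  | succ k ih =>
    rw [eulerIter_succ]
    exact H.abs_eulerStep_le (H.measurable_eulerIter hu k) ih x

lemma IsStable.lintegral_eulerIter_sub_le (H : IsStable ν g h M) (hu : Measurable u)
    (hM : ∀ x, |u x| ≤ M) (hv : Measurable v) (hM' : ∀ x, |v x| ≤ M) (k : ℕ) :
    ∫⁻ x, ‖eulerIter ν g h u k x - eulerIter ν g h v k x‖ₑ ≤ ∫⁻ x, ‖u x - v x‖ₑ := by
  induction k with
  | zero => exact le_rfl
  | succ k ih =>
    rw [eulerIter_succ, eulerIter_succ]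
    exact (H.lintegral_eulerStep_sub_le (H.measurable_eulerIter hu k) (H.abs_eulerIter_le hu hM k)
      (H.measurable_eulerIter hv k) (H.abs_eulerIter_le hv hM' k)).trans ih

lemma eulerIter_zero_fun (k : ℕ) : eulerIter ν g h (fun _ => 0) k = fun _ => 0 := by
  induction k with
  | zero => rfl
  | succ k ih => rw [eulerIter_succ, ih, eulerStep_zero]

lemma eulerIter_translate (y : Euc N) (k : ℕ) :
    eulerIter ν g h (fun x => u (x + y)) k = fun x => eulerIter ν g h u k (x + y) := by
  induction k with
  | zero => rfl
  | succ k ih => rw [eulerIter_succ, ih, eulerStep_translate, eulerIter_succ]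

lemma IsStable.lintegral_eulerIter_le (H : IsStable ν g h M) (hu : Measurable u)
    (hM : ∀ x, |u x| ≤ M) (k : ℕ) :
    ∫⁻ x, ‖eulerIter ν g h u k x‖ₑ ≤ ∫⁻ x, ‖u x‖ₑ := by
  have := H.lintegral_eulerIter_sub_le hu hM (measurable_const (a := (0 : ℝ)))
    (fun x => by simpa using H.bound_nonneg) k
  simpa [eulerIter_zero_fun] using this

lemma IsStable.lintegral_eulerIter_translate_le (H : IsStable ν g h M) (hu : Measurable u)
    (hM : ∀ x, |u x| ≤ M) (y : Euc N) (k : ℕ) :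
    ∫⁻ x, ‖eulerIter ν g h u k (x + y) - eulerIter ν g h u k x‖ₑ
      ≤ ∫⁻ x, ‖u (x + y) - u x‖ₑ := by
  have := H.lintegral_eulerIter_sub_le (hu.comp (measurable_add_const y)) (fun x => hM (x + y))
    hu hM k
  simpa only [Function.comp_def, eulerIter_translate] using this

lemma IsStable.abs_integral_eulerIter_sub_mul_le (H : IsStable ν g h M) (hu : Measurable u)
    (hM : ∀ x, |u x| ≤ M) {Φ : ℝ} (hΦ : ∀ r, |r| ≤ M → |g r| ≤ Φ) {ψ : Euc N → ℝ}
    (hψ : Integrable ψ) (j k : ℕ) (hjk : j ≤ k) :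
    |∫ x, (eulerIter ν g h u k x - eulerIter ν g h u j x) * ψ x|
      ≤ (k - j) * h * (Φ * ∫ x, |jumpOp ν ψ x|) := by
  have := H.isFinite
  have hb := H.abs_eulerIter_le hu hM
  have hm := H.measurable_eulerIter hu
  have hi : ∀ k, Integrable fun x => eulerIter ν g h u k x * ψ x := fun k =>
    hψ.bdd_mul (c := M) (hm k).aestronglyMeasurable (ae_of_all _ (hb k))
  induction k, hjk using Nat.le_induction with
  | base => simp
  | succ k hk ih =>
    have e : ∫ x, (eulerIter ν g h u (k + 1) x - eulerIter ν g h u j x) * ψ x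
        = (∫ x, (eulerIter ν g h u (k + 1) x - eulerIter ν g h u k x) * ψ x)
          + ∫ x, (eulerIter ν g h u k x - eulerIter ν g h u j x) * ψ x := by
      simp only [sub_mul]
      rw [integral_sub (hi _) (hi _), integral_sub (hi _) (hi _), integral_sub (hi _) (hi _)]
      ring
    have e2 : |∫ x, (eulerIter ν g h u (k + 1) x - eulerIter ν g h u k x) * ψ x|
        ≤ h * (Φ * ∫ x, |jumpOp ν ψ x|) := by
      rw [eulerIter_succ, H.integral_eulerStep_sub_mul (hm k) (hb k) hψ, abs_mul,
        abs_of_nonneg H.step_nonneg]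
      exact mul_le_mul_of_nonneg_left (abs_integral_mul_le (fun x => hΦ _ (hb k x))
        (integrable_jumpOp H.symm hψ)) H.step_nonneg
    rw [e]
    refine (abs_add_le _ _).trans ((add_le_add e2 ih).trans (le_of_eq ?_))
    push_cast
    ring

end Euler

section Interp
variable {N : ℕ} {ν : Measure (Euc N)} {g : ℝ → ℝ} {h M T Φ : ℝ} {u : Euc N → ℝ}
  {ψ : Euc N → ℝ → ℝ}

lemma IsSTTestFn.hasDerivAt (hψ : IsSTTestFn T ψ) (x : Euc N) (t : ℝ) :
    HasDerivAt (ψ x) (deriv (ψ x) t) t := by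
  have : Differentiable ℝ (ψ x) :=
    (hψ.1.differentiable (by simp)).comp ((differentiable_const x).prodMk differentiable_id)
  exact this.differentiableAt.hasDerivAt

lemma IsSTTestFn.hasDerivAt_integral_mul (hψ : IsSTTestFn T ψ) {a : Euc N → ℝ}
    (ha : Measurable a) {C : ℝ} (hC : ∀ x, |a x| ≤ C) (t : ℝ) :
    HasDerivAt (fun t => ∫ x, a x * ψ x t) (∫ x, a x * deriv (ψ x) t) t := by
  obtain ⟨A, R, B, hs⟩ := hψ.exists_isSlice
  obtain ⟨A', R', B', hs'⟩ := hψ.deriv_time.exists_isSlice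
  have hC0 : 0 ≤ C := (abs_nonneg _).trans (hC 0)
  refine (hasDerivAt_integral_of_dominated_loc_of_deriv_le (s := univ) univ_mem
    (bound := (Metric.closedBall (0 : Euc N) R').indicator fun _ => C * B')
    (F := fun t x => a x * ψ x t) (F' := fun t x => a x * deriv (ψ x) t)
    (Eventually.of_forall fun s => ?_) ?_ ?_ (ae_of_all _ fun x s _ => ?_) ?_
    (ae_of_all _ fun x s _ => (hψ.hasDerivAt x s).const_mul _)).2
  · exact ha.aestronglyMeasurable.mul (hs s).integrable.aestronglyMeasurable
  · exact (hs t).integrable.bdd_mul (c := C) ha.aestronglyMeasurable (ae_of_all _ hC)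
  · exact ha.aestronglyMeasurable.mul (hs' t).integrable.aestronglyMeasurable
  · by_cases hx : x ∈ Metric.closedBall (0 : Euc N) R'
    · rw [indicator_of_mem hx, Real.norm_eq_abs, abs_mul]
      exact mul_le_mul (hC x) ((hs' s).bdd x) (abs_nonneg _) hC0
    · rw [indicator_of_notMem hx, (hs' s).supp x (by simpa using hx)]
      simp
  · exact (integrable_indicator_iff measurableSet_closedBall).2
      (integrableOn_const (measure_closedBall_lt_top.ne))

lemma IsSTTestFn.continuous_integral_mul (hψ : IsSTTestFn T ψ) {a : Euc N → ℝ}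
    (ha : Measurable a) {C : ℝ} (hC : ∀ x, |a x| ≤ C) :
    Continuous (fun t => ∫ x, a x * ψ x t) :=
  continuous_iff_continuousAt.2 fun t => (hψ.hasDerivAt_integral_mul ha hC t).continuousAt

lemma IsSTTestFn.exists_integral_abs_sub_le (hψ : IsSTTestFn T ψ) :
    ∃ L, 0 ≤ L ∧ ∀ s t, ∫ x, |ψ x t - ψ x s| ≤ L * |t - s| := by
  obtain ⟨A, R, B, hs⟩ := hψ.exists_isSlice
  obtain ⟨A', R', B', hs'⟩ := hψ.deriv_time.exists_isSlice
  have hB' : 0 ≤ B' := (hs' 0).nonneg.2.2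
  refine ⟨B' * (volume : Measure (Euc N)).real (Metric.closedBall 0 R), by positivity,
    fun s t => ?_⟩
  rw [mul_right_comm, mul_comm, ← smul_eq_mul,
    ← integral_indicator_const (B' * |t - s|) measurableSet_closedBall]
  refine integral_mono_of_nonneg (ae_of_all _ fun x => abs_nonneg _)
    ((integrable_indicator_iff measurableSet_closedBall).2
      (integrableOn_const (measure_closedBall_lt_top.ne))) (ae_of_all _ fun x => ?_)
  by_cases hx : x ∈ Metric.closedBall (0 : Euc N) R
  · rw [indicator_of_mem hx]
    exact Convex.norm_image_sub_le_of_norm_hasDerivWithin_le (s := univ)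
      (fun r _ => (hψ.hasDerivAt x r).hasDerivWithinAt) (fun r _ => (hs' r).bdd x) convex_univ
      (mem_univ _) (mem_univ _)
  · have hx' : R < ‖x‖ := by simpa using hx
    simp only [indicator_of_notMem hx, (hs s).supp x hx', (hs t).supp x hx']
    simp

lemma IsSTTestFn.eq_zero_of_le (hψ : IsSTTestFn T ψ) (x : Euc N) {t : ℝ} (ht : T ≤ t) :
    ψ x t = 0 := by
  by_contra hne
  have := hψ.2.2 (subset_tsupport _ (show (x, t) ∈ Function.support (Function.uncurry ψ) from hne))
  exact absurd this (not_lt.2 ht)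

/-- The piecewise constant interpolation in time of the Euler scheme. -/
noncomputable def eulerInterp (ν : Measure (Euc N)) (g : ℝ → ℝ) (h : ℝ) (u : Euc N → ℝ)
    (x : Euc N) (t : ℝ) : ℝ := eulerIter ν g h u ⌊t / h⌋₊ x

lemma IsStable.measurable_eulerInterp (H : IsStable ν g h M) (hu : Measurable u) :
    Measurable (Function.uncurry (eulerInterp ν g h u)) := by
  have h1 : Measurable (fun p : Euc N × ℕ => eulerIter ν g h u p.2 p.1) :=
    measurable_from_prod_countable_left fun k => H.measurable_eulerIter hu k
  exact h1.comp (measurable_fst.prodMk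
    (Nat.measurable_floor.comp (measurable_snd.div_const h)))

lemma IsStable.abs_integral_eulerInterp_sub_mul_le (H : IsStable ν g h M) (hh : 0 < h)
    (hu : Measurable u) (hM : ∀ x, |u x| ≤ M) (hΦ : ∀ r, |r| ≤ M → |g r| ≤ Φ)
    {ρ : Euc N → ℝ} (hρ : Integrable ρ) {s t : ℝ} (hs : 0 ≤ s) (ht : 0 ≤ t) :
    |∫ x, (eulerInterp ν g h u x t - eulerInterp ν g h u x s) * ρ x|
      ≤ (|t - s| + h) * (Φ * ∫ x, |jumpOp ν ρ x|) := by
  wlog hst : s ≤ t generalizing s t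
  · rw [abs_sub_comm t s]
    refine le_trans (le_of_eq ?_) (this ht hs (le_of_not_ge hst))
    rw [← abs_neg, ← integral_neg]
    congr 2
    ext x
    ring
  have hΦ0 : 0 ≤ Φ := (abs_nonneg _).trans (hΦ 0 (by simpa using H.bound_nonneg))
  have hk : ⌊s / h⌋₊ ≤ ⌊t / h⌋₊ := Nat.floor_le_floor (by gcongr)
  refine (H.abs_integral_eulerIter_sub_mul_le hu hM hΦ hρ _ _ hk).trans ?_
  refine mul_le_mul_of_nonneg_right ?_ (by positivity)
  have h1 : (⌊t / h⌋₊ : ℝ) ≤ t / h := Nat.floor_le (by positivity)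
  have h2 : s / h < ⌊s / h⌋₊ + 1 := Nat.lt_floor_add_one _
  rw [le_div_iff₀ hh] at h1
  rw [div_lt_iff₀ hh] at h2
  rw [abs_of_nonneg (sub_nonneg.2 hst)]
  nlinarith

lemma IsStable.weak_eulerIter (H : IsStable ν g h M) (hu : Measurable u)
    (hM : ∀ x, |u x| ≤ M) (hΦ : ∀ r, |r| ≤ M → |g r| ≤ Φ) (hψ : IsSTTestFn T ψ) {L : ℝ}
    (hL : ∀ s t, ∫ x, |ψ x t - ψ x s| ≤ L * |t - s|) (k : ℕ) (s : ℝ) :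
    IntervalIntegrable (fun t => ∫ x, (eulerIter ν g h u k x * deriv (ψ x) t
      + g (eulerIter ν g h u k x) * jumpOp ν (fun y => ψ y t) x)) volume s (s + h) ∧
    |(∫ t in s..(s + h), ∫ x, (eulerIter ν g h u k x * deriv (ψ x) t
      + g (eulerIter ν g h u k x) * jumpOp ν (fun y => ψ y t) x))
      - ((∫ x, eulerIter ν g h u (k + 1) x * ψ x (s + h))
        - ∫ x, eulerIter ν g h u k x * ψ x s)| ≤ 2 * Φ * ν.real univ * (L * h) * h := by
  have := H.isFinite
  have hh := H.step_nonneg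
  have hΦ0 : 0 ≤ Φ := (abs_nonneg _).trans (hΦ 0 (by simpa using H.bound_nonneg))
  obtain ⟨A, R, C, hsl⟩ := hψ.exists_isSlice
  set a := eulerIter ν g h u k with ha
  have ham : Measurable a := H.measurable_eulerIter hu k
  have hab : ∀ x, |a x| ≤ M := H.abs_eulerIter_le hu hM k
  have hgb : ∀ x, |g (a x)| ≤ Φ := fun x => hΦ _ (hab x)
  set b := jumpOp ν (fun y => g (a y)) with hb
  have hbm : Measurable b := measurable_jumpOp (H.measurable_comp ham)
  have hbb : ∀ x, |b x| ≤ 2 * Φ * ν.real univ := abs_jumpOp_le hgb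
  have hi : ∀ t, Integrable fun x => b x * ψ x t := fun t =>
    (hsl t).integrable.bdd_mul (c := 2 * Φ * ν.real univ) hbm.aestronglyMeasurable
      (ae_of_all _ hbb)
  have hia : ∀ t, Integrable fun x => a x * ψ x t := fun t =>
    (hsl t).integrable.bdd_mul (c := M) ham.aestronglyMeasurable (ae_of_all _ hab)
  have hc1 : Continuous fun t => ∫ x, a x * deriv (ψ x) t :=
    hψ.deriv_time.continuous_integral_mul ham hab
  have hc2 : Continuous fun t => ∫ x, b x * ψ x t := hψ.continuous_integral_mul hbm hbb
  have hF : (fun t => ∫ x, (a x * deriv (ψ x) t + g (a x) * jumpOp ν (fun y => ψ y t) x))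
      = fun t => (∫ x, a x * deriv (ψ x) t) + ∫ x, b x * ψ x t := by
    ext t
    rw [integral_add, integral_jumpOp_mul H.symm (H.measurable_comp ham) hgb (hsl t).integrable]
    · obtain ⟨A', R', C', hsl'⟩ := hψ.deriv_time.exists_isSlice
      exact (hsl' t).integrable.bdd_mul (c := M) ham.aestronglyMeasurable (ae_of_all _ hab)
    · exact (integrable_jumpOp H.symm (hsl t).integrable).bdd_mul (c := Φ)
        (H.measurable_comp ham).aestronglyMeasurable (ae_of_all _ hgb)
  rw [hF]
  refine ⟨(hc1.add hc2).intervalIntegrable _ _, ?_⟩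
  rw [intervalIntegral.integral_add (hc1.intervalIntegrable _ _) (hc2.intervalIntegrable _ _),
    intervalIntegral.integral_eq_sub_of_hasDerivAt
      (fun t _ => hψ.hasDerivAt_integral_mul ham hab t) (hc1.intervalIntegrable _ _)]
  have e1 : ∫ x, eulerIter ν g h u (k + 1) x * ψ x (s + h)
      = (∫ x, a x * ψ x (s + h)) + h * ∫ x, b x * ψ x (s + h) := by
    rw [← integral_const_mul, ← integral_add (hia _) ((hi _).const_mul _), eulerIter_succ]
    refine integral_congr_ae (ae_of_all _ fun x => ?_)
    simp only [eulerStep, ← ha, ← hb]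
    ring
  have e2 : h * ∫ x, b x * ψ x (s + h) = ∫ _t in s..(s + h), ∫ x, b x * ψ x (s + h) := by
    rw [intervalIntegral.integral_const, add_sub_cancel_left, smul_eq_mul]
  rw [e1, e2]
  have e3 : ∀ p q r l : ℝ, p - q + r - (p + l - q) = r - l := fun p q r l => by ring
  rw [e3, ← intervalIntegral.integral_sub (hc2.intervalIntegrable _ _)
    intervalIntegrable_const, ← Real.norm_eq_abs]
  refine (intervalIntegral.norm_integral_le_of_norm_le_const
    (C := 2 * Φ * ν.real univ * (L * h)) fun t ht => ?_).trans ?_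
  · rw [← integral_sub (hi _) (hi _), Real.norm_eq_abs]
    simp only [← mul_sub]
    refine (abs_integral_mul_le hbb ((hsl _).integrable.sub (hsl _).integrable)).trans ?_
    refine mul_le_mul_of_nonneg_left ((hL _ _).trans ?_) (by positivity)
    have hL0 : 0 ≤ L := by
      have := (integral_nonneg fun x => abs_nonneg (ψ x 1 - ψ x 0)).trans (hL 0 1)
      simpa using this
    refine mul_le_mul_of_nonneg_left ?_ hL0
    rw [uIoc_of_le (by linarith)] at ht
    rw [abs_le]
    constructor <;> linarith [ht.1, ht.2]
  · rw [add_sub_cancel_left, abs_of_nonneg hh]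

lemma eulerInterp_of_mem (hh : 0 < h) (k : ℕ) {t : ℝ} (ht : t ∈ Ioo ((k : ℝ) * h) (k * h + h))
    (x : Euc N) : eulerInterp ν g h u x t = eulerIter ν g h u k x := by
  have : ⌊t / h⌋₊ = k := by
    rw [Nat.floor_eq_iff (div_nonneg ((by positivity : 0 ≤ (k : ℝ) * h).trans ht.1.le) hh.le),
      le_div_iff₀ hh, div_lt_iff₀ hh]
    exact ⟨ht.1.le, by linarith [ht.2]⟩
  rw [eulerInterp, this]

lemma IsStable.weak_eulerInterp (H : IsStable ν g h M) (hh : 0 < h) (hu : Measurable u)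
    (hM : ∀ x, |u x| ≤ M) (hΦ : ∀ r, |r| ≤ M → |g r| ≤ Φ) (hψ : IsSTTestFn T ψ) {L : ℝ}
    (hL : ∀ s t, ∫ x, |ψ x t - ψ x s| ≤ L * |t - s|) {m : ℕ} (hm : (m : ℝ) * h = T) :
    |(∫ t in Ioo 0 T, ∫ x, (eulerInterp ν g h u x t * deriv (ψ x) t
      + g (eulerInterp ν g h u x t) * jumpOp ν (fun y => ψ y t) x))
      + ∫ x, u x * ψ x 0| ≤ T * (2 * Φ * L * (h * ν.real univ)) := by
  set F : ℝ → ℝ := fun t => ∫ x, (eulerInterp ν g h u x t * deriv (ψ x) t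
      + g (eulerInterp ν g h u x t) * jumpOp ν (fun y => ψ y t) x) with hF
  have hT : 0 ≤ T := by rw [← hm]; positivity
  have hcast : ∀ k : ℕ, ((k + 1 : ℕ) : ℝ) * h = k * h + h := fun k => by push_cast; ring
  have hkey := H.weak_eulerIter hu hM hΦ hψ hL
  have heq : ∀ k : ℕ, EqOn (fun t => ∫ x, (eulerIter ν g h u k x * deriv (ψ x) t
      + g (eulerIter ν g h u k x) * jumpOp ν (fun y => ψ y t) x)) F
      (Ioo ((k : ℝ) * h) (k * h + h)) := by
    intro k t ht
    simp only [hF, eulerInterp_of_mem hh k ht]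
  have hInt : ∀ k < m, IntervalIntegrable F volume (((k : ℕ) : ℝ) * h) (((k + 1 : ℕ) : ℝ) * h) := by
    intro k _
    rw [hcast]
    refine (hkey k (k * h)).1.congr_uIoo ?_
    rw [uIoo_of_le (by linarith)]
    exact heq k
  have hsum := intervalIntegral.sum_integral_adjacent_intervals hInt
  have e0 : ∫ t in Ioo 0 T, F t = ∫ t in (((0 : ℕ) : ℝ) * h)..((m : ℝ) * h), F t := by
    rw [hm, Nat.cast_zero, zero_mul, intervalIntegral.integral_of_le hT,
      integral_Ioc_eq_integral_Ioo]
  rw [e0, ← hsum]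
  have htel := Finset.sum_range_sub (fun k : ℕ => ∫ x, eulerIter ν g h u k x * ψ x (k * h)) m
  have hend : ∫ x, eulerIter ν g h u m x * ψ x (m * h) = 0 := by
    simp [hψ.eq_zero_of_le _ hm.ge]
  have hstart : ∫ x, eulerIter ν g h u 0 x * ψ x (((0 : ℕ) : ℝ) * h) = ∫ x, u x * ψ x 0 := by
    simp [eulerIter]
  rw [hend, hstart, zero_sub] at htel
  rw [← neg_neg (∫ x, u x * ψ x 0), ← htel, ← sub_eq_add_neg, ← Finset.sum_sub_distrib]
  refine (Finset.abs_sum_le_sum_abs _ _).trans ?_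
  refine (Finset.sum_le_card_nsmul _ _ (2 * Φ * ν.real univ * (L * h) * h) fun k _ => ?_).trans
    (le_of_eq ?_)
  · rw [hcast, ← intervalIntegral.integral_congr_Ioo_of_le (by linarith) (heq k)]
    exact (hkey k (k * h)).2
  · rw [Finset.card_range, nsmul_eq_mul, ← hm]
    ring

end Interp

section Approx
variable {N : ℕ}

/-- Forward average of `φ` over an interval of length `δ`. -/
noncomputable def forwardAverage (φ : ℝ → ℝ) (δ r : ℝ) : ℝ := δ⁻¹ * ∫ s in (0 : ℝ)..δ, φ (r + s)

lemma forwardAverage_const {δ : ℝ} (hδ : 0 < δ) (c : ℝ) :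
    δ⁻¹ * ∫ _s in (0 : ℝ)..δ, c = c := by
  rw [intervalIntegral.integral_const, sub_zero, smul_eq_mul, inv_mul_cancel_left₀ hδ.ne']

lemma intervalIntegrable_add {φ : ℝ → ℝ} (hφc : Continuous φ) (r a b : ℝ) :
    IntervalIntegrable (fun s => φ (r + s)) volume a b :=
  (hφc.comp (continuous_const.add continuous_id)).intervalIntegrable _ _

lemma monotone_forwardAverage {φ : ℝ → ℝ} (hφc : Continuous φ) (hφ : Monotone φ) {δ : ℝ}
    (hδ : 0 < δ) : Monotone (forwardAverage φ δ) := fun a b hab =>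
  mul_le_mul_of_nonneg_left (intervalIntegral.integral_mono_on hδ.le
    (intervalIntegrable_add hφc _ _ _) (intervalIntegrable_add hφc _ _ _)
    fun s _ => hφ (by linarith)) (inv_nonneg.2 hδ.le)

lemma le_forwardAverage {φ : ℝ → ℝ} (hφc : Continuous φ) (hφ : Monotone φ) {δ : ℝ}
    (hδ : 0 < δ) (r : ℝ) : φ r ≤ forwardAverage φ δ r := by
  rw [← forwardAverage_const hδ (φ r)]
  exact mul_le_mul_of_nonneg_left (intervalIntegral.integral_mono_on hδ.le
    intervalIntegrable_const (intervalIntegrable_add hφc _ _ _)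
    fun s hs => hφ (by linarith [hs.1])) (inv_nonneg.2 hδ.le)

lemma forwardAverage_le {φ : ℝ → ℝ} (hφc : Continuous φ) (hφ : Monotone φ) {δ : ℝ}
    (hδ : 0 < δ) (r : ℝ) : forwardAverage φ δ r ≤ φ (r + δ) := by
  rw [← forwardAverage_const hδ (φ (r + δ))]
  exact mul_le_mul_of_nonneg_left (intervalIntegral.integral_mono_on hδ.le
    (intervalIntegrable_add hφc _ _ _) intervalIntegrable_const
    fun s hs => hφ (by linarith [hs.2])) (inv_nonneg.2 hδ.le)

lemma abs_forwardAverage_sub_le {φ : ℝ → ℝ} (hφc : Continuous φ) {δ M Φ : ℝ}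
    (hδ : 0 < δ) (hΦ : ∀ r, |r| ≤ M + δ → |φ r| ≤ Φ) {a b : ℝ} (ha : |a| ≤ M) (hb : |b| ≤ M) :
    |forwardAverage φ δ a - forwardAverage φ δ b| ≤ δ⁻¹ * (2 * Φ) * |a - b| := by
  have hi : ∀ p q : ℝ, IntervalIntegrable φ volume p q := fun p q => hφc.intervalIntegrable _ _
  have e : ∀ r, forwardAverage φ δ r = δ⁻¹ * ∫ s in r..(r + δ), φ s := fun r => by
    rw [forwardAverage, intervalIntegral.integral_comp_add_left, add_zero]
  have e2 : (∫ s in a..(a + δ), φ s) - ∫ s in b..(b + δ), φ s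
      = (∫ s in (b + δ)..(a + δ), φ s) - ∫ s in b..a, φ s := by
    rw [intervalIntegral.integral_interval_sub_interval_comm (hi _ _) (hi _ _) (hi _ _),
      intervalIntegral.integral_symm a b, intervalIntegral.integral_symm (a + δ) (b + δ)]
    ring
  rw [abs_le] at ha hb
  have b1 : |∫ s in (b + δ)..(a + δ), φ s| ≤ Φ * |a - b| := by
    refine (intervalIntegral.norm_integral_le_of_norm_le_const (f := φ) (C := Φ)
      fun s hs => hΦ s ?_).trans (le_of_eq ?_)
    · have := uIoc_subset_uIcc hs
      rw [mem_uIcc] at this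
      rw [abs_le]
      constructor <;> rcases this with h | h <;> linarith [h.1, h.2]
    · congr 2
      ring
  have b2 : |∫ s in b..a, φ s| ≤ Φ * |a - b| := by
    refine intervalIntegral.norm_integral_le_of_norm_le_const (f := φ) (C := Φ)
      fun s hs => hΦ s ?_
    have := uIoc_subset_uIcc hs
    rw [mem_uIcc] at this
    rw [abs_le]
    constructor <;> rcases this with h | h <;> linarith [h.1, h.2]
  rw [e, e, ← mul_sub, e2, abs_mul, abs_of_pos (inv_pos.2 hδ), mul_assoc]
  refine mul_le_mul_of_nonneg_left ?_ (inv_pos.2 hδ).le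
  linarith [abs_sub (∫ s in (b + δ)..(a + δ), φ s) (∫ s in b..a, φ s)]

/-- A sequence of approximate solutions of `∂_t u = L^μ[φ(u)]`, `u(0) = u0`. -/
structure IsApprox (μ : Measure (Euc N)) (T M Φ : ℝ) (φ : ℝ → ℝ) (u0 : Euc N → ℝ)
    (w : ℕ → Euc N → ℝ → ℝ) (g : ℕ → ℝ → ℝ) : Prop where
  measurable : ∀ n, Measurable (Function.uncurry (w n))
  bound : ∀ n x t, |w n x t| ≤ M
  lintegral_le : ∀ n t, ∫⁻ x, ‖w n x t‖ₑ ≤ ∫⁻ x, ‖u0 x‖ₑ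
  lintegral_translate_le : ∀ n t y,
    ∫⁻ x, ‖w n (x + y) t - w n x t‖ₑ ≤ ∫⁻ x, ‖u0 (x + y) - u0 x‖ₑ
  mono : ∀ n, Monotone (g n)
  le : ∀ n r, φ r ≤ g n r
  ge : ∀ n r, g n r ≤ φ (r + 1 / ((n : ℝ) + 1))
  bound_right : ∀ n r, |r| ≤ M → |g n r| ≤ Φ
  time : ∀ n {A R C : ℝ} {ρ : Euc N → ℝ}, IsSlice A R C ρ → ∀ s t, 0 ≤ s → 0 ≤ t →
    |∫ x, (w n x t - w n x s) * ρ x|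
      ≤ (|t - s| + 1 / ((n : ℝ) + 1)) * (Φ * sliceConst μ A R C)
  weak : ∀ ψ, IsSTTestFn T ψ → Tendsto (fun n : ℕ => (∫ t in Ioo 0 T, ∫ x,
    (w n x t * deriv (ψ x) t
      + g n (w n x t) * jumpOp (truncMeasure μ (1 / ((n : ℝ) + 1))) (fun y => ψ y t) x))
      + ∫ x, u0 x * ψ x 0) atTop (𝓝 0)

lemma exists_isApprox {μ : Measure (Euc N)} (hμ : IsLevyMeasure μ) {T : ℝ} (hT : 0 < T)
    {φ : ℝ → ℝ} (hφc : Continuous φ) (hφ : Monotone φ) {u0 : Euc N → ℝ} (hu : Measurable u0)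
    {M : ℝ} (hM : ∀ x, |u0 x| ≤ M) :
    ∃ Φ w g, IsApprox μ T M Φ φ u0 w g := by
  have hM0 : 0 ≤ M := (abs_nonneg _).trans (hM 0)
  set Φ := |φ (M + 1)| + |φ (-(M + 1))| with hΦdef
  have hΦ0 : 0 ≤ Φ := by positivity
  have hpos : ∀ n : ℕ, (0 : ℝ) < 1 / ((n : ℝ) + 1) := fun n => by positivity
  have hle1 : ∀ n : ℕ, 1 / ((n : ℝ) + 1) ≤ 1 := fun n => by
    rw [div_le_one (by positivity)]; linarith [(Nat.cast_nonneg n : (0 : ℝ) ≤ n)]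
  have hφΦ : ∀ r, |r| ≤ M + 1 → |φ r| ≤ Φ := fun r hr => hφ.abs_le_of_abs_le hr
  set g : ℕ → ℝ → ℝ := fun n => forwardAverage φ (1 / ((n : ℝ) + 1)) with hg
  set ν : ℕ → Measure (Euc N) := fun n => truncMeasure μ (1 / ((n : ℝ) + 1)) with hν
  have hfin : ∀ n, IsFiniteMeasure (ν n) := fun n => hμ.isFiniteMeasure_trunc (hpos n)
  have hgb : ∀ n r, |r| ≤ M → |g n r| ≤ Φ := by
    intro n r hr
    have h1 := le_forwardAverage hφc hφ (hpos n) r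
    have h2 := forwardAverage_le hφc hφ (hpos n) r
    have h3 := abs_le.1 (hφΦ r (by linarith))
    have h4 := abs_le.1 (hφΦ (r + 1 / ((n : ℝ) + 1)) (by
      have := hle1 n
      have := hpos n
      rw [abs_le] at hr ⊢
      constructor <;> linarith [hr.1, hr.2]))
    rw [abs_le]
    exact ⟨h3.1.trans h1, h2.trans h4.2⟩
  have hstep : ∀ n : ℕ, ∃ m : ℕ, 0 < m ∧ T / m ≤ 1 / ((n : ℝ) + 1) ∧
      T / m * (ν n).real univ ≤ 1 / ((n : ℝ) + 1) ∧
      T / m * (ν n).real univ * ((1 / ((n : ℝ) + 1))⁻¹ * (2 * Φ)) ≤ 1 := by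
    intro n
    have hlim : ∀ c d : ℝ, 0 < d → ∀ᶠ m : ℕ in atTop, T / m * c ≤ d := by
      intro c d hd
      have : Tendsto (fun m : ℕ => T / m * c) atTop (𝓝 (0 * c)) :=
        (tendsto_const_div_atTop_nhds_zero_nat T).mul_const c
      rw [zero_mul] at this
      exact (this.eventually (gt_mem_nhds hd)).mono fun m hm => le_of_lt hm
    obtain ⟨m, h1, h2, h3, h4⟩ := ((eventually_gt_atTop 0).and ((hlim 1 _ (hpos n)).and
      ((hlim ((ν n).real univ) _ (hpos n)).and
      (hlim ((ν n).real univ * ((1 / ((n : ℝ) + 1))⁻¹ * (2 * Φ))) 1 one_pos)))).exists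
    exact ⟨m, h1, by simpa using h2, h3, by rwa [mul_assoc]⟩
  choose m hm0 hm1 hm2 hm3 using hstep
  have hm0' : ∀ n, (0 : ℝ) < m n := fun n => by exact_mod_cast hm0 n
  have hh : ∀ n, 0 < T / m n := fun n => div_pos hT (hm0' n)
  have H : ∀ n, IsStable (ν n) (g n) (T / m n) M := by
    intro n
    refine ⟨hfin n, hμ.map_neg_trunc _, monotone_forwardAverage hφc hφ (hpos n), (hh n).le, hM0,
      fun a b ha hb => ?_⟩
    have h1 := abs_forwardAverage_sub_le hφc (hpos n)
      (fun r hr => hφΦ r (hr.trans (by linarith [hle1 n]))) ha hb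
    have h0 : 0 ≤ T / m n * (ν n).real univ := mul_nonneg (hh n).le measureReal_nonneg
    have h2 := mul_le_mul_of_nonneg_left h1 h0
    have h3 := mul_le_mul_of_nonneg_right (hm3 n) (abs_nonneg (a - b))
    rw [one_mul, mul_assoc] at h3
    exact h2.trans h3
  refine ⟨Φ, fun n => eulerInterp (ν n) (g n) (T / m n) u0, g, ⟨fun n =>
    (H n).measurable_eulerInterp hu, fun n x t => (H n).abs_eulerIter_le hu hM _ x, fun n t =>
    (H n).lintegral_eulerIter_le hu hM _, fun n t y =>
    (H n).lintegral_eulerIter_translate_le hu hM y _, fun n => (H n).mono,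
    fun n => le_forwardAverage hφc hφ (hpos n), fun n => forwardAverage_le hφc hφ (hpos n), hgb,
    ?_, ?_⟩⟩
  · intro n A R C ρ hρ s t hs ht
    refine ((H n).abs_integral_eulerInterp_sub_mul_le (hh n) hu hM (hgb n) hρ.integrable
      hs ht).trans ?_
    refine mul_le_mul (by linarith [hm1 n]) (mul_le_mul_of_nonneg_left
      (hρ.integral_abs_jumpOp_le hμ (hpos n) (hle1 n)) hΦ0) ?_ (by positivity)
    exact mul_nonneg hΦ0 (integral_nonneg fun x => abs_nonneg _)
  · intro ψ hψ
    obtain ⟨L, hL0, hL⟩ := hψ.exists_integral_abs_sub_le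
    have hlim : Tendsto (fun n : ℕ => T * (2 * Φ * L * (1 / ((n : ℝ) + 1)))) atTop (𝓝 0) := by
      have := ((tendsto_one_div_add_atTop_nhds_zero_nat (𝕜 := ℝ)).const_mul
        (2 * Φ * L)).const_mul T
      simpa using this
    refine squeeze_zero_norm (fun n => ?_) hlim
    refine ((H n).weak_eulerInterp (hh n) hu hM (hgb n) hψ hL (m := m n)
      (mul_div_cancel₀ T (hm0' n).ne')).trans ?_
    exact mul_le_mul_of_nonneg_left (mul_le_mul_of_nonneg_left (hm2 n) (by positivity)) hT.le

end Approx

section Compactness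
variable {N : ℕ} {μ : Measure (Euc N)} {T M Φ : ℝ} {φ : ℝ → ℝ} {u0 : Euc N → ℝ}
  {w : ℕ → Euc N → ℝ → ℝ} {g : ℕ → ℝ → ℝ} {ρ : Euc N → ℝ} {δ : ℝ}

lemma exists_subseq_tendsto_of_countable {ι : Type*} [Countable ι] {a : ℕ → ι → ℝ} {M : ℝ}
    (ha : ∀ n i, |a n i| ≤ M) :
    ∃ σ : ℕ → ℕ, StrictMono σ ∧ ∀ i, ∃ l, Tendsto (fun n => a (σ n) i) atTop (𝓝 l) := by
  have hc : IsCompact (Set.pi univ fun _ : ι => Icc (-M) M) :=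
    isCompact_univ_pi fun _ => isCompact_Icc
  obtain ⟨l, -, σ, hσ, hl⟩ := hc.tendsto_subseq (x := a) fun n i _ => abs_le.1 (ha n i)
  exact ⟨σ, hσ, fun i => ⟨l i, (tendsto_pi_nhds.1 hl) i⟩⟩

lemma cauchySeq_of_forall_exists_abs_sub_le {a : ℕ → ℝ}
    (h : ∀ ε > 0, ∃ b : ℕ → ℝ, CauchySeq b ∧ ∀ᶠ n in atTop, |a n - b n| ≤ ε) : CauchySeq a := by
  rw [Metric.cauchySeq_iff]
  intro ε hε
  obtain ⟨b, hb, hab⟩ := h (ε / 4) (by positivity)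
  obtain ⟨n₁, h₁⟩ := eventually_atTop.1 hab
  obtain ⟨n₂, h₂⟩ := Metric.cauchySeq_iff.1 hb (ε / 4) (by positivity)
  refine ⟨max n₁ n₂, fun m hm n hn => ?_⟩
  have e1 := abs_le.1 (h₁ m (le_of_max_le_left hm))
  have e2 := abs_le.1 (h₁ n (le_of_max_le_left hn))
  have e3 := h₂ m (le_of_max_le_right hm) n (le_of_max_le_right hn)
  rw [Real.dist_eq] at e3 ⊢
  have e4 := abs_lt.1 e3
  exact abs_lt.2 ⟨by linarith [e1.1, e2.2, e4.1], by linarith [e1.2, e2.1, e4.2]⟩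

lemma IsApprox.integrable (ha : IsApprox μ T M Φ φ u0 w g) (hu : Integrable u0) (n : ℕ) (t : ℝ) :
    Integrable (fun x => w n x t) :=
  ⟨((ha.measurable n).slice t).aestronglyMeasurable,
    (ha.lintegral_le n t).trans_lt hu.hasFiniteIntegral⟩

lemma integral_abs_le_of_lintegral_enorm_le {α : Type*} [MeasurableSpace α] {m : Measure α}
    {f k : α → ℝ} (hf : Integrable f m) (hk : Integrable k m)
    (h : ∫⁻ x, ‖f x‖ₑ ∂m ≤ ∫⁻ x, ‖k x‖ₑ ∂m) : ∫ x, |f x| ∂m ≤ ∫ x, |k x| ∂m := by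
  have e : ∀ {f : α → ℝ}, Integrable f m → ENNReal.ofReal (∫ x, |f x| ∂m) = ∫⁻ x, ‖f x‖ₑ ∂m :=
    fun hf => ofReal_integral_norm_eq_lintegral_enorm hf
  rw [← e hf, ← e hk] at h
  exact (ENNReal.ofReal_le_ofReal_iff (integral_nonneg fun _ => abs_nonneg _)).1 h

lemma IsApprox.integral_abs_translate_le (ha : IsApprox μ T M Φ φ u0 w g) (hu : Integrable u0)
    (n : ℕ) (t : ℝ) (y : Euc N) :
    ∫ x, |w n (x + y) t - w n x t| ≤ ∫ x, |u0 (x + y) - u0 x| :=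
  integral_abs_le_of_lintegral_enorm_le
    (((ha.integrable hu n t).comp_add_right y).sub (ha.integrable hu n t))
    ((hu.comp_add_right y).sub hu) (ha.lintegral_translate_le n t y)

lemma IsApprox.nonneg (ha : IsApprox μ T M Φ φ u0 w g) : 0 ≤ M :=
  (abs_nonneg _).trans (ha.bound 0 0 0)

lemma IsApprox.abs_mollify_sub_le_space (ha : IsApprox μ T M Φ φ u0 w g) (hu : Integrable u0)
    (hρ : Integrable ρ) {B : ℝ} (hB : ∀ y, |ρ y| ≤ B) (n : ℕ) (t : ℝ) (x x' : Euc N) :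
    |mollify ρ (fun x => w n x t) x - mollify ρ (fun x => w n x t) x'|
      ≤ B * ∫ y, |u0 (y + (x - x')) - u0 y| := by
  have hm := (ha.measurable n).slice t
  have hi := ha.integrable hu n t
  have ht : Integrable (fun y => w n (x + y) t - w n (x' + y) t) :=
    (hi.comp_add_left x).sub (hi.comp_add_left x')
  have e : mollify ρ (fun x => w n x t) x - mollify ρ (fun x => w n x t) x'
      = ∫ y, ρ y * (w n (x + y) t - w n (x' + y) t) := by
    rw [mollify, mollify, ← integral_sub
      (integrable_mollify_integrand hm hρ (fun x => ha.bound n x t) x)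
      (integrable_mollify_integrand hm hρ (fun x => ha.bound n x t) x')]
    exact integral_congr_ae (ae_of_all _ fun y => by ring)
  rw [e]
  refine (abs_integral_mul_le hB ht).trans
    (mul_le_mul_of_nonneg_left ?_ ((abs_nonneg _).trans (hB 0)))
  refine le_trans (le_of_eq ?_) (ha.integral_abs_translate_le hu n t (x - x'))
  rw [← integral_add_left_eq_self (fun y => |w n (y + (x - x')) t - w n y t|) x']
  refine integral_congr_ae (ae_of_all _ fun y => ?_)
  have : x' + y + (x - x') = x + y := by abel
  simp only [this]

lemma IsApprox.exists_abs_mollify_sub_le_time (ha : IsApprox μ T M Φ φ u0 w g)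
    (hρ : IsTestFn ρ) (x : Euc N) :
    ∃ D, 0 ≤ D ∧ ∀ n s t, 0 ≤ s → 0 ≤ t →
      |mollify ρ (fun x => w n x t) x - mollify ρ (fun x => w n x s) x|
        ≤ (|t - s| + 1 / ((n : ℝ) + 1)) * D := by
  have hτ : IsTestFn (fun y => ρ (y - x)) :=
    ⟨hρ.1.comp (contDiff_id.sub contDiff_const), hρ.2.comp_homeomorph (Homeomorph.subRight x)⟩
  obtain ⟨A, R, C, hs⟩ := hτ.exists_isSlice
  refine ⟨|Φ * sliceConst μ A R C|, abs_nonneg _, fun n s t h0 h1 => ?_⟩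
  refine le_trans (le_of_eq ?_) ((ha.time n hs s t h0 h1).trans
    (mul_le_mul_of_nonneg_left (le_abs_self _) (by positivity)))
  have hi := fun t => integrable_mollify_integrand ((ha.measurable n).slice t) hρ.integrable
    (fun x => ha.bound n x t) x
  rw [← integral_add_left_eq_self _ x, mollify, mollify, ← integral_sub (hi t) (hi s)]
  congr 1
  refine integral_congr_ae (ae_of_all _ fun y => ?_)
  simp only [add_sub_cancel_left]
  ring

lemma tendsto_comp_strictMono_one_div {σ : ℕ → ℕ} (hσ : StrictMono σ) :
    Tendsto (fun n => 1 / ((σ n : ℝ) + 1)) atTop (𝓝 0) :=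
  tendsto_one_div_add_atTop_nhds_zero_nat.comp hσ.tendsto_atTop

lemma IsApprox.exists_subseq_tendsto_mollify (ha : IsApprox μ T M Φ φ u0 w g)
    (hu : Integrable u0) {δ : ℕ → ℝ} {ρ : ℕ → Euc N → ℝ} (hρ : ∀ i, IsMollifier (δ i) (ρ i)) :
    ∃ σ : ℕ → ℕ, StrictMono σ ∧ ∀ i x t, 0 ≤ t →
      ∃ l, Tendsto (fun n => mollify (ρ i) (fun x => w (σ n) x t) x) atTop (𝓝 l) := by
  obtain ⟨σ, hσ, hl⟩ := exists_subseq_tendsto_of_countable (M := M)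
    (a := fun n (k : ℕ × ℕ × ℚ) => mollify (ρ k.1) (fun x => w n x |(k.2.2 : ℝ)|)
      (TopologicalSpace.denseSeq (Euc N) k.2.1))
    fun n k => (hρ k.1).abs_mollify_le (fun x => ha.bound n x _) _
  refine ⟨σ, hσ, fun i x t ht => cauchySeq_tendsto_of_complete ?_⟩
  refine cauchySeq_of_forall_exists_abs_sub_le fun ε hε => ?_
  obtain ⟨A, R, B, hs⟩ := (hρ i).isTestFn.exists_isSlice
  have hB := hs.nonneg.2.2
  obtain ⟨η, hη, hη'⟩ := Metric.eventually_nhds_iff.1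
    ((tendsto_integral_translate_sub hu).eventually_lt_const
      (show 0 < ε / (2 * (B + 1)) by positivity))
  obtain ⟨_, hz, ⟨j, rfl⟩⟩ := Metric.dense_iff.1
    (TopologicalSpace.denseRange_denseSeq (Euc N)) x η hη
  set z := TopologicalSpace.denseSeq (Euc N) j
  obtain ⟨D, hD, hDle⟩ := ha.exists_abs_mollify_sub_le_time (hρ i).isTestFn z
  obtain ⟨q, hq, hq'⟩ := exists_rat_btwn
    (show t < t + ε / (4 * (D + 1)) by linarith [show 0 < ε / (4 * (D + 1)) by positivity])
  refine ⟨fun n => mollify (ρ i) (fun x => w (σ n) x |(q : ℝ)|) z, ?_, ?_⟩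
  · obtain ⟨l, h⟩ := hl (i, j, q)
    exact h.cauchySeq
  have hsmall := (tendsto_comp_strictMono_one_div hσ).eventually_lt_const
    (show 0 < ε / (4 * (D + 1)) by positivity)
  filter_upwards [hsmall] with n hn
  have hq0 : |(q : ℝ)| = q := abs_of_nonneg (ht.trans hq.le)
  have e1 := ha.abs_mollify_sub_le_space hu (hρ i).isTestFn.integrable hs.bdd (σ n) t x z
  have e2 := hDle (σ n) |(q : ℝ)| t (abs_nonneg _) ht
  simp only [hq0] at e2 ⊢
  have e3 := (hη' (y := x - z) (by
    rw [dist_zero_right, ← dist_eq_norm, dist_comm]; exact hz)).le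
  have f1 : B * ∫ y, |u0 (y + (x - z)) - u0 y| ≤ ε / 2 := by
    refine (mul_le_mul_of_nonneg_left e3 hB).trans ?_
    rw [mul_div_assoc', div_le_div_iff₀ (by positivity) (by positivity)]
    nlinarith
  have f2 : (|t - q| + 1 / ((σ n : ℝ) + 1)) * D ≤ ε / 2 := by
    have : |t - q| ≤ ε / (4 * (D + 1)) := by
      rw [abs_le]; constructor <;> linarith
    refine (mul_le_mul_of_nonneg_right (add_le_add this hn.le) hD).trans ?_
    rw [← add_div, div_mul_eq_mul_div, div_le_div_iff₀ (by positivity) (by positivity)]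
    nlinarith
  refine (abs_sub_le _ (mollify (ρ i) (fun x => w (σ n) x t) z) _).trans ?_
  linarith

end Compactness

section Limit
variable {N : ℕ} {μ : Measure (Euc N)} {T M Φ : ℝ} {φ : ℝ → ℝ} {u0 : Euc N → ℝ}
  {w : ℕ → Euc N → ℝ → ℝ} {g : ℕ → ℝ → ℝ}

lemma enorm_sub_le_three (a b c d : ℝ) : ‖a - d‖ₑ ≤ ‖b - a‖ₑ + ‖b - c‖ₑ + ‖c - d‖ₑ := by
  have e : a - d = -(b - a) + (b - c) + (c - d) := by ring
  rw [e]
  refine (enorm_add_le _ _).trans (add_le_add_left ((enorm_add_le _ _).trans ?_) _)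
  rw [enorm_neg]

lemma enorm_sub_le_ofReal {a b M : ℝ} (ha : |a| ≤ M) (hb : |b| ≤ M) :
    ‖a - b‖ₑ ≤ ENNReal.ofReal (2 * M) := by
  rw [Real.enorm_eq_ofReal_abs]
  exact ENNReal.ofReal_le_ofReal ((abs_sub _ _).trans (by linarith))

lemma tendsto_lintegral_of_uniform_approx {α ι : Type*} [MeasurableSpace α] {m : Measure α}
    {l : Filter ι} [l.IsCountablyGenerated] {F : ι → α → ℝ} {f : α → ℝ}
    {Fi : ℕ → ι → α → ℝ} {fi : ℕ → α → ℝ} {ε : ℕ → ℝ≥0∞} {M : ℝ} {B : ℝ≥0∞} {k : α → ℝ}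
    (hε : Tendsto ε atTop (𝓝 0)) (hB : B ≠ ∞)
    (hF : ∀ n, Measurable (F n)) (hf : Measurable f) (hFi : ∀ i n, Measurable (Fi i n))
    (hfi : ∀ i, Measurable (fi i)) (hk : Measurable k)
    (hFiM : ∀ i n x, |Fi i n x| ≤ M) (hfiM : ∀ i x, |fi i x| ≤ M) (hkB : ∀ x, ‖k x‖ₑ ≤ B)
    (hk1 : ∫⁻ x, ‖k x‖ₑ ∂m ≠ ∞)
    (h1 : ∀ i, ∀ᶠ n in l, ∫⁻ x, ‖Fi i n x - F n x‖ₑ ∂m ≤ ε i)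
    (h2 : ∀ i, ∫⁻ x, ‖fi i x - f x‖ₑ ∂m ≤ ε i)
    (h3 : ∀ i x, Tendsto (fun n => Fi i n x) l (𝓝 (fi i x))) :
    Tendsto (fun n => ∫⁻ x, ‖F n x - f x‖ₑ * ‖k x‖ₑ ∂m) l (𝓝 0) := by
  rw [ENNReal.tendsto_nhds_zero]
  intro η hη
  have hη2 : 0 < η / 2 := ENNReal.half_pos hη.ne'
  have hlim : Tendsto (fun i => ε i * B + ε i * B) atTop (𝓝 0) := by
    have := ENNReal.Tendsto.mul_const hε (b := B) (Or.inr hB)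
    rw [zero_mul] at this
    simpa using this.add this
  obtain ⟨i, hi⟩ := ((ENNReal.tendsto_nhds_zero.1 hlim) _ hη2).exists
  have hmid : Tendsto (fun n => ∫⁻ x, ‖Fi i n x - fi i x‖ₑ * ‖k x‖ₑ ∂m) l (𝓝 0) := by
    have h := tendsto_lintegral_filter_of_dominated_convergence (μ := m) (l := l)
      (F := fun n x => ‖Fi i n x - fi i x‖ₑ * ‖k x‖ₑ) (f := fun _ => 0)
      (fun x => ENNReal.ofReal (2 * M) * ‖k x‖ₑ)
      (Eventually.of_forall fun n => ((hFi i n).sub (hfi i)).enorm.mul hk.enorm)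
      (Eventually.of_forall fun n => ae_of_all _ fun x =>
        mul_le_mul_left (enorm_sub_le_ofReal (hFiM i n x) (hfiM i x)) _)
      (by
        rw [lintegral_const_mul _ hk.enorm]
        exact ENNReal.mul_ne_top ENNReal.ofReal_ne_top hk1)
      (ae_of_all _ fun x => by
        have e : Tendsto (fun n => ‖Fi i n x - fi i x‖ₑ) l (𝓝 0) := by
          have := ((h3 i x).sub_const (fi i x)).enorm
          simpa using this
        have := ENNReal.Tendsto.mul_const e (b := ‖k x‖ₑ) (Or.inr enorm_ne_top)
        simpa using this)
    simpa using h
  filter_upwards [h1 i, (ENNReal.tendsto_nhds_zero.1 hmid) _ hη2] with n hn hn'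
  calc ∫⁻ x, ‖F n x - f x‖ₑ * ‖k x‖ₑ ∂m
      ≤ ∫⁻ x, (‖Fi i n x - F n x‖ₑ * B + ‖Fi i n x - fi i x‖ₑ * ‖k x‖ₑ
          + ‖fi i x - f x‖ₑ * B) ∂m := by
        refine lintegral_mono fun x => ?_
        refine (mul_le_mul_left (enorm_sub_le_three _ (Fi i n x) (fi i x) _) _).trans ?_
        rw [add_mul, add_mul]
        gcongr <;> exact hkB x
    _ = (∫⁻ x, ‖Fi i n x - F n x‖ₑ ∂m) * B + ∫⁻ x, ‖Fi i n x - fi i x‖ₑ * ‖k x‖ₑ ∂m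
          + (∫⁻ x, ‖fi i x - f x‖ₑ ∂m) * B := by
        have m1 := ((hFi i n).sub (hF n)).enorm
        have m2 := ((hFi i n).sub (hfi i)).enorm
        have m3 := ((hfi i).sub hf).enorm
        simp only [Pi.sub_apply] at m1 m2 m3
        rw [lintegral_add_right _ (m3.mul_const B),
          lintegral_add_left (m1.mul_const B), lintegral_mul_const _ m1, lintegral_mul_const _ m3]
    _ ≤ ε i * B + η / 2 + ε i * B := by
        gcongr
        exact h2 i
    _ = ε i * B + ε i * B + η / 2 := by ring
    _ ≤ η / 2 + η / 2 := by gcongr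
    _ = η := ENNReal.add_halves η

/-- Mollifications of an approximating sequence, converging pointwise along a subsequence. -/
structure IsMollifiedLimit (M : ℝ) (w : ℕ → Euc N → ℝ → ℝ) (W : ℕ → ℕ → Euc N → ℝ → ℝ)
    (V : ℕ → Euc N → ℝ → ℝ) : Prop where
  measurable : ∀ i n, Measurable (Function.uncurry (W i n))
  measurable_lim : ∀ i, Measurable (Function.uncurry (V i))
  bound : ∀ i n x t, |W i n x t| ≤ M
  bound_lim : ∀ i x t, |V i x t| ≤ M
  tendsto : ∀ i x t, 0 ≤ t → Tendsto (fun n => W i n x t) atTop (𝓝 (V i x t))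
  lintegral_le : ∀ i n t, ∫⁻ x, ‖W i n x t - w n x t‖ₑ ≤ (2⁻¹ : ℝ≥0∞) ^ i
  lipschitz : ∀ i x, ∃ D, ∀ s t, 0 ≤ s → 0 ≤ t → |V i x t - V i x s| ≤ |t - s| * D

lemma IsApprox.exists_isMollifiedLimit (ha : IsApprox μ T M Φ φ u0 w g) (hu : Integrable u0) :
    ∃ σ : ℕ → ℕ, StrictMono σ ∧ ∃ W V, IsMollifiedLimit M (fun n => w (σ n)) W V := by
  have hpos : ∀ i : ℕ, (0 : ℝ) < ((2⁻¹ : ℝ≥0∞) ^ i).toReal := fun i =>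
    ENNReal.toReal_pos (by simp) (by simp)
  have hδ : ∀ i : ℕ, ∃ δ > 0, ∀ y : Euc N, ‖y‖ < δ →
      ∫ x, |u0 (x + y) - u0 x| ≤ ((2⁻¹ : ℝ≥0∞) ^ i).toReal := fun i => by
    obtain ⟨η, hη, h⟩ := Metric.eventually_nhds_iff.1
      ((tendsto_integral_translate_sub hu).eventually_lt_const (hpos i))
    exact ⟨η, hη, fun y hy => (h (by simpa using hy)).le⟩
  choose δ hδ0 hδ using hδ
  choose ρ hρ using fun i => exists_isMollifier (N := N) (hδ0 i)
  obtain ⟨σ, hσ, hl⟩ := ha.exists_subseq_tendsto_mollify hu hρ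
  set W : ℕ → ℕ → Euc N → ℝ → ℝ := fun i n x t => mollify (ρ i) (fun x => w (σ n) x t) x with hW
  have hWm : ∀ i n, Measurable (Function.uncurry (W i n)) := fun i n =>
    measurable_mollify_uncurry (ha.measurable (σ n)) (hρ i).isTestFn.measurable
  have hWb : ∀ i n x t, |W i n x t| ≤ M := fun i n x t =>
    (hρ i).abs_mollify_le (fun x => ha.bound _ x t) x
  set V : ℕ → Euc N → ℝ → ℝ := fun i x t => clamp M (limUnder atTop fun n => W i n x t) with hV
  have hlim : ∀ i x t, 0 ≤ t → Tendsto (fun n => W i n x t) atTop (𝓝 (V i x t)) := by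
    intro i x t ht
    obtain ⟨l, h⟩ := hl i x t ht
    have hlM : |l| ≤ M := le_of_tendsto' h.abs fun n => hWb i n x t
    have : V i x t = l := by
      simp only [hV]
      rw [Tendsto.limUnder_eq h, clamp_of_abs_le hlM]
    rwa [this]
  refine ⟨σ, hσ, W, V, hWm, fun i => ?_, hWb, fun i x t => abs_clamp_le ha.nonneg _, hlim, ?_, ?_⟩
  · exact (continuous_clamp M).measurable.comp
      (StronglyMeasurable.limUnder (l := atTop) fun n => (hWm i n).stronglyMeasurable).measurable
  · intro i n t
    have hi := ha.integrable hu (σ n) t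
    have h := (hρ i).integral_abs_mollify_sub_le hi fun y hy =>
      (ha.integral_abs_translate_le hu (σ n) t y).trans (hδ i y hy)
    have e := ofReal_integral_norm_eq_lintegral_enorm
      ((integrable_mollify hi (hρ i).isTestFn.integrable).sub hi)
    refine le_trans (le_of_eq e.symm) ((ENNReal.ofReal_le_ofReal h).trans ?_)
    exact ENNReal.ofReal_toReal_le
  · intro i x
    obtain ⟨D, hD, h⟩ := ha.exists_abs_mollify_sub_le_time (hρ i).isTestFn x
    refine ⟨D, fun s t hs ht => ?_⟩
    have h1 := ((hlim i x t ht).sub (hlim i x s hs)).abs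
    have h2 := ((tendsto_comp_strictMono_one_div hσ).const_add |t - s|).mul_const D
    rw [add_zero] at h2
    exact le_of_tendsto_of_tendsto' h1 h2 fun n => h (σ n) s t hs ht

variable {W : ℕ → ℕ → Euc N → ℝ → ℝ} {V : ℕ → Euc N → ℝ → ℝ}

lemma IsMollifiedLimit.lintegral_lim_sub_le (h : IsMollifiedLimit M w W V)
    (hw : ∀ n, Measurable (Function.uncurry (w n))) {t : ℝ} (ht : 0 ≤ t) (i j : ℕ) :
    ∫⁻ x, ‖V i x t - V j x t‖ₑ ≤ (2⁻¹ : ℝ≥0∞) ^ i + (2⁻¹ : ℝ≥0∞) ^ j := by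
  refine lintegral_le_of_tendsto_pointwise (f := fun n x => ‖W i n x t - W j n x t‖ₑ)
    (fun n => (((h.measurable i n).slice t).sub ((h.measurable j n).slice t)).enorm)
    (ae_of_all _ fun x => ((h.tendsto i x t ht).sub (h.tendsto j x t ht)).enorm)
    (b := fun _ => _) (fun n => ?_) tendsto_const_nhds
  have m1 := (((h.measurable i n).slice t).sub ((hw n).slice t)).enorm
  calc ∫⁻ x, ‖W i n x t - W j n x t‖ₑ
      ≤ ∫⁻ x, (‖W i n x t - w n x t‖ₑ + ‖W j n x t - w n x t‖ₑ) := by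
        refine lintegral_mono fun x => ?_
        have e : W i n x t - W j n x t = (W i n x t - w n x t) + -(W j n x t - w n x t) := by ring
        rw [e]
        refine (enorm_add_le _ _).trans ?_
        rw [enorm_neg]
    _ = (∫⁻ x, ‖W i n x t - w n x t‖ₑ) + ∫⁻ x, ‖W j n x t - w n x t‖ₑ := lintegral_add_left m1 _
    _ ≤ _ := add_le_add (h.lintegral_le i n t) (h.lintegral_le j n t)

lemma tendsto_half_pow : Tendsto (fun i : ℕ => (2⁻¹ : ℝ≥0∞) ^ i) atTop (𝓝 0) :=
  ENNReal.tendsto_pow_atTop_nhds_zero_of_lt_one ENNReal.one_half_lt_one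

lemma IsMollifiedLimit.exists_limit (h : IsMollifiedLimit M w W V)
    (hw : ∀ n, Measurable (Function.uncurry (w n))) (hM : 0 ≤ M) :
    ∃ u : Euc N → ℝ → ℝ, Measurable (Function.uncurry u) ∧ (∀ x t, |u x t| ≤ M) ∧
      ∀ t, 0 ≤ t → ∀ i, ∫⁻ x, ‖V i x t - u x t‖ₑ ≤ (2⁻¹ : ℝ≥0∞) ^ i := by
  refine ⟨fun x t => clamp M (limUnder atTop fun i => V i x t), ?_,
    fun x t => abs_clamp_le hM _, fun t ht i => ?_⟩
  · exact (continuous_clamp M).measurable.comp (StronglyMeasurable.limUnder (l := atTop)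
      fun i => (h.measurable_lim i).stronglyMeasurable).measurable
  have hm := fun i => (h.measurable_lim i).slice t
  have hae : ∀ᵐ x, ∃ l, Tendsto (fun i => V i x t) atTop (𝓝 l) := by
    refine Lp.ae_tendsto_of_cauchy_eLpNorm (p := 1) (f := fun i x => V i x t)
      (fun i => (hm i).aestronglyMeasurable) le_rfl (B := fun i => 3 * (2⁻¹ : ℝ≥0∞) ^ i) ?_ ?_
    · rw [ENNReal.tsum_mul_left, ENNReal.tsum_geometric, ENNReal.one_sub_inv_two, inv_inv]
      exact ENNReal.mul_ne_top (by simp) (by simp)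
    · intro m i j hi hj
      rw [eLpNorm_one_eq_lintegral_enorm]
      have hmono : ∀ i, m ≤ i → (2⁻¹ : ℝ≥0∞) ^ i ≤ (2⁻¹ : ℝ≥0∞) ^ m := fun i hi =>
        pow_le_pow_of_le_one zero_le ENNReal.one_half_lt_one.le hi
      refine ((h.lintegral_lim_sub_le hw ht i j).trans
        (add_le_add (hmono i hi) (hmono j hj))).trans_lt ?_
      rw [← two_mul]
      exact ENNReal.mul_lt_mul_left (by simp) (by simp) (by norm_num)
  refine lintegral_le_of_tendsto_pointwise (f := fun j x => ‖V i x t - V j x t‖ₑ)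
    (fun j => ((hm i).sub (hm j)).enorm) ?_ (h.lintegral_lim_sub_le hw ht i) ?_
  · filter_upwards [hae] with x ⟨l, hl⟩
    have hlM : |l| ≤ M := le_of_tendsto' hl.abs fun i => h.bound_lim i x t
    rw [Tendsto.limUnder_eq hl, clamp_of_abs_le hlM]
    exact (hl.const_sub (V i x t)).enorm
  · simpa using tendsto_half_pow.const_add ((2⁻¹ : ℝ≥0∞) ^ i)

/-- Limit of an approximating sequence in `L¹` with bounded integrable weights. -/
structure IsApproxLimit (M : ℝ) (T : ℝ) (w : ℕ → Euc N → ℝ → ℝ) (u : Euc N → ℝ → ℝ) : Prop where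
  measurable : Measurable (Function.uncurry u)
  bound : ∀ x t, |u x t| ≤ M
  exists_lintegral_le : ∃ C : ℝ≥0∞, C ≠ ∞ ∧ ∀ t, 0 ≤ t → ∫⁻ x, ‖u x t‖ₑ ≤ C
  tendsto : ∀ t, 0 ≤ t → ∀ (k : Euc N → ℝ) (B : ℝ), Measurable k → Integrable k →
    (∀ x, |k x| ≤ B) → Tendsto (fun n => ∫⁻ x, ‖w n x t - u x t‖ₑ * ‖k x‖ₑ) atTop (𝓝 0)
  memCL1loc : MemCL1loc T u

lemma IsApprox.exists_isApproxLimit (ha : IsApprox μ T M Φ φ u0 w g) (hu : Integrable u0) :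
    ∃ σ : ℕ → ℕ, StrictMono σ ∧ ∃ u, IsApproxLimit M T (fun n => w (σ n)) u := by
  obtain ⟨σ, hσ, W, V, h⟩ := ha.exists_isMollifiedLimit hu
  obtain ⟨u, hum, hub, hu1⟩ := h.exists_limit (fun n => ha.measurable (σ n)) ha.nonneg
  refine ⟨σ, hσ, u, hum, hub, ?_, ?_, ?_⟩
  · refine ⟨(∫⁻ x, ‖u0 x‖ₑ) + 2, ENNReal.add_ne_top.2 ⟨hu.hasFiniteIntegral.ne, by simp⟩,
      fun t ht => ?_⟩
    have hV : ∫⁻ x, ‖V 0 x t‖ₑ ≤ (∫⁻ x, ‖u0 x‖ₑ) + 1 := by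
      refine lintegral_le_of_tendsto_pointwise (f := fun n x => ‖W 0 n x t‖ₑ)
        (fun n => ((h.measurable 0 n).slice t).enorm)
        (ae_of_all _ fun x => (h.tendsto 0 x t ht).enorm) (b := fun _ => _)
        (fun n => ?_) tendsto_const_nhds
      have hm := ((ha.measurable (σ n)).slice t).enorm
      calc ∫⁻ x, ‖W 0 n x t‖ₑ
          ≤ ∫⁻ x, (‖w (σ n) x t‖ₑ + ‖W 0 n x t - w (σ n) x t‖ₑ) :=
            lintegral_mono fun x => by
              simpa using enorm_add_le (w (σ n) x t) (W 0 n x t - w (σ n) x t)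
        _ = (∫⁻ x, ‖w (σ n) x t‖ₑ) + ∫⁻ x, ‖W 0 n x t - w (σ n) x t‖ₑ := lintegral_add_left hm _
        _ ≤ _ := add_le_add (ha.lintegral_le _ _) (by simpa using h.lintegral_le 0 n t)
    have hm := ((h.measurable_lim 0).slice t).enorm
    calc ∫⁻ x, ‖u x t‖ₑ ≤ ∫⁻ x, (‖V 0 x t‖ₑ + ‖V 0 x t - u x t‖ₑ) :=
          lintegral_mono fun x => by
            have := enorm_sub_le (a := V 0 x t) (b := V 0 x t - u x t)
            simpa using this
      _ = (∫⁻ x, ‖V 0 x t‖ₑ) + ∫⁻ x, ‖V 0 x t - u x t‖ₑ := lintegral_add_left hm _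
      _ ≤ (∫⁻ x, ‖u0 x‖ₑ) + 1 + 1 := add_le_add hV (by simpa using hu1 t ht 0)
      _ = _ := by rw [add_assoc, one_add_one_eq_two]
  · intro t ht k B hk hki hkB
    refine tendsto_lintegral_of_uniform_approx (Fi := fun i n x => W i n x t)
      (fi := fun i x => V i x t) (M := M) (B := ENNReal.ofReal B)
      tendsto_half_pow ENNReal.ofReal_ne_top (fun n => (ha.measurable (σ n)).slice t) (hum.slice t)
      (fun i n => (h.measurable i n).slice t) (fun i => (h.measurable_lim i).slice t) hk
      (fun i n x => h.bound i n x t) (fun i x => h.bound_lim i x t) (fun x => ?_)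
      hki.hasFiniteIntegral.ne (fun i => Eventually.of_forall fun n => h.lintegral_le i n t)
      (hu1 t ht) (fun i x => h.tendsto i x t ht)
    rw [Real.enorm_eq_ofReal_abs]
    exact ENNReal.ofReal_le_ofReal (hkB x)
  · intro K hK
    have hKfin : volume K ≠ ∞ := hK.measure_lt_top.ne
    have hInt : ∀ t, IntegrableOn (fun x => u x t) K := fun t =>
      Measure.integrableOn_of_bounded hKfin (hum.slice t).aestronglyMeasurable (M := M)
        (ae_of_all _ fun x => hub x t)
    refine ⟨fun t _ => hInt t, fun t ht => ?_⟩
    have key := tendsto_lintegral_of_uniform_approx (m := volume.restrict K)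
      (l := 𝓝[Icc 0 T] t) (F := fun s x => u x s) (f := fun x => u x t)
      (Fi := fun i s x => V i x s) (fi := fun i x => V i x t) (M := M) (B := 1)
      (k := fun _ => 1)
      tendsto_half_pow ENNReal.one_ne_top (fun s => hum.slice s) (hum.slice t)
      (fun i s => (h.measurable_lim i).slice s) (fun i => (h.measurable_lim i).slice t)
      measurable_const (fun i s x => h.bound_lim i x s) (fun i x => h.bound_lim i x t)
      (fun x => by simp) (by simpa using hKfin)
      (fun i => by
        filter_upwards [self_mem_nhdsWithin] with s hs
        exact (setLIntegral_le_lintegral _ _).trans (hu1 s hs.1 i))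
      (fun i => (setLIntegral_le_lintegral _ _).trans (hu1 t ht.1 i))
      (fun i x => by
        obtain ⟨D, hD⟩ := h.lipschitz i x
        refine tendsto_iff_norm_sub_tendsto_zero.2 ?_
        have hz : Tendsto (fun s => |s - t| * D) (𝓝[Icc 0 T] t) (𝓝 0) := by
          have : Continuous fun s : ℝ => |s - t| * D := by fun_prop
          have := this.tendsto t
          simp only [sub_self, abs_zero, zero_mul] at this
          exact this.mono_left nhdsWithin_le_nhds
        refine squeeze_zero' (Eventually.of_forall fun s => norm_nonneg _) ?_ hz
        filter_upwards [self_mem_nhdsWithin] with s hs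
        exact hD t s ht.1 hs.1)
    simp only [enorm_one, mul_one] at key
    have e : ∀ s, ∫ x in K, |u x s - u x t| = (∫⁻ x in K, ‖u x s - u x t‖ₑ).toReal := fun s =>
      integral_norm_eq_lintegral_enorm ((hInt s).sub (hInt t)).aestronglyMeasurable
    simp only [e]
    exact (ENNReal.tendsto_toReal ENNReal.zero_ne_top).comp key

end Limit

section Existence
variable {N : ℕ} {μ : Measure (Euc N)} {T M Φ : ℝ} {φ : ℝ → ℝ} {u0 : Euc N → ℝ}
  {w : ℕ → Euc N → ℝ → ℝ} {g : ℕ → ℝ → ℝ} {u : Euc N → ℝ → ℝ} {σ : ℕ → ℕ} {k : Euc N → ℝ}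

lemma measurable_jumpOp_uncurry {ν : Measure (Euc N)} [IsFiniteMeasure ν] {ψ : Euc N → ℝ → ℝ}
    (hψ : Measurable (Function.uncurry ψ)) :
    Measurable (fun p : Euc N × ℝ => jumpOp ν (fun y => ψ y p.2) p.1) := by
  have h : Measurable (Function.uncurry fun (p : Euc N × ℝ) (z : Euc N) =>
      ψ (p.1 + z) p.2 - ψ p.1 p.2) :=
    (hψ.comp (((measurable_fst.comp measurable_fst).add measurable_snd).prodMk
      (measurable_snd.comp measurable_fst))).sub (hψ.comp measurable_fst)
  exact (StronglyMeasurable.integral_prod_right h.stronglyMeasurable).measurable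

lemma IsSlice.exists_abs_Lop_le {A R C : ℝ} {ψ : Euc N → ℝ} (hμ : IsLevyMeasure μ)
    (h : IsSlice A R C ψ) : ∃ B, ∀ x, |Lop μ ψ x| ≤ B := by
  have := hμ.isFiniteMeasure_trunc one_pos
  refine ⟨A * smallMoment μ 1 + 2 * C * (truncMeasure μ 1).real univ, fun x => ?_⟩
  have h1 := h.abs_Lop_sub_jumpOp_le hμ one_pos le_rfl x
  have h2 := abs_jumpOp_le (ν := truncMeasure μ 1) h.bdd x
  have h3 : (Metric.closedBall (0 : Euc N) (R + 1)).indicator (fun _ => A * smallMoment μ 1) x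
      ≤ A * smallMoment μ 1 :=
    indicator_le_self' (fun _ _ => mul_nonneg h.nonneg.1 (smallMoment_nonneg 1)) x
  have h4 := abs_add_le (Lop μ ψ x - jumpOp (truncMeasure μ 1) ψ x) (jumpOp (truncMeasure μ 1) ψ x)
  rw [sub_add_cancel] at h4
  linarith

lemma IsApproxLimit.tendsto_integral_abs_mul (hL : IsApproxLimit M T w u)
    (hw : ∀ n, Measurable (Function.uncurry (w n)))
    {t : ℝ} (ht : 0 ≤ t) {B : ℝ} (hk : Measurable k) (hki : Integrable k) (hB : ∀ x, |k x| ≤ B) :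
    Tendsto (fun n => ∫ x, |w n x t - u x t| * |k x|) atTop (𝓝 0) := by
  have e : ∀ n, ∫ x, |w n x t - u x t| * |k x|
      = (∫⁻ x, ‖w n x t - u x t‖ₑ * ‖k x‖ₑ).toReal := fun n => by
    have := integral_norm_eq_lintegral_enorm (μ := volume)
      (((((hw n).slice t).sub (hL.measurable.slice t)).mul hk).aestronglyMeasurable)
    simpa [abs_mul, enorm_mul] using this
  simp only [e]
  exact (ENNReal.tendsto_toReal ENNReal.zero_ne_top).comp (hL.tendsto t ht k B hk hki hB)

lemma IsApproxLimit.tendsto_integral_mul (hL : IsApproxLimit M T w u)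
    (hw : ∀ n, Measurable (Function.uncurry (w n))) (hwM : ∀ n x t, |w n x t| ≤ M)
    {t : ℝ} (ht : 0 ≤ t) {B : ℝ} (hk : Measurable k) (hki : Integrable k) (hB : ∀ x, |k x| ≤ B)
    {F : ℕ → Euc N → ℝ} {f : Euc N → ℝ} (hF : ∀ n, Integrable fun x => F n x * k x)
    (hf : Integrable fun x => f x * k x) {e : ℕ → ℝ} (he : Tendsto e atTop (𝓝 0))
    (h : ∀ δ > 0, ∃ K : ℝ, ∀ n x, |F n x - f x| ≤ δ + K * (|w n x t - u x t| + e n)) :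
    Tendsto (fun n => ∫ x, F n x * k x) atTop (𝓝 (∫ x, f x * k x)) := by
  have hr := hL.tendsto_integral_abs_mul hw ht hk hki hB
  have hri : ∀ n, Integrable fun x => |w n x t - u x t| * |k x| := fun n =>
    hki.abs.bdd_mul (c := 2 * M)
      (((hw n).slice t).sub (hL.measurable.slice t)).norm.aestronglyMeasurable
      (ae_of_all _ fun x => by
        rw [Real.norm_eq_abs, abs_abs]
        refine (abs_sub _ _).trans ?_
        linarith [hwM n x t, hL.bound x t])
  rw [Metric.tendsto_atTop']
  intro ε hε
  set P := ∫ x, |k x| with hP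
  have hP0 : 0 ≤ P := integral_nonneg fun _ => abs_nonneg _
  obtain ⟨K, hK⟩ := h (ε / (2 * (P + 1))) (by positivity)
  have hlim : Tendsto (fun n => K * (∫ x, |w n x t - u x t| * |k x|) + K * e n * P)
      atTop (𝓝 0) := by
    have := (hr.const_mul K).add ((he.const_mul K).mul_const P)
    simpa using this
  obtain ⟨n₀, hn₀⟩ := eventually_atTop.1
    (hlim.eventually_lt_const (show 0 < ε / 2 by positivity))
  refine ⟨n₀, fun n hn => ?_⟩
  rw [Real.dist_eq, ← integral_sub (hF n) hf]
  have e1 : |∫ x, (F n x * k x - f x * k x)|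
      ≤ ∫ x, (ε / (2 * (P + 1)) * |k x| + (K * (|w n x t - u x t| * |k x|) + K * e n * |k x|)) := by
    rw [← Real.norm_eq_abs]
    refine norm_integral_le_of_norm_le ((hki.abs.const_mul _).add
      (((hri n).const_mul K).add (hki.abs.const_mul _))) (ae_of_all _ fun x => ?_)
    rw [← sub_mul, Real.norm_eq_abs, abs_mul]
    refine (mul_le_mul_of_nonneg_right (hK n x) (abs_nonneg _)).trans (le_of_eq ?_)
    ring
  have j : Integrable fun x => K * (|w n x t - u x t| * |k x|) + K * e n * |k x| :=
    ((hri n).const_mul K).add (hki.abs.const_mul _)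
  rw [integral_add (hki.abs.const_mul _) j,
    integral_add ((hri n).const_mul K) (hki.abs.const_mul _), integral_const_mul,
    integral_const_mul, integral_const_mul, ← hP] at e1
  have e2 : ε / (2 * (P + 1)) * P ≤ ε / 2 := by
    rw [div_mul_eq_mul_div, div_le_div_iff₀ (by positivity) (by positivity)]
    nlinarith
  linarith [hn₀ n hn.le]

lemma one_div_natCast_add_one_le (n : ℕ) : 1 / ((n : ℝ) + 1) ≤ 1 := by
  rw [div_le_one (by positivity)]
  linarith [(Nat.cast_nonneg n : (0 : ℝ) ≤ n)]

lemma IsApprox.exists_abs_comp_sub_le (ha : IsApprox μ T M Φ φ u0 w g) (hφc : Continuous φ)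
    (hφ : Monotone φ) {δ : ℝ} (hδ : 0 < δ) :
    ∃ K : ℝ, ∀ n a b, |a| ≤ M → |b| ≤ M →
      |g n a - φ b| ≤ δ + K * (|a - b| + 1 / ((n : ℝ) + 1)) := by
  obtain ⟨K, hK0, hK⟩ := exists_abs_sub_le_add_mul hφc hφ (M + 1) hδ
  refine ⟨K, fun n a b hab hbb => ?_⟩
  have hn0 : 0 < 1 / ((n : ℝ) + 1) := by positivity
  have hn1 := one_div_natCast_add_one_le n
  have h1 := hK a b (by linarith) (by linarith)
  have h2 := hK (a + 1 / ((n : ℝ) + 1)) b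
    (by rw [abs_le] at hab ⊢; constructor <;> linarith [hab.1, hab.2]) (by linarith)
  have h3 : |a + 1 / ((n : ℝ) + 1) - b| ≤ |a - b| + 1 / ((n : ℝ) + 1) := by
    have := abs_add_le (a - b) (1 / ((n : ℝ) + 1))
    rw [abs_of_pos hn0] at this
    rwa [add_sub_right_comm]
  have h4 := mul_le_mul_of_nonneg_left h3 hK0
  have h5 : K * |a - b| ≤ K * (|a - b| + 1 / ((n : ℝ) + 1)) :=
    mul_le_mul_of_nonneg_left (by linarith) hK0
  have h6 := ha.le n a
  have h7 := ha.ge n a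
  rw [abs_le] at h1 h2 ⊢
  constructor <;> linarith [h1.1, h2.2]

lemma IsApprox.tendsto_weak_integrand (hμ : IsLevyMeasure μ) (ha : IsApprox μ T M Φ φ u0 w g)
    (hφc : Continuous φ) (hφ : Monotone φ) (hσ : StrictMono σ)
    (hL : IsApproxLimit M T (fun n => w (σ n)) u) {ψ : Euc N → ℝ → ℝ} (hψ : IsSTTestFn T ψ)
    {t : ℝ} (ht : 0 ≤ t) :
    Tendsto (fun n => ∫ x, (w (σ n) x t * deriv (ψ x) t + g (σ n) (w (σ n) x t) *
        jumpOp (truncMeasure μ (1 / ((σ n : ℝ) + 1))) (fun y => ψ y t) x)) atTop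
      (𝓝 (∫ x, (u x t * deriv (ψ x) t + φ (u x t) * Lop μ (fun y => ψ y t) x))) := by
  have hsf := hμ.sigmaFinite
  obtain ⟨A, R, C, h⟩ := hψ.exists_isSlice
  obtain ⟨A', R', C', h'⟩ := hψ.deriv_time.exists_isSlice
  obtain ⟨B, hB⟩ := (h t).exists_abs_Lop_le hμ
  have hwm := fun n => ha.measurable (σ n)
  have hwb := fun n => ha.bound (σ n)
  have hpos : ∀ n : ℕ, (0 : ℝ) < 1 / ((n : ℝ) + 1) := fun n => by positivity
  have hΦ0 : 0 ≤ Φ := (abs_nonneg _).trans (ha.bound_right 0 0 (by simpa using ha.nonneg))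
  have hgm : ∀ n, Measurable fun x => g (σ n) (w (σ n) x t) := fun n =>
    (ha.mono (σ n)).measurable.comp ((hwm n).slice t)
  have hgb : ∀ n x, |g (σ n) (w (σ n) x t)| ≤ Φ := fun n x => ha.bound_right _ _ (hwb n x t)
  have hφb : ∀ x, |φ (u x t)| ≤ |φ M| + |φ (-M)| := fun x => hφ.abs_le_of_abs_le (hL.bound x t)
  have hLm := measurable_Lop (μ := μ) (h t).contDiff
  have hLi := (h t).integrable_Lop hμ
  have i1 := fun n => integrable_mul_deriv hψ (hwm n) (hwb n) t
  have i2 : ∀ n, Integrable fun x => g (σ n) (w (σ n) x t) * Lop μ (fun y => ψ y t) x := fun n =>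
    hLi.bdd_mul (c := Φ) (hgm n).aestronglyMeasurable (ae_of_all _ (hgb n))
  have i3 := fun n => (h t).integrable_Lop_sub_jumpOp hμ (hpos (σ n))
    (one_div_natCast_add_one_le (σ n))
  have i4 : ∀ n, Integrable fun x => g (σ n) (w (σ n) x t) * (Lop μ (fun y => ψ y t) x
      - jumpOp (truncMeasure μ (1 / ((σ n : ℝ) + 1))) (fun y => ψ y t) x) := fun n =>
    (i3 n).bdd_mul (c := Φ) (hgm n).aestronglyMeasurable (ae_of_all _ (hgb n))
  have i5 := integrable_mul_deriv hψ hL.measurable hL.bound t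
  have i6 : Integrable fun x => φ (u x t) * Lop μ (fun y => ψ y t) x :=
    hLi.bdd_mul (c := |φ M| + |φ (-M)|)
      (hφc.measurable.comp (hL.measurable.slice t)).aestronglyMeasurable (ae_of_all _ hφb)
  have t1 : Tendsto (fun n => ∫ x, w (σ n) x t * deriv (ψ x) t) atTop
      (𝓝 (∫ x, u x t * deriv (ψ x) t)) :=
    hL.tendsto_integral_mul hwm hwb ht (h' t).contDiff.continuous.measurable (h' t).integrable
      (h' t).bdd i1 i5 (e := fun _ => 0) tendsto_const_nhds
      fun δ hδ => ⟨1, fun n x => by linarith⟩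
  have t2 : Tendsto (fun n => ∫ x, g (σ n) (w (σ n) x t) * Lop μ (fun y => ψ y t) x) atTop
      (𝓝 (∫ x, φ (u x t) * Lop μ (fun y => ψ y t) x)) :=
    hL.tendsto_integral_mul hwm hwb ht hLm hLi hB i2 i6 (tendsto_comp_strictMono_one_div hσ)
      fun δ hδ => by
        obtain ⟨K, hK⟩ := ha.exists_abs_comp_sub_le hφc hφ hδ
        exact ⟨K, fun n x => hK (σ n) _ _ (hwb n x t) (hL.bound x t)⟩
  have t3 : Tendsto (fun n => ∫ x, g (σ n) (w (σ n) x t) * (Lop μ (fun y => ψ y t) x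
      - jumpOp (truncMeasure μ (1 / ((σ n : ℝ) + 1))) (fun y => ψ y t) x)) atTop (𝓝 0) := by
    have hz : Tendsto (fun n => Φ * (A * smallMoment μ (1 / ((σ n : ℝ) + 1)) *
        (volume : Measure (Euc N)).real (Metric.closedBall 0 (R + 1)))) atTop (𝓝 0) := by
      have := (((hμ.tendsto_smallMoment.comp hσ.tendsto_atTop).const_mul A).mul_const
        ((volume : Measure (Euc N)).real (Metric.closedBall 0 (R + 1)))).const_mul Φ
      simpa using this
    refine squeeze_zero_norm (fun n => ?_) hz
    exact (abs_integral_mul_le (hgb n) (i3 n)).trans (mul_le_mul_of_nonneg_left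
      ((h t).integral_abs_Lop_sub_jumpOp_le hμ (hpos (σ n)) (one_div_natCast_add_one_le (σ n))) hΦ0)
  rw [integral_add i5 i6, ← sub_zero (_ + _)]
  refine ((t1.add t2).sub t3).congr fun n => ?_
  have j : Integrable fun x => w (σ n) x t * deriv (ψ x) t
      + g (σ n) (w (σ n) x t) * Lop μ (fun y => ψ y t) x := (i1 n).add (i2 n)
  rw [← integral_add (i1 n) (i2 n), ← integral_sub j (i4 n)]
  exact integral_congr_ae (ae_of_all _ fun x => by ring)

lemma IsApprox.isDistSolOp (hμ : IsLevyMeasure μ) (ha : IsApprox μ T M Φ φ u0 w g)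
    (hφc : Continuous φ) (hφ : Monotone φ) (hσ : StrictMono σ)
    (hL : IsApproxLimit M T (fun n => w (σ n)) u) : IsDistSolOp T (Lop μ) φ u0 u := by
  intro ψ hψ
  have hpos : ∀ n : ℕ, (0 : ℝ) < 1 / ((n : ℝ) + 1) := fun n => by positivity
  have hΦ0 : 0 ≤ Φ := (abs_nonneg _).trans (ha.bound_right 0 0 (by simpa using ha.nonneg))
  obtain ⟨A, R, C, h⟩ := hψ.exists_isSlice
  obtain ⟨A', R', C', h'⟩ := hψ.deriv_time.exists_isSlice
  have hgb : ∀ n x t, |g (σ n) (w (σ n) x t)| ≤ Φ := fun n x t =>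
    ha.bound_right _ _ (ha.bound _ _ _)
  have hlim : Tendsto (fun n => ∫ t in Ioo 0 T, ∫ x, (w (σ n) x t * deriv (ψ x) t
      + g (σ n) (w (σ n) x t) *
        jumpOp (truncMeasure μ (1 / ((σ n : ℝ) + 1))) (fun y => ψ y t) x)) atTop
      (𝓝 (∫ t in Ioo 0 T, ∫ x,
        (u x t * deriv (ψ x) t + φ (u x t) * Lop μ (fun y => ψ y t) x))) := by
    refine tendsto_integral_of_dominated_convergence
      (fun _ => M * (C' * (volume : Measure (Euc N)).real (Metric.closedBall 0 R'))
        + Φ * sliceConst μ A R C) (fun n => ?_) (integrable_const _)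
      (fun n => ae_of_all _ fun t => ?_) ?_
    · have := hμ.isFiniteMeasure_trunc (hpos (σ n))
      have hm : Measurable (fun p : Euc N × ℝ => w (σ n) p.1 p.2 * deriv (ψ p.1) p.2
          + g (σ n) (w (σ n) p.1 p.2) *
            jumpOp (truncMeasure μ (1 / ((σ n : ℝ) + 1))) (fun y => ψ y p.2) p.1) :=
        ((ha.measurable (σ n)).mul hψ.deriv_time.1.continuous.measurable).add
          (((ha.mono (σ n)).measurable.comp (ha.measurable (σ n))).mul
            (measurable_jumpOp_uncurry hψ.1.continuous.measurable))
      exact (StronglyMeasurable.integral_prod_left' hm.stronglyMeasurable).aestronglyMeasurable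
    · have i2 : Integrable fun x => g (σ n) (w (σ n) x t) *
          jumpOp (truncMeasure μ (1 / ((σ n : ℝ) + 1))) (fun y => ψ y t) x :=
        ((h t).integrable_jumpOp hμ (hpos (σ n))).bdd_mul (c := Φ)
          ((ha.mono (σ n)).measurable.comp ((ha.measurable (σ n)).slice t)).aestronglyMeasurable
          (ae_of_all _ fun x => hgb n x t)
      rw [integral_add (integrable_mul_deriv hψ (ha.measurable (σ n)) (ha.bound (σ n)) t) i2,
        Real.norm_eq_abs]
      refine (abs_add_le _ _).trans (add_le_add ?_ ?_)
      · exact (abs_integral_mul_le (fun x => ha.bound (σ n) x t) (h' t).integrable).trans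
          (mul_le_mul_of_nonneg_left (h' t).integral_abs_le ha.nonneg)
      · exact (abs_integral_mul_le (fun x => hgb n x t)
          ((h t).integrable_jumpOp hμ (hpos (σ n)))).trans (mul_le_mul_of_nonneg_left
          ((h t).integral_abs_jumpOp_le hμ (hpos (σ n)) (one_div_natCast_add_one_le (σ n))) hΦ0)
    · refine (ae_restrict_iff' measurableSet_Ioo).2 (ae_of_all _ fun t ht => ?_)
      exact ha.tendsto_weak_integrand hμ hφc hφ hσ hL hψ ht.1.le
  exact tendsto_nhds_unique (hlim.add_const _) ((ha.weak ψ hψ).comp hσ.tendsto_atTop)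

lemma IsApproxLimit.memLinfQT (hL : IsApproxLimit M T w u) : MemLinfQT T u :=
  ⟨hL.measurable.aestronglyMeasurable, M, ae_of_all _ fun p => hL.bound p.1 p.2⟩

lemma IsApproxLimit.memL1QT (hL : IsApproxLimit M T w u) : MemL1QT T u := by
  refine ⟨hL.measurable.aestronglyMeasurable, ?_⟩
  obtain ⟨C, hC, h⟩ := hL.exists_lintegral_le
  have hm : Measurable fun p : Euc N × ℝ => ‖u p.1 p.2‖ₑ := hL.measurable.enorm
  rw [HasFiniteIntegral, QTvol, lintegral_prod_symm' _ hm]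
  calc ∫⁻ t in Ioo 0 T, ∫⁻ x, ‖u x t‖ₑ ≤ ∫⁻ _t in Ioo 0 T, C :=
        setLIntegral_mono measurable_const fun t ht => h t ht.1.le
    _ = C * volume (Ioo 0 T) := setLIntegral_const _ _
    _ < ∞ := ENNReal.mul_lt_top hC.lt_top measure_Ioo_lt_top

lemma exists_isDistSolOp (hμ : IsLevyMeasure μ) (hT : 0 < T) (hφc : Continuous φ)
    (hφ : Monotone φ) (hu0 : MemLinfRn u0) (hu1 : Integrable u0) :
    ∃ u : Euc N → ℝ → ℝ, MemLinfQT T u ∧ MemL1QT T u ∧ MemCL1loc T u ∧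
      IsDistSolOp T (Lop μ) φ u0 u := by
  obtain ⟨hm, C, hC⟩ := hu0
  set M := max C 0
  set v : Euc N → ℝ := fun x => clamp M (hm.mk u0 x) with hv
  have hvu : v =ᵐ[volume] u0 := by
    filter_upwards [hm.ae_eq_mk, hC] with x hx hCx
    simp only [hv]
    rw [← hx, clamp_of_abs_le (hCx.trans (le_max_left _ _))]
  have hvm : Measurable v :=
    (continuous_clamp M).measurable.comp hm.stronglyMeasurable_mk.measurable
  obtain ⟨Φ, w, g, ha⟩ := exists_isApprox hμ hT hφc hφ hvm
    (fun x => abs_clamp_le (le_max_right C 0) (hm.mk u0 x))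
  obtain ⟨σ, hσ, u, hL⟩ := ha.exists_isApproxLimit (hu1.congr hvu.symm)
  refine ⟨u, hL.memLinfQT, hL.memL1QT, hL.memCL1loc, fun ψ hψ => ?_⟩
  refine Eq.trans ?_ (ha.isDistSolOp hμ hφc hφ hσ hL ψ hψ)
  congr 1
  exact integral_congr_ae (hvu.symm.mono fun x hx => by simp only [hx])

end Existence

/-- Existence and uniqueness (Theorem 2.5). For `u₀ ∈ L^∞ ∩ L¹(ℝ^N)` there is a
unique distributional solution `u ∈ L^∞(Q_T) ∩ L¹(Q_T) ∩ C([0,T];L¹_loc(ℝ^N))` of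
`∂_t u − L^μ[φ(u)] = 0` with initial datum `u₀`. -/
theorem existence_and_uniqueness
    (N : ℕ) (hN : 0 < N) (T : ℝ) (hT : 0 < T)
    (φ : ℝ → ℝ) (hφc : Continuous φ) (hφm : Monotone φ)
    (μ : Measure (Euc N)) (hμ : IsLevyMeasure μ)
    (u0 : Euc N → ℝ) (hu0inf : MemLinfRn u0) (hu01 : Integrable u0 (volume : Measure (Euc N))) :
    ∃ u : Euc N → ℝ → ℝ,
      MemLinfQT T u ∧ MemL1QT T u ∧ MemCL1loc T u ∧
      IsDistSolOp T (Lop μ) φ u0 u ∧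
      ∀ v : Euc N → ℝ → ℝ,
        MemLinfQT T v → MemL1QT T v → MemCL1loc T v →
        IsDistSolOp T (Lop μ) φ u0 v →
        ∀ᵐ p ∂(QTvol N T), v p.1 p.2 = u p.1 p.2 := by
  obtain ⟨u, h1, h2, h3, h4⟩ := exists_isDistSolOp hμ hT hφc hφm hu0inf hu01
  exact ⟨u, h1, h2, h3, h4, fun v hv1 hv2 _ hv4 =>
    IsDistSolOp.unique hφc hφm hμ hT h1 h2 h4 hv1 hv2 hv4⟩
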